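/- Let N ≥ 2 and N_f ≥ N + 2 be integers, set Ñ = N_f − N, let p, q ∈ ℂ with 0 < |p| < 1, 0 < |q| < 1, and let s₁, …, s_{N_f}, t₁, …, t_{N_f} ∈ ℂ ∖ {0} and a, b ∈ ℂ ∖ {0} satisfy a^{Ñ} = S := ∏_{i=1}^{N_f} s_i, b^{Ñ} = T := ∏_{i=1}^{N_f} t_i, a = pq·b, and |a| < |s_i| < 1 and 1 < |t_i| < |b| for all i. Then ((p;p)_∞^{N−1}(q;q)_∞^{N−1}/N!) ∫_{𝕋^{N−1}} [∏_{i=1}^{N_f} ∏_{j=1}^{N} Γ(s_i z_j;p,q) Γ(t_i^{−1} z_j^{−1};p,q)] / [∏_{1≤i<j≤N} Γ(z_i z_j^{−1};p,q) Γ(z_i^{−1} z_j;p,q)] ∏_{j=1}^{N−1} dz_j/(2πi z_j) (with z_N = (z₁⋯z_{N−1})^{−1}) equals ((p;p)_∞^{Ñ−1}(q;q)_∞^{Ñ−1}/Ñ!) · ∏_{i,j=1}^{N_f} Γ(s_i t_j^{−1};p,q) · ∫_{𝕋^{Ñ−1}} [∏_{i=1}^{N_f} ∏_{j=1}^{Ñ}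 Γ(a s_i^{−1} z_j;p,q) Γ(b^{−1} t_i z_j^{−1};p,q)] / [∏_{1≤i<j≤Ñ} Γ(z_i z_j^{−1};p,q) Γ(z_i^{−1} z_j;p,q)] ∏_{j=1}^{Ñ−1} dz_j/(2πi z_j) (with z_{Ñ} = (z₁⋯z_{Ñ−1})^{−1}). This is the A_{N−1} ↔ A_{Ñ−1} symmetry transformation expressing the equality of the electric and magnetic superconformal indices of Seiberg's duality for SU(N) SQCD. -/

import Mathlib

open scoped BigOperators

/-- The infinite q-Pochhammer symbol `(x;p)_∞ = ∏_{j≥0} (1 - x p^j)`. -/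
noncomputable def pochInf (x p : ℂ) : ℂ := ∏' j : ℕ, (1 - x * p ^ j)

/-- The elliptic gamma function `Γ(z;p,q)`. -/
noncomputable def ellGamma (z p q : ℂ) : ℂ :=
  ∏' jk : ℕ × ℕ, (1 - z⁻¹ * p ^ (jk.1 + 1) * q ^ (jk.2 + 1)) / (1 - z * p ^ jk.1 * q ^ jk.2)

/-- The contour integral `(2πi)⁻¹ ∮_{𝕋} f(z) dz/z` over the positively oriented
unit circle. -/
noncomputable def circleInt (f : ℂ → ℂ) : ℂ :=
  (2 * (Real.pi : ℂ) * Complex.I)⁻¹ * ∮ z in C(0, 1), f z / z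

/-- The iterated contour integral `∫_{𝕋^n} f ∏_{j=1}^n dz_j/(2πi z_j)`. -/
noncomputable def torusInt : (n : ℕ) → ((Fin n → ℂ) → ℂ) → ℂ
  | 0, f => f Fin.elim0
  | n + 1, f => circleInt fun z => torusInt n fun w => f (Fin.cons z w)

/-- Extension of `N-1` integration variables `z₁,…,z_{N-1}` to `N` variables
with `z_N = (z₁⋯z_{N-1})⁻¹`, so that `z₁⋯z_N = 1`. -/
noncomputable def zfull (N : ℕ) (z : Fin (N - 1) → ℂ) : Fin N → ℂ :=
  fun i => if h : (i : ℕ) < N - 1 then z ⟨i, h⟩ else (∏ j, z j)⁻¹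

namespace SD
open Filter Topology

/-- double infinite product -/
noncomputable def EE (x p q : ℂ) : ℂ := ∏' jk : ℕ × ℕ, (1 + -(x * p ^ jk.1 * q ^ jk.2))

lemma summable_pq {ρ σ : ℝ} (h0 : 0 ≤ ρ) (h1 : ρ < 1) (h0' : 0 ≤ σ) (h1' : σ < 1) (M : ℝ) :
    Summable fun jk : ℕ × ℕ => M * ρ ^ jk.1 * σ ^ jk.2 := by
  have := (summable_geometric_of_lt_one h0 h1).mul_of_nonneg
    (summable_geometric_of_lt_one h0' h1') (fun i => by positivity) (fun i => by positivity)
  simpa [mul_assoc] using this.mul_left M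

lemma summable_EE (x : ℂ) {p q : ℂ} (hp : ‖p‖ < 1) (hq : ‖q‖ < 1) :
    Summable fun jk : ℕ × ℕ => ‖-(x * p ^ jk.1 * q ^ jk.2)‖ := by
  simpa using summable_pq (norm_nonneg p) hp (norm_nonneg q) hq ‖x‖

lemma multipliable_EE (x : ℂ) {p q : ℂ} (hp : ‖p‖ < 1) (hq : ‖q‖ < 1) :
    Multipliable fun jk : ℕ × ℕ => (1 + -(x * p ^ jk.1 * q ^ jk.2)) :=
  multipliable_one_add_of_summable (summable_EE x hp hq)

lemma hasProd_EE (x : ℂ) {p q : ℂ} (hp : ‖p‖ < 1) (hq : ‖q‖ < 1) :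
    HasProd (fun jk : ℕ × ℕ => (1 + -(x * p ^ jk.1 * q ^ jk.2))) (EE x p q) :=
  (multipliable_EE x hp hq).hasProd

lemma EE_ne_zero {x p q : ℂ} (hp : ‖p‖ < 1) (hq : ‖q‖ < 1)
    (h : ∀ j k : ℕ, x * p ^ j * q ^ k ≠ 1) : EE x p q ≠ 0 := by
  refine tprod_one_add_ne_zero_of_summable (fun jk hjk => h jk.1 jk.2 ?_) (summable_EE x hp hq)
  linear_combination -hjk

lemma EE_eq_zero {x p q : ℂ} (j k : ℕ) (h : x * p ^ j * q ^ k = 1) : EE x p q = 0 :=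
  tprod_of_exists_eq_zero ⟨(j, k), by simp [h]⟩

lemma EE_ne_zero_of_lt {x p q : ℂ} (hp : ‖p‖ < 1) (hq : ‖q‖ < 1) (hx : ‖x‖ < 1) :
    EE x p q ≠ 0 := by
  refine EE_ne_zero hp hq fun j k h => ?_
  have h2 : ‖x * p ^ j * q ^ k‖ ≤ ‖x‖ := by
    rw [norm_mul, norm_mul, norm_pow, norm_pow]
    calc ‖x‖ * ‖p‖ ^ j * ‖q‖ ^ k ≤ ‖x‖ * 1 * 1 := by
          gcongr
          · exact pow_le_one₀ (norm_nonneg _) hp.le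
          · exact pow_le_one₀ (norm_nonneg _) hq.le
      _ = ‖x‖ := by ring
  rw [h, norm_one] at h2
  linarith

lemma EE_symm (x p q : ℂ) : EE x p q = EE x q p := by
  unfold EE
  rw [← (Equiv.prodComm ℕ ℕ).tprod_eq]
  congr 1
  ext jk
  simp only [Equiv.prodComm_apply, Prod.fst_swap, Prod.snd_swap]
  ring

lemma pochInf_eq_EE (x p : ℂ) : pochInf x p = EE x p 0 := by
  unfold pochInf EE
  have hinj : Function.Injective (fun j : ℕ => ((j, 0) : ℕ × ℕ)) := fun a b h => by
    simpa using h
  rw [← hinj.tprod_eq]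
  · congr 1; ext j; simp; ring
  · intro jk h
    rcases jk with ⟨j, k⟩
    refine ⟨j, ?_⟩
    by_contra hk
    apply h
    have : k ≠ 0 := fun h' => hk (by simp [h'])
    simp [this]

lemma EE_rec (x : ℂ) {p q : ℂ} (hp : ‖p‖ < 1) (hq : ‖q‖ < 1) :
    EE x p q = pochInf x q * EE (p * x) p q := by
  have hinj1 : Function.Injective (fun j : ℕ => ((0, j) : ℕ × ℕ)) := fun a b h => by
    simpa using h
  have hinj2 : Function.Injective (fun j : ℕ × ℕ => ((j.1 + 1, j.2) : ℕ × ℕ)) := fun a b h => by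
    simpa [Prod.ext_iff] using h
  have hc : IsCompl (Set.range (fun j : ℕ => ((0, j) : ℕ × ℕ)))
      (Set.range (fun j : ℕ × ℕ => ((j.1 + 1, j.2) : ℕ × ℕ))) := by
    constructor
    · rw [Set.disjoint_left]
      rintro _ ⟨a, rfl⟩ ⟨b, hb⟩
      simp at hb
    · rw [codisjoint_iff]
      ext ⟨j, k⟩
      simp only [Set.sup_eq_union, Set.mem_union, Set.mem_range, Set.top_eq_univ, Set.mem_univ,
        iff_true]
      rcases j with _ | j
      · left; exact ⟨k, rfl⟩
      · right; exact ⟨(j, k), rfl⟩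
  have h1 : HasProd ((fun jk : ℕ × ℕ => (1 + -(x * p ^ jk.1 * q ^ jk.2))) ∘
      (fun j : ℕ => ((0, j) : ℕ × ℕ))) (pochInf x q) := by
    have := hasProd_EE x hq (q := 0) (by simp)
    rw [← pochInf_eq_EE] at this
    have hinj : Function.Injective (fun j : ℕ => ((j, 0) : ℕ × ℕ)) := fun a b h => by
      simpa using h
    rw [← hinj.hasProd_iff] at this
    · convert this using 1
      ext j; simp
    · rintro ⟨j, k⟩ h
      have : k ≠ 0 := by
        rintro rfl; exact h ⟨j, rfl⟩
      simp [this]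
  have h2 : HasProd ((fun jk : ℕ × ℕ => (1 + -(x * p ^ jk.1 * q ^ jk.2))) ∘
      (fun j : ℕ × ℕ => ((j.1 + 1, j.2) : ℕ × ℕ))) (EE (p * x) p q) := by
    convert hasProd_EE (p * x) hp hq using 1
    ext j; simp only [Function.comp_apply]; ring
  exact (HasProd.mul_isCompl hc (hinj1.hasProd_range_iff.mpr h1)
    (hinj2.hasProd_range_iff.mpr h2)).tprod_eq

lemma EE_rec' (x : ℂ) {p q : ℂ} (hp : ‖p‖ < 1) (hq : ‖q‖ < 1) :
    EE x p q = pochInf x p * EE (q * x) p q := by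
  rw [EE_symm, EE_rec x hq hp, EE_symm]

@[simp] lemma EE_zero (p q : ℂ) : EE 0 p q = 1 := by simp [EE]

lemma pochInf_rec (x : ℂ) {p : ℂ} (hp : ‖p‖ < 1) :
    pochInf x p = (1 - x) * pochInf (p * x) p := by
  rw [pochInf_eq_EE, EE_rec x hp (by simp), ← pochInf_eq_EE, pochInf_eq_EE x 0]
  congr 1
  rw [EE_rec' x (by simp) (by simp)]
  rw [zero_mul, EE_zero, mul_one]
  unfold pochInf
  rw [tprod_eq_mulSingle 0]
  · simp
  · intro j hj; simp [hj]

lemma ellGamma_eq {z p q : ℂ} (hp : ‖p‖ < 1) (hq : ‖q‖ < 1) :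
    ellGamma z p q = EE (p * q / z) p q / EE z p q := by
  unfold ellGamma
  by_cases h : ∀ j k : ℕ, z * p ^ j * q ^ k ≠ 1
  · have := (hasProd_EE (p * q / z) hp hq).div₀ (hasProd_EE z hp hq) (EE_ne_zero hp hq h)
    rw [← this.tprod_eq]
    congr 1
    ext jk
    congr 1 <;> ring
  · push Not at h
    obtain ⟨j, k, h⟩ := h
    rw [EE_eq_zero j k h, div_zero]
    refine tprod_of_exists_eq_zero ⟨(j, k), ?_⟩
    simp [h]

section cont

lemma EE_tlu {α : Type*} [TopologicalSpace α] [LocallyCompactSpace α] {q : ℂ} (hq : ‖q‖ < 1)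
    (x p : α → ℂ) {K : Set α} (hK : IsOpen K) (hx : ContinuousOn x K) (hp : ContinuousOn p K)
    {M ρ : ℝ} (hρ0 : 0 ≤ ρ) (hρ1 : ρ < 1) (hM : ∀ a ∈ K, ‖x a‖ ≤ M) (hρ : ∀ a ∈ K, ‖p a‖ ≤ ρ) :
    HasProdLocallyUniformlyOn (fun (jk : ℕ × ℕ) a => (1 + -(x a * p a ^ jk.1 * q ^ jk.2)))
      (fun a => EE (x a) (p a) q) K := by
  refine Summable.hasProdLocallyUniformlyOn_one_add (f := fun (jk : ℕ × ℕ) a =>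
      -(x a * p a ^ jk.1 * q ^ jk.2)) hK (summable_pq hρ0 hρ1 (norm_nonneg q) hq M) ?_ ?_
  · refine Eventually.of_forall fun jk a ha => ?_
    rw [norm_neg, norm_mul, norm_mul, norm_pow, norm_pow]
    have := hM a ha
    have := hρ a ha
    have : 0 ≤ M := le_trans (norm_nonneg _) (hM a ha)
    gcongr
  · intro jk
    fun_prop

lemma EE_cont {q : ℂ} (hq : ‖q‖ < 1) :
    ContinuousOn (fun xp : ℂ × ℂ => EE xp.1 xp.2 q) {xp | ‖xp.2‖ < 1} := by
  intro xp hxp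
  obtain ⟨ρ, hρ, hρ1⟩ := exists_between (show ‖xp.2‖ < 1 from hxp)
  let K : Set (ℂ × ℂ) := {y | ‖y.1‖ < ‖xp.1‖ + 1 ∧ ‖y.2‖ < ρ}
  have hK : IsOpen K := by
    exact (isOpen_lt (continuous_fst.norm) continuous_const).inter
      (isOpen_lt (continuous_snd.norm) continuous_const)
  have h := EE_tlu hq (fun y : ℂ × ℂ => y.1) (fun y => y.2) hK (by fun_prop) (by fun_prop)
    (le_trans (norm_nonneg _) hρ.le) hρ1 (fun a ha => ha.1.le) (fun a ha => ha.2.le)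
  have h2 := hasProdLocallyUniformlyOn_iff_tendstoLocallyUniformlyOn.mp h
  have h3 : ContinuousOn (fun xp : ℂ × ℂ => EE xp.1 xp.2 q) K := by
    refine h2.continuousOn (Frequently.of_forall fun s => ?_)
    fun_prop
  exact (h3.continuousAt (hK.mem_nhds ⟨by simp, hρ⟩)).continuousWithinAt

lemma EE_continuousOn {α : Type*} [TopologicalSpace α] {q : ℂ} (hq : ‖q‖ < 1) {s : Set α}
    {x p : α → ℂ} (hx : ContinuousOn x s) (hp : ContinuousOn p s) (h1 : ∀ a ∈ s, ‖p a‖ < 1) :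
    ContinuousOn (fun a => EE (x a) (p a) q) s := by
  intro a ha
  have h2 : ContinuousAt (fun xp : ℂ × ℂ => EE xp.1 xp.2 q) (x a, p a) :=
    (EE_cont hq).continuousAt ((isOpen_lt (continuous_snd.norm) continuous_const).mem_nhds
      (h1 a ha))
  exact ContinuousAt.comp_continuousWithinAt (f := fun a => (x a, p a)) h2
    ((hx a ha).prodMk (hp a ha))

lemma EE_differentiableOn {q : ℂ} (hq : ‖q‖ < 1) {U : Set ℂ} (hU : IsOpen U)
    {x p : ℂ → ℂ} (hx : DifferentiableOn ℂ x U) (hp : DifferentiableOn ℂ p U)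
    (h1 : ∀ a ∈ U, ‖p a‖ < 1) :
    DifferentiableOn ℂ (fun a => EE (x a) (p a) q) U := by
  intro a ha
  obtain ⟨ρ, hρ, hρ1⟩ := exists_between (h1 a ha)
  let K : Set ℂ := U ∩ {y | ‖x y‖ < ‖x a‖ + 1} ∩ {y | ‖p y‖ < ρ}
  have hK1 : IsOpen (U ∩ {y | ‖x y‖ < ‖x a‖ + 1}) :=
    (hx.continuousOn.norm).isOpen_inter_preimage hU isOpen_Iio
  have hK : IsOpen K :=
    ((hp.continuousOn.norm).mono Set.inter_subset_left).isOpen_inter_preimage hK1 isOpen_Iio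
  have hKU : K ⊆ U := fun y hy => hy.1.1
  have h := EE_tlu hq x p hK (hx.continuousOn.mono hKU) (hp.continuousOn.mono hKU)
    (le_trans (norm_nonneg _) hρ.le) hρ1 (fun a ha => (show ‖x a‖ < _ from ha.1.2).le)
    (fun a ha => (show ‖p a‖ < _ from ha.2).le)
  have h2 := hasProdLocallyUniformlyOn_iff_tendstoLocallyUniformlyOn.mp h
  have h3 : DifferentiableOn ℂ (fun a => EE (x a) (p a) q) K := by
    refine h2.differentiableOn (Eventually.of_forall fun s => ?_) hK
    have hx' := hx.mono hKU
    have hp' := hp.mono hKU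
    apply DifferentiableOn.fun_finsetProd
    intro i _
    fun_prop
  exact (h3.differentiableAt (hK.mem_nhds ⟨⟨ha, by simp⟩, hρ⟩)).differentiableWithinAt

end cont

end SD

namespace SD
open Filter Topology MeasureTheory

/-- exponential map on the circle -/
noncomputable def ex (x : UnitAddCircle) : ℂ := (AddCircle.toCircle x : ℂ)

lemma ex_add (x y : UnitAddCircle) : ex (x + y) = ex x * ex y := by
  simp [ex, AddCircle.toCircle_add]

lemma ex_zero : ex 0 = 1 := by simp [ex]

@[simp] lemma norm_ex (x : UnitAddCircle) : ‖ex x‖ = 1 := by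
  unfold ex; exact Circle.norm_coe _

@[simp] lemma ex_ne_zero (x : UnitAddCircle) : ex x ≠ 0 := by
  rw [← norm_ne_zero_iff, norm_ex]; norm_num

lemma ex_neg (x : UnitAddCircle) : ex (-x) = (ex x)⁻¹ := by
  simp [ex, AddCircle.toCircle_neg]

lemma ex_sub (x y : UnitAddCircle) : ex (x - y) = ex x / ex y := by
  rw [sub_eq_add_neg, ex_add, ex_neg, div_eq_mul_inv]

lemma ex_sum {ι : Type*} (s : Finset ι) (x : ι → UnitAddCircle) :
    ex (∑ i ∈ s, x i) = ∏ i ∈ s, ex (x i) := by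
  classical
  induction s using Finset.induction_on with
  | empty => simp [ex_zero]
  | insert a s ha ih => rw [Finset.sum_insert ha, Finset.prod_insert ha, ex_add, ih]

@[fun_prop] lemma continuous_ex : Continuous ex :=
  continuous_subtype_val.comp AddCircle.continuous_toCircle

lemma ex_coe (t : ℝ) : ex (t : UnitAddCircle) = circleMap 0 1 (2 * Real.pi * t) := by
  simp [ex, AddCircle.toCircle_apply_mk, circleMap, Circle.coe_exp]

lemma ex_surj {z : ℂ} (hz : ‖z‖ = 1) : ∃ x, ex x = z := by
  refine ⟨((z.arg / (2 * Real.pi) : ℝ) : UnitAddCircle), ?_⟩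
  rw [ex_coe, mul_div_cancel₀ _ (by positivity)]
  have := Complex.norm_mul_exp_arg_mul_I z
  simp only [circleMap, zero_add]
  rw [hz] at this
  exact_mod_cast this

lemma ex_surj' {z : ℂ} (hz : z ≠ 0) : ∃ x, z = (‖z‖ : ℂ) * ex x := by
  have h0 : (‖z‖ : ℂ) ≠ 0 := by simpa using hz
  obtain ⟨x, hx⟩ := ex_surj (z := z / ‖z‖) (by
    rw [norm_div, Complex.norm_real, norm_norm, div_self (by simpa using hz)])
  exact ⟨x, by rw [hx]; field_simp⟩

lemma circleIntegral_eq_av {R : ℝ} (hR : 0 < R) (f : ℂ → ℂ) :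
    (∮ z in C(0, R), z⁻¹ * f z) = 2 * Real.pi * Complex.I * ∫ x, f (R * ex x) := by
  rw [circleIntegral, ← UnitAddCircle.intervalIntegral_preimage 0]
  have h1 : ∀ θ : ℝ, deriv (circleMap 0 R) θ • ((circleMap 0 R θ)⁻¹ * f (circleMap 0 R θ)) =
      Complex.I * f (circleMap 0 R θ) := by
    intro θ
    have : circleMap 0 R θ ≠ 0 := circleMap_ne_center hR.ne'
    rw [deriv_circleMap, smul_eq_mul]
    field_simp
  simp_rw [h1]
  have h2 : ∀ t : ℝ, f (R * ex (t : UnitAddCircle)) = f (circleMap 0 R (2 * Real.pi * t)) := by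
    intro t
    rw [ex_coe]; simp [circleMap]
  simp_rw [h2]
  have h3 := intervalIntegral.integral_comp_mul_left (a := 0) (b := 0 + 1)
    (fun θ => f (circleMap 0 R θ)) (c := 2 * Real.pi) (by positivity)
  rw [h3]
  simp only [mul_zero, zero_add, mul_one]
  rw [intervalIntegral.integral_const_mul]
  have : (Real.pi : ℂ) ≠ 0 := by exact_mod_cast Real.pi_ne_zero
  simp only [Complex.real_smul]
  push_cast
  field_simp

lemma circleInt_eq (f : ℂ → ℂ) : circleInt f = ∫ x, f (ex x) := by
  unfold circleInt
  have : ∀ z, f z / z = z⁻¹ * f z := fun z => by ring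
  simp_rw [this]
  rw [circleIntegral_eq_av one_pos]
  have : (Real.pi : ℂ) ≠ 0 := by exact_mod_cast Real.pi_ne_zero
  have := Complex.I_ne_zero
  field_simp
  simp

lemma av_phase (f : ℂ → ℂ) {c : ℂ} (hc : c ≠ 0) :
    ∫ x, f (c * ex x) = ∫ x, f (‖c‖ * ex x) := by
  obtain ⟨y, hy⟩ := ex_surj' hc
  rw [← integral_add_left_eq_self (fun x => f (‖c‖ * ex x)) y]
  congr 1; ext x
  rw [ex_add, ← mul_assoc, ← hy]

lemma av_annulus (f : ℂ → ℂ) {c₁ c₂ : ℂ} (hc₁ : c₁ ≠ 0) (hle : ‖c₁‖ ≤ ‖c₂‖)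
    (hf : ∀ z, ‖c₁‖ ≤ ‖z‖ → ‖z‖ ≤ ‖c₂‖ → DifferentiableAt ℂ f z) :
    ∫ x, f (c₁ * ex x) = ∫ x, f (c₂ * ex x) := by
  have h1 : 0 < ‖c₁‖ := by positivity
  have h2 : 0 < ‖c₂‖ := h1.trans_le hle
  rw [av_phase f hc₁, av_phase f (norm_pos_iff.mp h2)]
  have := Complex.circleIntegral_sub_center_inv_smul_eq_of_differentiable_on_annulus_off_countable
    (c := 0) h1 hle (f := f) Set.countable_empty
    (fun z hz => (hf z (by simpa using hz.2) (by simpa using hz.1)).continuousAt.continuousWithinAt)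
    (fun z hz => by
      have h3 : ¬ ‖z‖ ≤ ‖c₁‖ := by simpa using hz.1.2
      have h4 : ‖z‖ < ‖c₂‖ := by simpa using hz.1.1
      exact hf z (not_le.mp h3).le h4.le)
  simp only [sub_zero, smul_eq_mul] at this
  rw [circleIntegral_eq_av h1, circleIntegral_eq_av h2] at this
  have h4 := mul_left_cancel₀ Complex.two_pi_I_ne_zero this
  exact h4.symm

lemma av_annulus' (f : ℂ → ℂ) {c₁ c₂ : ℂ} (hc₁ : c₁ ≠ 0) (hc₂ : c₂ ≠ 0)
    (hf : ∀ z, min ‖c₁‖ ‖c₂‖ ≤ ‖z‖ → ‖z‖ ≤ max ‖c₁‖ ‖c₂‖ → DifferentiableAt ℂ f z) :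
    ∫ x, f (c₁ * ex x) = ∫ x, f (c₂ * ex x) := by
  rcases le_total ‖c₁‖ ‖c₂‖ with h | h
  · exact av_annulus f hc₁ h (fun z h1 h2 => hf z (by simpa [h] using h1) (by simpa [h] using h2))
  · exact (av_annulus f hc₂ h
      (fun z h1 h2 => hf z (by simpa [h] using h1) (by simpa [h] using h2))).symm

lemma integrable_cc {α : Type*} [TopologicalSpace α] [CompactSpace α] [MeasurableSpace α]
    [BorelSpace α] (μ : Measure α) [IsFiniteMeasure μ] {f : α → ℂ}
    (hf : Continuous f) : Integrable f μ :=
  hf.integrable_of_hasCompactSupport (HasCompactSupport.of_compactSpace f)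

lemma av_outer {R : ℝ} {z₀ : ℂ} (hR : ‖z₀‖ < R) :
    ∫ x, (1 - z₀ / (R * ex x))⁻¹ = 1 := by
  have hR0 : 0 < R := (norm_nonneg _).trans_lt hR
  have h1 := circleIntegral_eq_av hR0 (fun z => (1 - z₀ / z)⁻¹)
  have h2 : (∮ z in C(0, R), z⁻¹ * (1 - z₀ / z)⁻¹) = ∮ z in C(0, R), (z - z₀)⁻¹ := by
    refine circleIntegral.integral_congr hR0.le fun z hz => ?_
    have hz : ‖z‖ = R := by simpa using hz
    have : z ≠ 0 := norm_pos_iff.mp (hz ▸ hR0)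
    rw [← mul_inv]
    congr 1; field_simp
  rw [h2, circleIntegral.integral_sub_inv_of_mem_ball (by simpa using hR)] at h1
  have := mul_left_cancel₀ Complex.two_pi_I_ne_zero ((mul_one _).trans h1)
  exact this.symm

lemma av_inner {R : ℝ} (hR0 : 0 < R) {z₀ : ℂ} (hR : R < ‖z₀‖) :
    ∫ x, (1 - z₀ / (R * ex x))⁻¹ = 0 := by
  have h1 := circleIntegral_eq_av hR0 (fun z => (1 - z₀ / z)⁻¹)
  have h2 : (∮ z in C(0, R), z⁻¹ * (1 - z₀ / z)⁻¹) = ∮ z in C(0, R), (z - z₀)⁻¹ := by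
    refine circleIntegral.integral_congr hR0.le fun z hz => ?_
    have hz : ‖z‖ = R := by simpa using hz
    have : z ≠ 0 := norm_pos_iff.mp (hz ▸ hR0)
    rw [← mul_inv]
    congr 1; field_simp
  have h3 : (∮ z in C(0, R), (z - z₀)⁻¹) = 0 := by
    refine DiffContOnCl.circleIntegral_eq_zero hR0.le ?_
    refine DifferentiableOn.diffContOnCl (s := Metric.ball 0 R) ?_
    intro z hz
    have hz : ‖z‖ ≤ R := by simpa using Metric.closure_ball_subset_closedBall hz
    have : z - z₀ ≠ 0 := fun h => by rw [sub_eq_zero] at h; rw [h] at hz; linarith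
    exact ((differentiableAt_id.sub_const z₀).inv this).differentiableWithinAt
  rw [h2, h3] at h1
  exact (mul_eq_zero.mp h1.symm).resolve_left Complex.two_pi_I_ne_zero

lemma av_residue (K : ℂ → ℂ) {r R : ℝ} {z₀ : ℂ} (hr : 0 < r) (h1 : r < ‖z₀‖) (h2 : ‖z₀‖ < R)
    (hK : ∀ z, r ≤ ‖z‖ → ‖z‖ ≤ R → DifferentiableAt ℂ K z) :
    (∫ x, K (R * ex x) / (1 - z₀ / (R * ex x))) - ∫ x, K (r * ex x) / (1 - z₀ / (r * ex x)) =
      K z₀ := by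
  have hR : 0 < R := hr.trans (h1.trans h2)
  let g : ℂ → ℂ := fun z => z * dslope K z₀ z
  have hz0 : z₀ ∈ {z : ℂ | r < ‖z‖ ∧ ‖z‖ < R} := ⟨h1, h2⟩
  have hopen : IsOpen {z : ℂ | r < ‖z‖ ∧ ‖z‖ < R} :=
    (isOpen_lt continuous_const continuous_norm).inter (isOpen_lt continuous_norm continuous_const)
  have hg : ∀ z, r ≤ ‖z‖ → ‖z‖ ≤ R → DifferentiableAt ℂ g z := by
    intro z hz1 hz2
    refine differentiableAt_id.mul ?_
    by_cases hz : z = z₀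
    · subst hz
      have : DifferentiableOn ℂ (dslope K z) {z : ℂ | r < ‖z‖ ∧ ‖z‖ < R} :=
        (Complex.differentiableOn_dslope (hopen.mem_nhds hz0)).mpr
          fun w hw => (hK w hw.1.le hw.2.le).differentiableWithinAt
      exact this.differentiableAt (hopen.mem_nhds hz0)
    · exact (differentiableAt_dslope_of_ne hz).mpr (hK z hz1 hz2)
  have key : ∀ ρ : ℝ, 0 < ρ → r ≤ ρ → ρ ≤ R → ρ ≠ ‖z₀‖ →
      ∫ x, K (ρ * ex x) / (1 - z₀ / (ρ * ex x)) =
        K z₀ * (∫ x, (1 - z₀ / (ρ * ex x))⁻¹) + ∫ x, g (ρ * ex x) := by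
    intro ρ hρ hρ1 hρ2 hρ3
    have hne : ∀ x, (ρ * ex x : ℂ) ≠ 0 := fun x => by simp [hρ.ne']
    have hnorm : ∀ x, ‖(ρ * ex x : ℂ)‖ = ρ := fun x => by simp [abs_of_pos hρ]
    have hne2 : ∀ x, (ρ * ex x : ℂ) - z₀ ≠ 0 := fun x h => by
      rw [sub_eq_zero] at h
      exact hρ3 (by rw [← h, hnorm])
    have hne3 : ∀ x, 1 - z₀ / (ρ * ex x : ℂ) ≠ 0 := fun x h => by
      apply hne2 x
      have h7 : z₀ / (ρ * ex x : ℂ) * (ρ * ex x) = z₀ := div_mul_cancel₀ _ (hne x)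
      linear_combination h7 + (ρ * ex x : ℂ) * h
    rw [← integral_const_mul, ← integral_add]
    · congr 1; ext x
      simp only [g]
      have h5 : dslope K z₀ (ρ * ex x) = (K (ρ * ex x) - K z₀) / (ρ * ex x - z₀) := by
        rw [dslope_of_ne _ (sub_ne_zero.mp (hne2 x)), slope_def_field]
      rw [h5]
      have h6 : 1 - z₀ / (ρ * ex x : ℂ) = (ρ * ex x - z₀) / (ρ * ex x) := by
        rw [sub_div, div_self (hne x)]
      rw [h6]
      have := hne x
      have := hne2 x
      have := ex_ne_zero x
      have : (ρ : ℂ) ≠ 0 := by exact_mod_cast hρ.ne'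
      field_simp
      ring
    · apply integrable_cc
      refine continuous_const.mul (Continuous.inv₀ ?_ hne3)
      exact continuous_const.sub (continuous_const.div (by fun_prop) hne)
    · apply integrable_cc
      rw [continuous_iff_continuousAt]
      intro x
      exact ContinuousAt.comp (f := fun x => (ρ * ex x : ℂ)) (g := g)
        (hg _ (by rw [hnorm]; exact hρ1) (by rw [hnorm]; exact hρ2)).continuousAt
        (by fun_prop)
  rw [key R hR (h1.trans h2).le le_rfl h2.ne', key r hr le_rfl (h1.trans h2).le h1.ne,
    av_outer h2, av_inner hr h1]
  have := av_annulus g (c₁ := r) (c₂ := R) (by exact_mod_cast hr.ne')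
    (by simpa [abs_of_pos hr, abs_of_pos hR] using (h1.trans h2).le)
    (fun z hz1 hz2 => hg z (by simpa [abs_of_pos hr] using hz1) (by simpa [abs_of_pos hR] using hz2))
  rw [this]; ring

lemma fourier_unique {f : UnitAddCircle → ℂ} (hf : Continuous f)
    (h : ∀ k : ℤ, ∫ x, ex x ^ k * f x = 0) : f = 0 := by
  let F : C(UnitAddCircle, ℂ) := ⟨f, hf⟩
  have hc : ∀ n, fourierCoeff F n = 0 := by
    intro n
    rw [fourierCoeff, AddCircle.integral_haarAddCircle]
    have := h (-n)
    simp only [fourier_apply, AddCircle.toCircle_zsmul, smul_eq_mul]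
    simp only [ex] at this
    push_cast
    simp only [F, ContinuousMap.coe_mk]
    rw [this]; simp
  have h2 := has_pointwise_sum_fourier_series_of_summable (f := F) (by
    have : fourierCoeff F = 0 := funext hc
    rw [this]; exact summable_zero)
  ext x
  have h3 := h2 x
  simp only [hc, zero_smul] at h3
  exact h3.unique hasSum_zero

end SD

namespace SD
open Filter Topology MeasureTheory

lemma integral_cons {n : ℕ} {F : (Fin (n + 1) → UnitAddCircle) → ℂ} (hF : Continuous F) :
    ∫ x, F x = ∫ y, ∫ w, F (Fin.cons y w) := by
  have h := (volume_preserving_piFinSuccAbove (fun _ : Fin (n + 1) => UnitAddCircle) 0).symm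
  rw [← h.integral_comp' (g := F)]
  have hc : Continuous fun z : UnitAddCircle × (Fin n → UnitAddCircle) =>
      F (Fin.cons z.1 z.2) := by
    apply hF.comp
    exact Continuous.finCons continuous_fst continuous_snd
  have e : ∀ z : UnitAddCircle × (Fin n → UnitAddCircle),
      F ((MeasurableEquiv.piFinSuccAbove (fun _ : Fin (n + 1) => UnitAddCircle) 0).symm z) =
        F (Fin.cons z.1 z.2) := by
    intro z
    congr 1
    simp [MeasurableEquiv.piFinSuccAbove, Fin.insertNthEquiv]
  simp_rw [e]
  exact integral_prod _ (integrable_cc _ hc)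

lemma integral_snoc {n : ℕ} {F : (Fin (n + 1) → UnitAddCircle) → ℂ} (hF : Continuous F) :
    ∫ x, F x = ∫ w : Fin n → UnitAddCircle, ∫ y,
      F (Fin.snoc (α := fun _ => UnitAddCircle) w y) := by
  have h := (volume_preserving_piFinSuccAbove (fun _ : Fin (n + 1) => UnitAddCircle)
    (Fin.last n)).symm
  rw [← h.integral_comp' (g := F)]
  have hc : Continuous fun z : UnitAddCircle × (Fin n → UnitAddCircle) =>
      F (Fin.snoc (α := fun _ => UnitAddCircle) z.2 z.1) := by
    apply hF.comp
    exact Continuous.finSnoc continuous_snd continuous_fst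
  have e : ∀ z : UnitAddCircle × (Fin n → UnitAddCircle),
      F ((MeasurableEquiv.piFinSuccAbove (fun _ : Fin (n + 1) => UnitAddCircle)
        (Fin.last n)).symm z) = F (Fin.snoc (α := fun _ => UnitAddCircle) z.2 z.1) := by
    intro z
    congr 1
    simp [MeasurableEquiv.piFinSuccAbove, Fin.insertNthEquiv, Fin.insertNth_last']
  simp_rw [e]
  exact integral_prod_symm _ (integrable_cc _ hc)

lemma torusInt_eq (n : ℕ) (f : (Fin n → ℂ) → ℂ)
    (hf : Continuous fun x : Fin n → UnitAddCircle => f (fun j => ex (x j))) :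
    torusInt n f = ∫ x : Fin n → UnitAddCircle, f (fun j => ex (x j)) := by
  induction n with
  | zero =>
    rw [torusInt, volume_pi, Measure.pi_of_empty, integral_dirac]
    congr 1; ext j; exact j.elim0
  | succ n ih =>
    rw [torusInt, circleInt_eq, integral_cons hf]
    congr 1; ext y
    have e : ∀ w : Fin n → UnitAddCircle, (fun j => ex ((Fin.cons y w : Fin (n + 1) → _) j)) =
        Fin.cons (ex y) (fun j => ex (w j)) := by
      intro w; ext j
      refine Fin.cases ?_ (fun j => ?_) j <;> simp
    rw [ih]
    · simp_rw [e]
    · have : Continuous fun w : Fin n → UnitAddCircle =>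
        (fun x : Fin (n + 1) → UnitAddCircle => f (fun j => ex (x j))) (Fin.cons y w) :=
        hf.comp (Continuous.finCons continuous_const continuous_id)
      simpa only [e] using this

/-- constrained integral, with `∑ x = y` -/
noncomputable def cInt (n : ℕ) (F : (Fin (n + 1) → UnitAddCircle) → ℂ) (y : UnitAddCircle) : ℂ :=
  ∫ w : Fin n → UnitAddCircle, F (Fin.snoc (α := fun _ => UnitAddCircle) w (y - ∑ j, w j))

lemma cInt_aux {n : ℕ} {F : (Fin (n + 1) → UnitAddCircle) → ℂ} (hF : Continuous F) :
    Continuous fun z : UnitAddCircle × (Fin n → UnitAddCircle) =>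
      F (Fin.snoc (α := fun _ => UnitAddCircle) z.2 (z.1 - ∑ j, z.2 j)) := by
  apply hF.comp
  refine Continuous.finSnoc continuous_snd ?_
  fun_prop

lemma cInt_continuous {n : ℕ} {F : (Fin (n + 1) → UnitAddCircle) → ℂ} (hF : Continuous F) :
    Continuous (cInt n F) := by
  have := continuous_parametric_integral_of_continuous (μ := volume)
    (f := fun (y : UnitAddCircle) (w : Fin n → UnitAddCircle) =>
      F (Fin.snoc (α := fun _ => UnitAddCircle) w (y - ∑ j, w j))) (cInt_aux hF) isCompact_univ
  simp only [setIntegral_univ] at this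
  exact this

lemma integral_constraint {n : ℕ} {F : (Fin (n + 1) → UnitAddCircle) → ℂ} (hF : Continuous F)
    {g : UnitAddCircle → ℂ} (hg : Continuous g) :
    ∫ x, g (∑ j, x j) * F x = ∫ y, g y * cInt n F y := by
  have hc : Continuous fun x : Fin (n + 1) → UnitAddCircle => g (∑ j, x j) * F x := by fun_prop
  rw [integral_snoc hc]
  have e1 : ∀ w : Fin n → UnitAddCircle,
      ∫ y, g (∑ j, (Fin.snoc (α := fun _ => UnitAddCircle) w y : Fin (n + 1) → _) j) *
        F (Fin.snoc (α := fun _ => UnitAddCircle) w y) =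
      ∫ y, g y * F (Fin.snoc (α := fun _ => UnitAddCircle) w (y - ∑ j, w j)) := by
    intro w
    rw [← integral_sub_right_eq_self _ (∑ j, w j)]
    congr 1; ext y
    congr 2
    rw [Fin.sum_univ_castSucc]
    simp
  simp_rw [e1]
  have hc2 : Continuous (fun z : UnitAddCircle × (Fin n → UnitAddCircle) =>
      g z.1 * F (Fin.snoc (α := fun _ => UnitAddCircle) z.2 (z.1 - ∑ j, z.2 j))) :=
    (hg.comp continuous_fst).mul (cInt_aux hF)
  rw [← integral_integral_swap (f := fun (y : UnitAddCircle) (w : Fin n → UnitAddCircle) =>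
      g y * F (Fin.snoc (α := fun _ => UnitAddCircle) w (y - ∑ j, w j)))
      (integrable_cc _ hc2)]
  congr 1; ext y
  rw [integral_const_mul, cInt]

lemma differentiableOn_integral {α : Type*} [TopologicalSpace α] [CompactSpace α]
    [SecondCountableTopology α] [MeasurableSpace α] [BorelSpace α] (μ : Measure α)
    [IsFiniteMeasure μ]
    {U : Set ℂ} (hU : IsOpen U) (h : ℂ → α → ℂ)
    (hc : ContinuousOn (fun z : ℂ × α => h z.1 z.2) (U ×ˢ Set.univ))
    (hd : ∀ x, DifferentiableOn ℂ (fun τ => h τ x) U) :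
    DifferentiableOn ℂ (fun τ => ∫ x, h τ x ∂μ) U := by
  intro τ₀ hτ₀
  obtain ⟨ε, hε, hball⟩ := Metric.isOpen_iff.mp hU τ₀ hτ₀
  have hcx : ∀ τ ∈ U, Continuous (h τ) := by
    intro τ hτ
    rw [continuous_iff_continuousAt]
    intro x
    have h1 : ContinuousAt (fun z : ℂ × α => h z.1 z.2) (τ, x) :=
      hc.continuousAt ((hU.prod isOpen_univ).mem_nhds ⟨hτ, trivial⟩)
    exact ContinuousAt.comp (f := fun x => (τ, x)) h1 (by fun_prop)
  have hcl : Metric.closedBall τ₀ (ε / 2) ⊆ U :=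
    (Metric.closedBall_subset_ball (by linarith)).trans hball
  have hcomp : IsCompact (Metric.closedBall τ₀ (ε / 2) ×ˢ (Set.univ : Set α)) :=
    (isCompact_closedBall _ _).prod isCompact_univ
  obtain ⟨M, hM⟩ := hcomp.exists_bound_of_continuousOn
    (hc.mono (Set.prod_mono hcl subset_rfl))
  have hder : ∀ x, ∀ τ ∈ Metric.ball τ₀ (ε / 4), ‖deriv (fun τ => h τ x) τ‖ ≤ M / (ε / 4) := by
    intro x τ hτ
    have hsub : Metric.closedBall τ (ε / 4) ⊆ Metric.closedBall τ₀ (ε / 2) := by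
      apply Metric.closedBall_subset_closedBall'
      have := Metric.mem_ball.mp hτ
      linarith
    refine Complex.norm_deriv_le_of_forall_mem_sphere_norm_le (by positivity) ?_ ?_
    · apply DifferentiableOn.diffContOnCl
      rw [closure_ball _ (by positivity)]
      exact (hd x).mono (hsub.trans hcl)
    · intro z hz
      exact hM (z, x) ⟨hsub (Metric.sphere_subset_closedBall hz), trivial⟩
  have hb4 : Metric.ball τ₀ (ε / 4) ⊆ U :=
    (Metric.ball_subset_ball (by linarith)).trans hball
  have hda : ∀ x, ∀ τ ∈ Metric.ball τ₀ (ε / 4),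
      HasDerivAt (fun τ => h τ x) (deriv (fun τ => h τ x) τ) τ := fun x τ hτ =>
    ((hd x).differentiableAt (hU.mem_nhds (hb4 hτ))).hasDerivAt
  have key := hasDerivAt_integral_of_dominated_loc_of_deriv_le (μ := μ) (𝕜 := ℂ)
    (F := h) (F' := fun τ x => deriv (fun τ => h τ x) τ) (x₀ := τ₀)
    (s := Metric.ball τ₀ (ε / 4)) (bound := fun _ => M / (ε / 4))
    (Metric.ball_mem_nhds _ (by positivity)) ?_ ?_ ?_ ?_ ?_ ?_
  · exact key.2.differentiableAt.differentiableWithinAt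
  · filter_upwards [hU.mem_nhds hτ₀] with τ hτ
    exact (hcx τ hτ).aestronglyMeasurable
  · exact integrable_cc _ (hcx τ₀ hτ₀)
  · -- measurability of derivative
    let u : ℕ → ℂ := fun n => τ₀ + ((ε / 4 / (n + 2) : ℝ) : ℂ)
    have hu0 : ∀ n : ℕ, 0 < ε / 4 / ((n : ℝ) + 2) := fun n => by positivity
    have hu : ∀ n, u n ∈ Metric.ball τ₀ (ε / 4) := by
      intro n
      simp only [u, Metric.mem_ball, dist_self_add_left, Complex.norm_real, Real.norm_eq_abs]
      rw [abs_of_pos (hu0 n)]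
      apply div_lt_self (by positivity)
      have : (0 : ℝ) ≤ n := Nat.cast_nonneg n
      linarith
    have hune : ∀ n, u n ≠ τ₀ := by
      intro n hn
      simp only [u, add_eq_left] at hn
      exact (hu0 n).ne' (by exact_mod_cast hn)
    have hut : Tendsto u atTop (𝓝[≠] τ₀) := by
      refine tendsto_nhdsWithin_iff.mpr ⟨?_, Eventually.of_forall hune⟩
      have h1 : Tendsto (fun n : ℕ => ε / 4 / ((n : ℝ) + 2)) atTop (𝓝 0) :=
        tendsto_const_nhds.div_atTop
          (tendsto_atTop_add_const_right _ _ tendsto_natCast_atTop_atTop)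
      have h2 : Tendsto (fun n : ℕ => ((ε / 4 / ((n : ℝ) + 2) : ℝ) : ℂ)) atTop (𝓝 0) := by
        exact (Complex.continuous_ofReal.tendsto 0).comp h1
      simpa [u] using h2.const_add τ₀
    refine aestronglyMeasurable_of_tendsto_ae atTop
      (f := fun n x => slope (fun τ => h τ x) τ₀ (u n)) ?_ ?_
    · intro n
      simp only [slope_def_field]
      exact (((hcx _ (hb4 (hu n))).sub (hcx _ hτ₀)).div_const _).aestronglyMeasurable
    · refine Eventually.of_forall fun x => ?_
      exact (hasDerivAt_iff_tendsto_slope.mp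
        (hda x τ₀ (Metric.mem_ball_self (by positivity)))).comp hut
  · exact Eventually.of_forall fun x τ hτ => hder x τ hτ
  · exact integrable_const _
  · exact Eventually.of_forall fun x τ hτ => hda x τ hτ

end SD

namespace SD
open Filter Topology MeasureTheory

lemma pochInf_ne_zero {x p : ℂ} (hp : ‖p‖ < 1) (h : ∀ j : ℕ, x * p ^ j ≠ 1) : pochInf x p ≠ 0 := by
  rw [pochInf_eq_EE]
  refine EE_ne_zero hp (by simp) fun j k => ?_
  rcases Nat.eq_zero_or_pos k with rfl | hk
  · simpa using h j
  · simp [hk.ne']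

lemma pochInf_ne_zero_of_lt {x p : ℂ} (hp : ‖p‖ < 1) (hx : ‖x‖ < 1) : pochInf x p ≠ 0 := by
  rw [pochInf_eq_EE]; exact EE_ne_zero_of_lt hp (by simp) hx

lemma pochInf_differentiable {p : ℂ} (hp : ‖p‖ < 1) : Differentiable ℂ (fun x => pochInf x p) := by
  simp_rw [pochInf_eq_EE]
  rw [← differentiableOn_univ]
  exact EE_differentiableOn (by simp) isOpen_univ differentiableOn_id
    (differentiableOn_const _) (fun _ _ => hp)

lemma pochInf_one (p : ℂ) : pochInf 1 p = 0 := tprod_of_exists_eq_zero ⟨0, by simp⟩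

/-- theta function -/
noncomputable def th (p x : ℂ) : ℂ := pochInf x p * pochInf (p / x) p

section
variable {p : ℂ}

lemma th_one : th p 1 = 0 := by simp [th, pochInf_one]

lemma th_mul_p (hp0 : p ≠ 0) (hp : ‖p‖ < 1) {x : ℂ} (hx : x ≠ 0) :
    th p (p * x) = -x⁻¹ * th p x := by
  unfold th
  rw [show p / (p * x) = x⁻¹ by field_simp, pochInf_rec x hp, pochInf_rec x⁻¹ hp, div_eq_mul_inv]
  field_simp
  ring

lemma th_inv (hp0 : p ≠ 0) (hp : ‖p‖ < 1) {x : ℂ} (hx : x ≠ 0) :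
    th p x⁻¹ = -x⁻¹ * th p x := by
  rw [← th_mul_p hp0 hp hx]
  unfold th
  rw [show p / (p * x) = x⁻¹ by field_simp, show p / x⁻¹ = p * x by field_simp]
  ring

lemma th_p_div (hp0 : p ≠ 0) {x : ℂ} (hx : x ≠ 0) : th p (p / x) = th p x := by
  unfold th
  rw [show p / (p / x) = x by field_simp]
  ring

lemma th_ne_zero_of_annulus (hp : ‖p‖ < 1) {x : ℂ} (h1 : ‖p‖ < ‖x‖) (h2 : ‖x‖ < 1) :
    th p x ≠ 0 := by
  refine mul_ne_zero (pochInf_ne_zero_of_lt hp h2) (pochInf_ne_zero_of_lt hp ?_)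
  rw [norm_div, div_lt_one (lt_of_le_of_lt (norm_nonneg _) h1)]
  exact h1

lemma th_ne_zero (hp0 : p ≠ 0) (hp : ‖p‖ < 1) {x : ℂ} (hx : x ≠ 0) (h : ∀ k : ℤ, x ≠ p ^ k) :
    th p x ≠ 0 := by
  refine mul_ne_zero (pochInf_ne_zero hp fun j hj => ?_) (pochInf_ne_zero hp fun j hj => ?_)
  · apply h (-(j : ℤ))
    rw [zpow_neg, zpow_natCast]
    exact eq_inv_of_mul_eq_one_left hj
  · apply h (j + 1)
    rw [zpow_add₀ hp0, zpow_natCast, zpow_one]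
    field_simp at hj
    rw [← hj]; ring

lemma th_differentiableAt (hp : ‖p‖ < 1) {x : ℂ} (hx : x ≠ 0) :
    DifferentiableAt ℂ (th p) x := by
  unfold th
  refine (pochInf_differentiable hp x).mul ?_
  exact (DifferentiableAt.comp (g := fun x => pochInf x p) (f := fun x => p / x) x
    (pochInf_differentiable hp _) ((differentiableAt_const p).div differentiableAt_id hx))

lemma th_continuousOn (hp : ‖p‖ < 1) {α : Type*} [TopologicalSpace α] {f : α → ℂ}
    (hf : Continuous f) (h0 : ∀ a, f a ≠ 0) : Continuous fun a => th p (f a) := by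
  rw [continuous_iff_continuousAt]
  intro a
  exact ContinuousAt.comp (f := f) (th_differentiableAt hp (h0 a)).continuousAt hf.continuousAt

/-- antisymmetric theta -/
noncomputable def dl (p x y : ℂ) : ℂ := y * th p (x / y)

lemma dl_antisymm (hp0 : p ≠ 0) (hp : ‖p‖ < 1) {x y : ℂ} (hx : x ≠ 0) (hy : y ≠ 0) :
    dl p y x = -dl p x y := by
  unfold dl
  rw [show y / x = (x / y)⁻¹ by field_simp, th_inv hp0 hp (div_ne_zero hx hy)]
  field_simp

lemma dl_smul {c x y : ℂ} (hc : c ≠ 0) : dl p (c * x) (c * y) = c * dl p x y := by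
  unfold dl
  rw [mul_div_mul_left _ _ hc]; ring

/-- degree two functions -/
lemma deg_two_unique (hp0 : p ≠ 0) (hp : ‖p‖ < 1) (g : ℂ → ℂ)
    (hg : ∀ x, x ≠ 0 → DifferentiableAt ℂ g x)
    (hq : ∀ x, x ≠ 0 → g (p * x) = (x ^ 2)⁻¹ * g x)
    (h0 : ∫ x, g (ex x) = 0) (h1 : ∫ x, (ex x)⁻¹ * g (ex x) = 0) :
    ∀ x, x ≠ 0 → g x = 0 := by
  let b : ℤ → ℂ → ℂ := fun k c => ∫ x, (c * ex x) ^ (-k) * g (c * ex x)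
  have hb : ∀ k c c', c ≠ 0 → c' ≠ 0 → b k c = b k c' := by
    intro k c c' hc hc'
    refine av_annulus' (fun z => z ^ (-k) * g z) hc hc' fun z hz _ => ?_
    have hz0 : z ≠ 0 := by
      rw [← norm_pos_iff]
      exact lt_of_lt_of_le (lt_min (norm_pos_iff.mpr hc) (norm_pos_iff.mpr hc')) hz
    exact (differentiableAt_zpow.mpr (Or.inl hz0)).mul (hg z hz0)
  have hrec : ∀ k, b k 1 = p ^ (-k) * b (k + 2) 1 := by
    intro k
    rw [hb k 1 p one_ne_zero hp0]
    simp only [b]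
    rw [← integral_const_mul]
    congr 1; ext x
    rw [hq _ (ex_ne_zero x), one_mul, mul_zpow, neg_add, zpow_add₀ (ex_ne_zero x)]
    simp only [zpow_neg, zpow_ofNat]
    ring
  have hz : ∀ k : ℤ, b k 1 = 0 ∧ b (k + 1) 1 = 0 := by
    intro k
    induction k using Int.induction_on with
    | zero => constructor <;> simp [b, h0, h1]
    | succ i ih =>
      refine ⟨ih.2, ?_⟩
      have := hrec i
      rw [ih.1] at this
      have h3 := (mul_eq_zero.mp this.symm).resolve_left (zpow_ne_zero _ hp0)
      rw [show (i : ℤ) + 1 + 1 = i + 2 by ring]; exact h3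
    | pred i ih =>
      refine ⟨?_, by simpa using ih.1⟩
      rw [hrec]
      rw [show (-(i : ℤ) - 1 + 2) = -i + 1 by ring, ih.2, mul_zero]
  intro c hc
  have hfc : Continuous fun x => g (c * ex x) := by
    rw [continuous_iff_continuousAt]
    intro x
    exact ContinuousAt.comp (f := fun x => c * ex x) (g := g)
      (hg _ (mul_ne_zero hc (ex_ne_zero x))).continuousAt (by fun_prop)
  have h5 := fourier_unique hfc (by
    intro k
    have h6 := (hz (-k)).1
    rw [hb (-k) 1 c one_ne_zero hc] at h6
    simp only [b, neg_neg, mul_zpow] at h6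
    simp_rw [mul_assoc] at h6
    rw [integral_const_mul] at h6
    exact (mul_eq_zero.mp h6).resolve_left (zpow_ne_zero _ hc))
  have := congrFun h5 0
  simpa [ex_zero] using this

/-- auxiliary kernel -/
noncomputable def kk (p x y : ℂ) : ℂ := x⁻¹ * (th p (x * y) * th p (x / y))

lemma kk_antisymm (hp0 : p ≠ 0) (hp : ‖p‖ < 1) {x y : ℂ} (hx : x ≠ 0) (hy : y ≠ 0) :
    kk p y x = -kk p x y := by
  unfold kk
  rw [show y / x = (x / y)⁻¹ by field_simp, th_inv hp0 hp (div_ne_zero hx hy), mul_comm y x]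
  field_simp

lemma kk_self (x : ℂ) (hx : x ≠ 0) : kk p x x = 0 := by
  simp [kk, div_self hx, th_one]

lemma kk_pf (hp0 : p ≠ 0) (hp : ‖p‖ < 1) {x y₁ y₂ y₃ : ℂ} (hx : x ≠ 0) (h₁ : y₁ ≠ 0)
    (h₂ : y₂ ≠ 0) (h₃ : y₃ ≠ 0) :
    kk p y₂ y₃ * kk p x y₁ - kk p y₁ y₃ * kk p x y₂ + kk p y₁ y₂ * kk p x y₃ = 0 := by
  let f : ℂ → ℂ → ℂ := fun y x => th p (x * y) * th p (x / y)
  have fd : ∀ y, y ≠ 0 → ∀ x, x ≠ 0 → DifferentiableAt ℂ (f y) x := by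
    intro y hy x hx
    refine DifferentiableAt.mul ?_ ?_
    · exact DifferentiableAt.comp (g := th p) (f := fun x => x * y) x
        (th_differentiableAt hp (mul_ne_zero hx hy)) (by fun_prop)
    · exact DifferentiableAt.comp (g := th p) (f := fun x => x / y) x
        (th_differentiableAt hp (div_ne_zero hx hy)) (by fun_prop)
  have fp : ∀ y, y ≠ 0 → ∀ x, x ≠ 0 → f y (p * x) = (x ^ 2)⁻¹ * f y x := by
    intro y hy x hx
    simp only [f]
    rw [mul_assoc, mul_div_assoc, th_mul_p hp0 hp (mul_ne_zero hx hy),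
      th_mul_p hp0 hp (div_ne_zero hx hy)]
    field_simp
  have fc : ∀ y, y ≠ 0 → Continuous fun x => f y (ex x) := by
    intro y hy
    rw [continuous_iff_continuousAt]
    intro x
    exact ContinuousAt.comp (f := ex) (g := f y) (fd y hy _ (ex_ne_zero x)).continuousAt
      (by fun_prop)
  have fc' : ∀ y, y ≠ 0 → Continuous fun x => (ex x)⁻¹ * f y (ex x) := by
    intro y hy
    exact (continuous_ex.inv₀ ex_ne_zero).mul (fc y hy)
  let I0 : ℂ → ℂ := fun y => ∫ x, f y (ex x)
  let I1 : ℂ → ℂ := fun y => ∫ x, (ex x)⁻¹ * f y (ex x)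
  let A : Matrix (Fin 2) (Fin 3) ℂ := !![I0 y₁, I0 y₂, I0 y₃; I1 y₁, I1 y₂, I1 y₃]
  have hker := LinearMap.ker_ne_bot_of_finrank_lt (f := A.mulVecLin) (by simp)
  obtain ⟨α, hα, hα0⟩ := Submodule.exists_mem_ne_zero_of_ne_bot hker
  have hα' : A.mulVec α = 0 := by simpa using hα
  have e0 : I0 y₁ * α 0 + I0 y₂ * α 1 + I0 y₃ * α 2 = 0 := by
    have := congrFun hα' 0
    simpa [A, Matrix.mulVec, dotProduct, Fin.sum_univ_three] using this
  have e1 : I1 y₁ * α 0 + I1 y₂ * α 1 + I1 y₃ * α 2 = 0 := by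
    have := congrFun hα' 1
    simpa [A, Matrix.mulVec, dotProduct, Fin.sum_univ_three] using this
  let g : ℂ → ℂ := fun x => f y₁ x * α 0 + f y₂ x * α 1 + f y₃ x * α 2
  have hg : ∀ x, x ≠ 0 → g x = 0 := by
    refine deg_two_unique hp0 hp g ?_ ?_ ?_ ?_
    · intro x hx
      exact (((fd _ h₁ x hx).mul_const _).add ((fd _ h₂ x hx).mul_const _)).add
        ((fd _ h₃ x hx).mul_const _)
    · intro x hx
      simp only [g, fp _ h₁ x hx, fp _ h₂ x hx, fp _ h₃ x hx]
      ring
    · simp only [g]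
      rw [integral_add, integral_add, integral_mul_const, integral_mul_const, integral_mul_const]
      · exact e0
      · exact (integrable_cc _ (fc _ h₁)).mul_const _
      · exact (integrable_cc _ (fc _ h₂)).mul_const _
      · exact ((integrable_cc _ (fc _ h₁)).mul_const _).add
          ((integrable_cc _ (fc _ h₂)).mul_const _)
      · exact (integrable_cc _ (fc _ h₃)).mul_const _
    · simp only [g, mul_add, ← mul_assoc]
      rw [integral_add, integral_add, integral_mul_const, integral_mul_const, integral_mul_const]
      · exact e1
      · exact (integrable_cc _ (fc' _ h₁)).mul_const _
      · exact (integrable_cc _ (fc' _ h₂)).mul_const _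
      · exact ((integrable_cc _ (fc' _ h₁)).mul_const _).add
          ((integrable_cc _ (fc' _ h₂)).mul_const _)
      · exact (integrable_cc _ (fc' _ h₃)).mul_const _
  have hk : ∀ x, x ≠ 0 → kk p x y₁ * α 0 + kk p x y₂ * α 1 + kk p x y₃ * α 2 = 0 := by
    intro x hx
    have := hg x hx
    simp only [g, f] at this
    unfold kk
    linear_combination x⁻¹ * this
  have k1 := hk y₁ h₁
  have k2 := hk y₂ h₂
  have k3 := hk y₃ h₃
  have k4 := hk x hx
  rw [kk_self _ h₁] at k1
  rw [kk_self _ h₂, kk_antisymm hp0 hp h₁ h₂] at k2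
  rw [kk_self _ h₃, kk_antisymm hp0 hp h₁ h₃, kk_antisymm hp0 hp h₂ h₃] at k3
  generalize kk p y₁ y₂ = a at *
  generalize kk p y₁ y₃ = b at *
  generalize kk p y₂ y₃ = c at *
  generalize kk p x y₁ = d₁ at *
  generalize kk p x y₂ = d₂ at *
  generalize kk p x y₃ = d₃ at *
  have hne : α 0 ≠ 0 ∨ α 1 ≠ 0 ∨ α 2 ≠ 0 := by
    by_contra hcon
    push Not at hcon
    apply hα0
    ext i; fin_cases i
    · exact hcon.1
    · exact hcon.2.1
    · exact hcon.2.2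
  rcases hne with h | h | h
  · apply mul_left_cancel₀ h
    linear_combination c * k4 + d₂ * k3 - d₃ * k2
  · apply mul_left_cancel₀ h
    linear_combination -b * k4 - d₁ * k3 + d₃ * k1
  · apply mul_left_cancel₀ h
    linear_combination a * k4 - d₁ * (-1) * k2 - d₂ * k1

lemma three_term (hp0 : p ≠ 0) (hp : ‖p‖ < 1) {t x y u v : ℂ} (ht : t ≠ 0) (hx : x ≠ 0)
    (hy : y ≠ 0) (hu : u ≠ 0) (hv : v ≠ 0) :
    th p (t * (u * v)) * th p (t * (x * y)) * th p (x * v) * th p (u * y) -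
      th p (t * (x * v)) * th p (t * (u * y)) * th p (u * v) * th p (x * y) =
    th p t * th p (t * (u * v * (x * y))) * dl p u x * dl p v y := by
  obtain ⟨c, hc⟩ := IsAlgClosed.exists_pow_nat_eq (t * y * v) (n := 2) (by norm_num)
  have hc0 : c ≠ 0 := by
    rintro rfl
    have : t * y * v ≠ 0 := by positivity
    exact this (by rw [← hc]; ring)
  have H := kk_pf hp0 hp (x := x * c) (y₁ := t * y / c) (y₂ := t * v / c) (y₃ := c * u)
    (by positivity) (by positivity) (by positivity) (by positivity)
  unfold kk at H
  have e1 : t * v / c * (c * u) = t * (u * v) := by field_simp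
  have e2 : t * v / c / (c * u) = (u * y)⁻¹ := by
    rw [div_div, show c * (c * u) = c ^ 2 * u by ring, hc]; field_simp
  have e3 : x * c * (t * y / c) = t * (x * y) := by field_simp
  have e4 : x * c / (t * y / c) = x * v := by
    rw [div_div_eq_mul_div, show x * c * c = x * c ^ 2 by ring, hc]; field_simp
  have e5 : t * y / c * (c * u) = t * (u * y) := by field_simp
  have e6 : t * y / c / (c * u) = (u * v)⁻¹ := by
    rw [div_div, show c * (c * u) = c ^ 2 * u by ring, hc]; field_simp
  have e7 : x * c * (t * v / c) = t * (x * v) := by field_simp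
  have e8 : x * c / (t * v / c) = x * y := by
    rw [div_div_eq_mul_div, show x * c * c = x * c ^ 2 by ring, hc]; field_simp
  have e9 : t * y / c * (t * v / c) = t := by
    rw [div_mul_div_comm, ← sq, hc]; field_simp
  have e10 : t * y / c / (t * v / c) = (v / y)⁻¹ := by field_simp
  have e11 : x * c * (c * u) = t * (u * v * (x * y)) := by
    rw [show x * c * (c * u) = x * u * c ^ 2 by ring, hc]; ring
  have e12 : x * c / (c * u) = (u / x)⁻¹ := by field_simp
  rw [e1, e2, e3, e4, e5, e6, e7, e8, e9, e10, e11, e12, th_inv hp0 hp (mul_ne_zero hu hy),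
    th_inv hp0 hp (mul_ne_zero hu hv), th_inv hp0 hp (div_ne_zero hv hy),
    th_inv hp0 hp (div_ne_zero hu hx)] at H
  unfold dl
  generalize th p (t * (u * v)) = A1 at *
  generalize th p (t * (x * y)) = A2 at *
  generalize th p (t * (x * v)) = A3 at *
  generalize th p (t * (u * y)) = A4 at *
  generalize th p (t * (u * v * (x * y))) = A5 at *
  generalize th p (x * v) = A6 at *
  generalize th p (u * y) = A7 at *
  generalize th p (u * v) = A8 at *
  generalize th p (x * y) = A9 at *
  generalize th p (u / x) = A10 at *
  generalize th p (v / y) = A11 at *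
  have H2 : -(t * u * v * y * x)  * (((t * v / c)⁻¹ * (A1 * (-(u * y)⁻¹ * A7)) * ((x * c)⁻¹ * (A2 * A6)) -
            (t * y / c)⁻¹ * (A4 * (-(u * v)⁻¹ * A8)) * ((x * c)⁻¹ * (A3 * A9)) +
          (t * y / c)⁻¹ * (th p t * (-(v / y)⁻¹ * A11)) * ((x * c)⁻¹ * (A5 * (-(u / x)⁻¹ * A10))))) = 0 := by
    rw [H, mul_zero]
  field_simp at H2
  linear_combination H2

end

end SD

namespace SD
open Filter Topology MeasureTheory

/-- theta Vandermonde -/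
noncomputable def VV (p : ℂ) {n : ℕ} (f : Fin n → ℂ) : ℂ :=
  ∏ a, ∏ b, if a < b then dl p (f a) (f b) else 1

lemma VV_cast {p : ℂ} {K K' : ℕ} (h : K = K') (f : Fin K' → ℂ) :
    VV p (fun a => f (Fin.cast h a)) = VV p f := by
  subst h; rfl

lemma VV_succ {p : ℂ} {n : ℕ} (f : Fin (n + 1) → ℂ) :
    VV p f = (∏ b : Fin n, dl p (f 0) (f b.succ)) * VV p (fun a : Fin n => f a.succ) := by
  unfold VV
  rw [Fin.prod_univ_succ]
  congr 1
  · rw [Fin.prod_univ_succ]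
    simp
  · refine Finset.prod_congr rfl fun a _ => ?_
    rw [Fin.prod_univ_succ]
    simp

lemma VV_append {p : ℂ} {n d : ℕ} (f : Fin n → ℂ) (g : Fin d → ℂ) :
    VV p (Fin.append f g) = VV p f * VV p g * ∏ i, ∏ j, dl p (f i) (g j) := by
  unfold VV
  rw [Fin.prod_univ_add]
  have h1 : ∀ a : Fin n, (∏ b : Fin (n + d), if Fin.castAdd d a < b then
      dl p (Fin.append f g (Fin.castAdd d a)) (Fin.append f g b) else 1) =
      (∏ b, if a < b then dl p (f a) (f b) else 1) * ∏ j, dl p (f a) (g j) := by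
    intro a
    rw [Fin.prod_univ_add]
    congr 1
    · have hlt : ∀ x : Fin n, Fin.castAdd d a < Fin.castAdd d x ↔ a < x := fun x => Iff.rfl
      simp [hlt]
    · refine Finset.prod_congr rfl fun j _ => ?_
      rw [if_pos]
      · simp
      · rw [Fin.lt_def]; simp; omega
  have h2 : ∀ a : Fin d, (∏ b : Fin (n + d), if Fin.natAdd n a < b then
      dl p (Fin.append f g (Fin.natAdd n a)) (Fin.append f g b) else 1) =
      (∏ b, if a < b then dl p (g a) (g b) else 1) := by
    intro a
    rw [Fin.prod_univ_add]
    have : (∏ b : Fin n, if Fin.natAdd n a < Fin.castAdd d b then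
      dl p (Fin.append f g (Fin.natAdd n a)) (Fin.append f g (Fin.castAdd d b)) else 1) = 1 := by
      refine Finset.prod_eq_one fun j _ => ?_
      rw [if_neg]
      rw [Fin.lt_def]; simp; omega
    rw [this]; simp
  simp_rw [h1, h2, Finset.prod_mul_distrib]
  ring

/-- Kronecker-type function -/
noncomputable def ph (p t w : ℂ) : ℂ := th p (t * w) / (th p t * th p w)

lemma det_schur {n : ℕ} (M : Matrix (Fin (n + 1)) (Fin (n + 1)) ℂ) (h : M 0 0 ≠ 0) :
    M.det = M 0 0 * (Matrix.of fun a b : Fin n =>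
      M a.succ b.succ - M a.succ 0 * M 0 b.succ / M 0 0).det := by
  let B : Matrix (Fin (n + 1)) (Fin (n + 1)) ℂ := Matrix.of fun a b =>
    if a = 0 then M 0 b else M a b - M a 0 * M 0 b / M 0 0
  have h1 : M.det = B.det := by
    refine Matrix.det_eq_of_forall_row_eq_smul_add_const
      (fun a => if a = 0 then 0 else M a 0 / M 0 0) 0 (by simp) fun i j => ?_
    by_cases hi : i = 0
    · subst hi; simp [B]
    · simp only [B, Matrix.of_apply, if_neg hi, if_true]; ring
  rw [h1, Matrix.det_succ_column_zero, Fin.sum_univ_succ]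
  have : ∑ i : Fin n, (-1 : ℂ) ^ (i.succ : ℕ) * B i.succ 0 *
      (B.submatrix i.succ.succAbove Fin.succ).det = 0 := by
    refine Finset.sum_eq_zero fun i _ => ?_
    have : B i.succ 0 = 0 := by
      simp only [B, Matrix.of_apply, if_neg (Fin.succ_ne_zero i)]
      field_simp; ring
    rw [this]; ring
  rw [this]
  simp only [Fin.val_zero, pow_zero, one_mul, add_zero]
  congr 2
  
lemma frob_schur {p : ℂ} (hp0 : p ≠ 0) (hp : ‖p‖ < 1) {t x y u v : ℂ} (ht : t ≠ 0) (hx : x ≠ 0)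
    (hy : y ≠ 0) (hu : u ≠ 0) (hv : v ≠ 0) (h1 : th p t ≠ 0) (h2 : th p (u * v) ≠ 0)
    (h3 : th p (x * v) ≠ 0) (h4 : th p (u * y) ≠ 0) (h5 : th p (x * y) ≠ 0)
    (h6 : th p (t * (u * v)) ≠ 0) :
    ph p t (x * y) - ph p t (x * v) * ph p t (u * y) / ph p t (u * v) =
      dl p u x / th p (x * v) * (dl p v y / th p (u * y) * ph p (t * (u * v)) (x * y)) := by
  have H := three_term hp0 hp ht hx hy hu hv
  unfold ph
  rw [show t * (u * v) * (x * y) = t * (u * v * (x * y)) by ring]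
  generalize th p (t * (u * v)) = A1 at *
  generalize th p (t * (x * y)) = A2 at *
  generalize th p (t * (x * v)) = A3 at *
  generalize th p (t * (u * y)) = A4 at *
  generalize th p (t * (u * v * (x * y))) = A5 at *
  generalize th p (x * v) = A6 at *
  generalize th p (u * y) = A7 at *
  generalize th p (u * v) = A8 at *
  generalize th p (x * y) = A9 at *
  field_simp
  linear_combination H

theorem frobenius {p : ℂ} (hp0 : p ≠ 0) (hp : ‖p‖ < 1) : ∀ (n : ℕ) (x y : Fin n → ℂ) (t : ℂ),
    t ≠ 0 → th p t ≠ 0 → (∀ a, x a ≠ 0) → (∀ a, y a ≠ 0) → (∀ a b, th p (x a * y b) ≠ 0) →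
    (Matrix.of fun a b => ph p t (x a * y b)).det =
      th p (t * ((∏ a, x a) * ∏ b, y b)) / th p t * (VV p x * VV p y) /
        ∏ a, ∏ b, th p (x a * y b) := by
  intro n
  induction n with
  | zero =>
    intro x y t _ h _ _ _
    simp [VV, h]
  | succ n ih =>
    intro x y t ht hth hx hy hxy
    have gen : ∀ t : ℂ, t ≠ 0 → th p t ≠ 0 → th p (t * (x 0 * y 0)) ≠ 0 →
      (Matrix.of fun a b => ph p t (x a * y b)).det =
      th p (t * ((∏ a, x a) * ∏ b, y b)) / th p t * (VV p x * VV p y) /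
        ∏ a, ∏ b, th p (x a * y b) := by
      intro t ht hth h0
      rw [det_schur _ (by
        simp only [Matrix.of_apply, ph]
        exact div_ne_zero h0 (mul_ne_zero hth (hxy 0 0)))]
      have e : (Matrix.of fun a b : Fin n =>
          (Matrix.of fun a b => ph p t (x a * y b)) a.succ b.succ -
          (Matrix.of fun a b => ph p t (x a * y b)) a.succ 0 *
          (Matrix.of fun a b => ph p t (x a * y b)) 0 b.succ /
          (Matrix.of fun a b => ph p t (x a * y b)) 0 0) =
          Matrix.of fun a b : Fin n => (dl p (x 0) (x a.succ) / th p (x a.succ * y 0)) *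
           (Matrix.of fun a b : Fin n => (dl p (y 0) (y b.succ) / th p (x 0 * y b.succ)) *
             (Matrix.of fun a b : Fin n =>
               ph p (t * (x 0 * y 0)) (x a.succ * y b.succ)) a b) a b := by
        ext a b
        simp only [Matrix.of_apply]
        exact frob_schur hp0 hp ht (hx _) (hy _) (hx 0) (hy 0) hth (hxy _ _) (hxy _ _) (hxy _ _)
          (hxy _ _) h0
      rw [e, Matrix.det_mul_column, Matrix.det_mul_row, ih (fun a => x a.succ) (fun a => y a.succ)
        _ (mul_ne_zero ht (mul_ne_zero (hx 0) (hy 0))) h0 (fun a => hx _) (fun a => hy _)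
        (fun a b => hxy _ _), VV_succ x, VV_succ y]
      simp only [Fin.prod_univ_succ, Finset.prod_div_distrib, Finset.prod_mul_distrib,
        Matrix.of_apply, ph]
      rw [show t * (x 0 * y 0) * ((∏ a : Fin n, x a.succ) * ∏ b : Fin n, y b.succ) =
        t * (x 0 * (∏ a : Fin n, x a.succ) * (y 0 * ∏ b : Fin n, y b.succ)) by ring]
      have n1 : ∏ a : Fin n, th p (x a.succ * y 0) ≠ 0 := Finset.prod_ne_zero_iff.mpr fun a _ => hxy _ _
      have n2 : ∏ a : Fin n, th p (x 0 * y a.succ) ≠ 0 := Finset.prod_ne_zero_iff.mpr fun a _ => hxy _ _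
      have n3 : ∏ a : Fin n, ∏ b : Fin n, th p (x a.succ * y b.succ) ≠ 0 :=
        Finset.prod_ne_zero_iff.mpr fun a _ => Finset.prod_ne_zero_iff.mpr fun a _ => hxy _ _
      have n4 := hxy 0 0
      generalize (∏ a : Fin n, th p (x a.succ * y 0)) = B1 at *
      generalize (∏ a : Fin n, th p (x 0 * y a.succ)) = B2 at *
      generalize (∏ a : Fin n, ∏ b : Fin n, th p (x a.succ * y b.succ)) = B3 at *
      generalize th p (x 0 * y 0) = B4 at *
      generalize th p (t * (x 0 * y 0)) = B5 at *
      field_simp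
    have cth : ∀ c : ℂ, c ≠ 0 → ContinuousOn (fun t => th p (t * c)) {t | t ≠ 0} := by
      intro c hc t ht
      refine ContinuousAt.continuousWithinAt (ContinuousAt.comp (f := fun t => t * c) (g := th p) ?_
        (by fun_prop))
      exact (th_differentiableAt hp (mul_ne_zero ht hc)).continuousAt
    have hopen0 : IsOpen {t : ℂ | t ≠ 0} := isOpen_ne
    have cth1 : ContinuousOn (fun t => th p t) {t | t ≠ 0} := by simpa using cth 1 one_ne_zero
    let U : Set ℂ := {t | t ≠ 0} ∩ (fun t => th p t) ⁻¹' {0}ᶜ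
    have hU : IsOpen U := cth1.isOpen_inter_preimage hopen0 isOpen_compl_singleton
    have hUs : U ⊆ {t | t ≠ 0} := Set.inter_subset_left
    let S : Set ℂ := (Set.range fun k : ℤ => p ^ k / (x 0 * y 0))ᶜ
    have hS : Dense S := (Set.countable_range _).dense_compl ℂ
    have hxy0 : x 0 * y 0 ≠ 0 := mul_ne_zero (hx 0) (hy 0)
    have key := Set.EqOn.of_subset_closure (s := U ∩ S) (t := U)
      (f := fun t => (Matrix.of fun a b => ph p t (x a * y b)).det)
      (g := fun t => th p (t * ((∏ a, x a) * ∏ b, y b)) / th p t * (VV p x * VV p y) /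
        ∏ a, ∏ b, th p (x a * y b)) ?_ ?_ ?_ Set.inter_subset_left
        (hS.open_subset_closure_inter hU)
    · exact key ⟨ht, hth⟩
    · rintro t ⟨⟨h1, h2⟩, h3⟩
      refine gen t h1 h2 (th_ne_zero hp0 hp (mul_ne_zero h1 hxy0) fun k hk => h3 ⟨k, ?_⟩)
      simp only
      rw [← hk, mul_div_cancel_right₀ _ hxy0]
    · simp only [Matrix.det_apply]
      refine continuousOn_finsetSum _ fun σ _ => ContinuousOn.const_smul
        (continuousOn_finsetProd _ fun i _ => ?_) _
      simp only [Matrix.of_apply, ph]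
      refine ((cth _ (mul_ne_zero (hx _) (hy _))).mono hUs).div
        ((cth1.mono hUs).mul continuousOn_const) fun t ht => mul_ne_zero ht.2 (hxy _ _)
    · refine ContinuousOn.div_const (ContinuousOn.mul (ContinuousOn.div ?_ (cth1.mono hUs)
        fun t ht => ht.2) continuousOn_const) _
      exact (cth _ (mul_ne_zero (Finset.prod_ne_zero_iff.mpr fun a _ => hx a)
        (Finset.prod_ne_zero_iff.mpr fun a _ => hy a))).mono hUs

end SD

namespace SD
open Filter Topology MeasureTheory

theorem andreief {n d : ℕ} (φ : Fin n → UnitAddCircle → ℂ) (ψ : Fin n ⊕ Fin d → UnitAddCircle → ℂ)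
    (c : Fin n ⊕ Fin d → Fin d → ℂ) (hφ : ∀ k, Continuous (φ k)) (hψ : ∀ k, Continuous (ψ k)) :
    ∫ x : Fin n → UnitAddCircle, (Matrix.of fun k j => φ k (x j)).det *
      (Matrix.of fun a b => Sum.elim (fun j => ψ a (x j)) (c a) b).det =
    (n.factorial : ℂ) *
      (Matrix.of fun a b => Sum.elim (fun k => ∫ x, φ k x * ψ a x) (c a) b).det := by
  set M : Matrix (Fin n ⊕ Fin d) (Fin n ⊕ Fin d) ℂ :=
    Matrix.of fun a b => Sum.elim (fun k => ∫ x, φ k x * ψ a x) (c a) b with hM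
  have h1 : ∀ σ : Equiv.Perm (Fin n), ∫ x : Fin n → UnitAddCircle, (∏ j, φ (σ j) (x j)) *
      (Matrix.of fun a b => Sum.elim (fun j => ψ a (x j)) (c a) b).det =
      ((Equiv.Perm.sign σ : ℤ) : ℂ) * M.det := by
    intro σ
    have e1 : (M.submatrix id (Equiv.sumCongr σ (Equiv.refl (Fin d)))).det =
        ((Equiv.Perm.sign σ : ℤ) : ℂ) * M.det := by
      rw [Matrix.det_permute']
      congr 2
      have := Equiv.Perm.sign_sumCongr σ (1 : Equiv.Perm (Fin d))
      simp only [Equiv.Perm.sign_one, mul_one] at this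
      rw [← this]; rfl
    rw [← e1, Matrix.det_apply']
    simp_rw [Matrix.det_apply', Finset.mul_sum]
    rw [integral_finsetSum]
    · refine Finset.sum_congr rfl fun π _ => ?_
      simp only [Fintype.prod_sum_type, Matrix.of_apply, Sum.elim_inl, Sum.elim_inr,
        Matrix.submatrix_apply, id, Equiv.sumCongr_apply, Sum.map_inl, Sum.map_inr, hM]
      have := integral_fintype_prod_volume_eq_prod (ι := Fin n) (E := fun _ => UnitAddCircle)
        (fun j x => φ (σ j) x * ψ (π (Sum.inl j)) x)
      rw [← this]
      rw [mul_comm (∫ x : Fin n → UnitAddCircle, _) (Finset.prod _ _), ← mul_assoc,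
        ← integral_const_mul]
      refine integral_congr_ae (Eventually.of_forall fun x => ?_)
      simp only [Finset.prod_mul_distrib, Equiv.refl_apply]
      ring
    · intro π _
      refine integrable_cc _ ?_
      refine Continuous.mul (continuous_finsetProd _ fun j _ => (hφ _).comp (continuous_apply j)) ?_
      refine continuous_const.mul (continuous_finsetProd _ fun j _ => ?_)
      rcases j with j | j
      · exact (hψ _).comp (continuous_apply j)
      · exact continuous_const
  have h2 : ∀ x : Fin n → UnitAddCircle, (Matrix.of fun k j => φ k (x j)).det *
      (Matrix.of fun a b => Sum.elim (fun j => ψ a (x j)) (c a) b).det =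
      ∑ σ : Equiv.Perm (Fin n), ((Equiv.Perm.sign σ : ℤ) : ℂ) * ((∏ j, φ (σ j) (x j)) *
      (Matrix.of fun a b => Sum.elim (fun j => ψ a (x j)) (c a) b).det) := by
    intro x
    rw [Matrix.det_apply', Finset.sum_mul]
    simp only [Matrix.of_apply, mul_assoc]
  simp_rw [h2]
  rw [integral_finsetSum]
  · simp_rw [integral_const_mul, h1, ← mul_assoc]
    rw [← Finset.sum_mul]
    congr 1
    have : ∀ σ : Equiv.Perm (Fin n), ((Equiv.Perm.sign σ : ℤ) : ℂ) * ((Equiv.Perm.sign σ : ℤ) : ℂ) = 1 := by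
      intro σ
      rcases Int.units_eq_one_or (Equiv.Perm.sign σ) with h | h <;> simp [h]
    simp [this, Fintype.card_perm]
  · intro σ _
    refine integrable_cc _ ?_
    refine continuous_const.mul (Continuous.mul
      (continuous_finsetProd _ fun j _ => (hφ _).comp (continuous_apply j)) ?_)
    refine Continuous.matrix_det ?_
    refine continuous_matrix fun a b => ?_
    rcases b with j | j
    · exact (hψ _).comp (continuous_apply j)
    · exact continuous_const

lemma ph_differentiableAt {p t z : ℂ} (hp : ‖p‖ < 1) (ht : t ≠ 0) (hz0 : z ≠ 0)
    (ht1 : th p t ≠ 0) (hz : th p z ≠ 0) : DifferentiableAt ℂ (ph p t) z := by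
  unfold ph
  refine DifferentiableAt.div ?_ ((th_differentiableAt hp hz0).const_mul _) (mul_ne_zero ht1 hz)
  exact DifferentiableAt.comp (g := th p) (f := fun z => t * z) z
    (th_differentiableAt hp (mul_ne_zero ht hz0)) (by fun_prop)

lemma ph_continuous {p t c : ℂ} (hp : ‖p‖ < 1) (ht : t ≠ 0) (ht1 : th p t ≠ 0)
    (hc0 : c ≠ 0) (h1 : ‖p‖ < ‖c‖) (h2 : ‖c‖ < 1) : Continuous fun x => ph p t (c * ex x) := by
  rw [continuous_iff_continuousAt]
  intro x
  refine ContinuousAt.comp (f := fun x => c * ex x) (g := ph p t)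
    (ph_differentiableAt hp ht (mul_ne_zero hc0 (ex_ne_zero x)) ht1
      (th_ne_zero_of_annulus hp ?_ ?_)).continuousAt (by fun_prop)
  · simpa using h1
  · simpa using h2

/-- pairing -/
noncomputable def GG (p q σ τ α ρ : ℂ) : ℂ := ∫ x, ph q τ (ρ * ex x) * ph p σ (α * ex x)

section
variable {p q σ τ : ℂ} (hp : ‖p‖ < 1) (hq0 : q ≠ 0) (hq : ‖q‖ < 1) (hσ : σ ≠ 0) (hτ : τ ≠ 0)
  (hσ1 : th p σ ≠ 0) (hτ1 : th q τ ≠ 0)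
include hp hq hσ hτ hσ1 hτ1

lemma GG_scale {α ρ c : ℂ} (hc : c ≠ 0) (h1 : ‖p‖ < ‖α‖) (h2 : ‖α‖ < 1) (h3 : ‖q‖ < ‖ρ‖)
    (h4 : ‖ρ‖ < 1) (h1' : ‖p‖ < ‖c * α‖) (h2' : ‖c * α‖ < 1) (h3' : ‖q‖ < ‖c * ρ‖)
    (h4' : ‖c * ρ‖ < 1) : GG p q σ τ (c * α) (c * ρ) = GG p q σ τ α ρ := by
  unfold GG
  have hα : 0 < ‖α‖ := lt_of_le_of_lt (norm_nonneg _) h1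
  have hρ : 0 < ‖ρ‖ := lt_of_le_of_lt (norm_nonneg _) h3
  have := av_annulus' (fun z => ph q τ (ρ * z) * ph p σ (α * z)) hc one_ne_zero (fun z hz hz' => by
    rw [norm_one] at hz hz'
    have hz0 : 0 < ‖z‖ := lt_of_lt_of_le (lt_min (norm_pos_iff.mpr hc) one_pos) hz
    rw [norm_mul] at h1' h2' h3' h4'
    have key : ∀ (x y : ℝ), 0 < x → y < ‖c‖ * x → y < x → y < x * ‖z‖ := by
      intro x y hx hy hy'
      rcases min_le_iff.mp hz with h | h
      · nlinarith
      · nlinarith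
    have key' : ∀ (x : ℝ), 0 < x → ‖c‖ * x < 1 → x < 1 → x * ‖z‖ < 1 := by
      intro x hx hy hy'
      rcases le_max_iff.mp hz' with h | h
      · nlinarith
      · nlinarith
    refine DifferentiableAt.mul ?_ ?_
    · refine DifferentiableAt.comp (f := fun z => ρ * z) (g := ph q τ) z ?_ (by fun_prop)
      refine ph_differentiableAt hq hτ (mul_ne_zero (norm_pos_iff.mp hρ) (norm_pos_iff.mp hz0)) hτ1
        (th_ne_zero_of_annulus hq ?_ ?_)
      · rw [norm_mul]; exact key _ _ hρ h3' h3
      · rw [norm_mul]; exact key' _ hρ h4' h4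
    · refine DifferentiableAt.comp (f := fun z => α * z) (g := ph p σ) z ?_ (by fun_prop)
      refine ph_differentiableAt hp hσ (mul_ne_zero (norm_pos_iff.mp hα) (norm_pos_iff.mp hz0)) hσ1
        (th_ne_zero_of_annulus hp ?_ ?_)
      · rw [norm_mul]; exact key _ _ hα h1' h1
      · rw [norm_mul]; exact key' _ hα h2' h2)
  simp only [one_mul] at this
  rw [← this]
  refine integral_congr_ae (Eventually.of_forall fun x => ?_)
  simp only
  congr 2 <;> ring

omit hp hσ hσ1 in
include hq0 in
lemma ph_div_q {x : ℂ} (hx : x ≠ 0) (hx1 : th q x ≠ 0) : ph q τ (x / q) = τ * ph q τ x := by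
  unfold ph
  have h1 := th_mul_p hq0 hq (x := x / q) (by positivity)
  have h2 := th_mul_p hq0 hq (x := τ * (x / q)) (by positivity)
  rw [show q * (x / q) = x by field_simp] at h1
  rw [show q * (τ * (x / q)) = τ * x by field_simp] at h2
  have hx2 : th q (x / q) ≠ 0 := by
    intro h; rw [h] at h1; exact hx1 (by rw [h1]; ring)
  rw [h1, h2]
  field_simp

include hq0 in
lemma GG_shift {α ρ : ℂ} (h1 : ‖p‖ < ‖q * α‖) (h2 : ‖α‖ < 1) (h3 : ‖q‖ < ‖ρ‖)
    (h4 : ‖ρ‖ < 1) : GG p q σ τ (q * α) ρ =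
      τ * GG p q σ τ α ρ + (pochInf q q ^ 2)⁻¹ * ph p σ (q * α / ρ) := by
  have hq' : 0 < ‖q‖ := norm_pos_iff.mpr hq0
  have hρ0 : ρ ≠ 0 := norm_pos_iff.mp (lt_of_le_of_lt (norm_nonneg _) h3)
  have hα0 : α ≠ 0 := by rintro rfl; simp at h1; linarith [norm_nonneg p]
  have hα' : 0 < ‖α‖ := norm_pos_iff.mpr hα0
  have hρ' : 0 < ‖ρ‖ := norm_pos_iff.mpr hρ0
  let g : ℂ → ℂ := fun z => ph p σ (α * z)
  let K : ℂ → ℂ := fun z => th q (τ * (ρ * z)) * g z /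
    (th q τ * (pochInf (ρ * z) q * pochInf (q * (q / (ρ * z))) q))
  have hKF : ∀ z : ℂ, K z / (1 - q / ρ / z) = ph q τ (ρ * z) * ph p σ (α * z) := by
    intro z
    simp only [K, g, ph, th]
    rw [pochInf_rec (q / (ρ * z)) hq, div_div q ρ z]
    rw [div_div, div_mul_eq_mul_div]
    congr 1
    ring
  have hqr : ‖q‖ < ‖q / ρ‖ := by
    rw [norm_div, lt_div_iff₀ hρ']; nlinarith
  have hqr2 : ‖q / ρ‖ < 1 := by
    rw [norm_div, div_lt_one hρ']; exact h3
  have hq1 : pochInf q q ≠ 0 := pochInf_ne_zero_of_lt hq hq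
  have hres := av_residue K (r := ‖q‖) (R := 1) (z₀ := q / ρ) hq' hqr hqr2 (by
    intro z hz hz'
    have hz0 : 0 < ‖z‖ := lt_of_lt_of_le hq' hz
    have hz00 : z ≠ 0 := norm_pos_iff.mp hz0
    have a1 : ‖ρ * z‖ < 1 := by rw [norm_mul]; nlinarith
    have a2 : ‖q * (q / (ρ * z))‖ < 1 := by
      rw [norm_mul, norm_div, norm_mul, mul_div_assoc', div_lt_one (by positivity)]
      nlinarith
    refine DifferentiableAt.div (DifferentiableAt.mul ?_ ?_)
      ((DifferentiableAt.mul ?_ ?_).const_mul _) (mul_ne_zero hτ1 (mul_ne_zero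
        (pochInf_ne_zero_of_lt hq a1) (pochInf_ne_zero_of_lt hq a2)))
    · exact DifferentiableAt.comp (g := th q) (f := fun z => τ * (ρ * z)) z
        (th_differentiableAt hq (mul_ne_zero hτ (mul_ne_zero hρ0 hz00))) (by fun_prop)
    · refine DifferentiableAt.comp (f := fun z => α * z) (g := ph p σ) z ?_ (by fun_prop)
      refine ph_differentiableAt hp hσ (mul_ne_zero hα0 hz00) hσ1 (th_ne_zero_of_annulus hp ?_ ?_)
      · rw [norm_mul] at *; nlinarith
      · rw [norm_mul] at *; nlinarith
    · exact DifferentiableAt.comp (g := fun x => pochInf x q) (f := fun z => ρ * z) z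
        (pochInf_differentiable hq _) (by fun_prop)
    · refine DifferentiableAt.comp (g := fun x => pochInf x q) (f := fun z => q * (q / (ρ * z))) z
        (pochInf_differentiable hq _) ?_
      refine DifferentiableAt.const_mul (DifferentiableAt.div (by fun_prop) (by fun_prop)
        (mul_ne_zero hρ0 hz00)) _)
  simp_rw [hKF] at hres
  have hK0 : K (q / ρ) = -τ⁻¹ * ((pochInf q q ^ 2)⁻¹ * ph p σ (q * α / ρ)) := by
    simp only [K, g]
    rw [show ρ * (q / ρ) = q by field_simp, div_self hq0, mul_one, mul_comm τ q,
      th_mul_p hq0 hq hτ, show α * (q / ρ) = q * α / ρ by ring]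
    field_simp
  have e1 : GG p q σ τ (q * α) ρ = τ * ∫ x, ph q τ (ρ * ((‖q‖ : ℂ) * ex x)) *
      ph p σ (α * ((‖q‖ : ℂ) * ex x)) := by
    have hph := av_phase (fun z => ph q τ (ρ * z) * ph p σ (α * z)) hq0
    rw [← hph, ← integral_const_mul]
    unfold GG
    refine integral_congr_ae (Eventually.of_forall fun x => ?_)
    simp only
    have := ph_div_q hq0 hq hτ hτ1 (x := ρ * (q * ex x)) (by
      have := ex_ne_zero x; positivity) ?_
    · rw [show ρ * (q * ex x) / q = ρ * ex x by field_simp] at this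
      rw [this]
      ring_nf
    · rw [show ρ * (q * ex x) = q * (ρ * ex x) by ring, th_mul_p hq0 hq
        (mul_ne_zero hρ0 (ex_ne_zero x))]
      refine mul_ne_zero (neg_ne_zero.mpr (inv_ne_zero (mul_ne_zero hρ0 (ex_ne_zero x))))
        (th_ne_zero_of_annulus hq ?_ ?_)
      · simpa using h3
      · simpa using h4
  rw [e1]
  have e2 : GG p q σ τ α ρ = ∫ x, ph q τ (ρ * (((1 : ℝ) : ℂ) * ex x)) *
      ph p σ (α * (((1 : ℝ) : ℂ) * ex x)) := by simp [GG]
  rw [e2]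
  rw [hK0] at hres
  have : τ * (-τ⁻¹ * ((pochInf q q ^ 2)⁻¹ * ph p σ (q * α / ρ))) =
     -((pochInf q q ^ 2)⁻¹ * ph p σ (q * α / ρ)) := by field_simp
  linear_combination (-τ) * hres - this
end

/-- column operations -/
lemma det_columns {K : ℕ} (lvl : Fin K → ℕ) (pred : Fin K → Fin K)
    (hpred : ∀ b, lvl b ≠ 0 → lvl (pred b) + 1 = lvl b) (τ c₀ : ℂ)
    (P M : Matrix (Fin K) (Fin K) ℂ) (h0 : ∀ a b, lvl b = 0 → M a b = P a b)
    (h1 : ∀ a b, lvl b ≠ 0 → P a b = τ * P a (pred b) + c₀ * M a b) :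
    P.det = (∏ b, if lvl b = 0 then 1 else c₀) * M.det := by
  let U : Matrix (Fin K) (Fin K) ℂ := Matrix.of fun b' b =>
    (if b' = b then 1 else 0) - (if lvl b ≠ 0 ∧ b' = pred b then τ else 0)
  have hU : U.BlockTriangular lvl := by
    intro i j hij
    simp only [U, Matrix.of_apply]
    rw [if_neg (by rintro rfl; exact lt_irrefl _ hij), if_neg, sub_zero]
    rintro ⟨h, rfl⟩
    have := hpred j h
    omega
  have hUdet : U.det = 1 := by
    rw [hU.det]
    refine Finset.prod_eq_one fun k _ => ?_
    have : U.toSquareBlock lvl k = 1 := by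
      ext ⟨i, hi⟩ ⟨j, hj⟩
      rw [Matrix.toSquareBlock_def]
      simp only [U, Matrix.of_apply, Matrix.one_apply, Subtype.mk.injEq]
      rw [if_neg (c := lvl j ≠ 0 ∧ i = pred j), sub_zero]
      rintro ⟨h, rfl⟩
      have := hpred j h
      omega
    rw [this, Matrix.det_one]
  have hPU : P * U = Matrix.of fun a b => (if lvl b = 0 then 1 else c₀) * M a b := by
    ext a b
    simp only [Matrix.mul_apply, U, Matrix.of_apply, mul_sub, Finset.sum_sub_distrib]
    simp only [mul_ite, mul_one, mul_zero, Finset.sum_ite_eq', Finset.mem_univ, if_true]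
    by_cases hb : lvl b = 0
    · simp [hb, h0 a b hb]
    · simp [hb, h1 a b hb]
      ring
  rw [← Matrix.det_mul_row, ← hPU, Matrix.det_mul, hUdet, mul_one]

end SD

namespace SD
open Filter Topology MeasureTheory

/-- pair products -/
noncomputable def PP {n : ℕ} (g : Fin n → Fin n → ℂ) : ℂ := ∏ a, ∏ b, if a < b then g a b else 1

lemma VV_eq_PP (p : ℂ) {n : ℕ} (f : Fin n → ℂ) : VV p f = PP fun a b => dl p (f a) (f b) := rfl

lemma PP_mul {n : ℕ} (g h : Fin n → Fin n → ℂ) : PP (fun a b => g a b * h a b) = PP g * PP h := by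
  unfold PP
  rw [← Finset.prod_mul_distrib]
  refine Finset.prod_congr rfl fun a _ => ?_
  rw [← Finset.prod_mul_distrib]
  refine Finset.prod_congr rfl fun b _ => ?_
  split_ifs <;> simp

lemma PP_congr {n : ℕ} {g h : Fin n → Fin n → ℂ} (H : ∀ a b, a < b → g a b = h a b) :
    PP g = PP h := by
  unfold PP
  refine Finset.prod_congr rfl fun a _ => Finset.prod_congr rfl fun b _ => ?_
  split_ifs with h
  · exact H a b h
  · rfl

lemma PP_ne_zero {n : ℕ} {g : Fin n → Fin n → ℂ} (H : ∀ a b, a < b → g a b ≠ 0) : PP g ≠ 0 := by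
  unfold PP
  refine Finset.prod_ne_zero_iff.mpr fun a _ => Finset.prod_ne_zero_iff.mpr fun b _ => ?_
  split_ifs with h
  · exact H a b h
  · simp

lemma PP_succ {n : ℕ} (g : Fin (n + 1) → Fin (n + 1) → ℂ) :
    PP g = (∏ b : Fin n, g 0 b.succ) * PP (fun a b : Fin n => g a.succ b.succ) := by
  unfold PP
  rw [Fin.prod_univ_succ]
  congr 1
  · rw [Fin.prod_univ_succ]
    simp
  · refine Finset.prod_congr rfl fun a _ => ?_
    rw [Fin.prod_univ_succ]
    simp

lemma PP_pair : ∀ {n : ℕ} (f : Fin n → ℂ), PP (fun a b => f a * f b) = (∏ a, f a) ^ (n - 1) := by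
  intro n
  induction n with
  | zero => intro f; simp [PP]
  | succ n ih =>
    intro f
    rw [PP_succ, ih (fun a => f a.succ), Fin.prod_univ_succ, Finset.prod_mul_distrib]
    rcases n with _ | n
    · simp
    · simp [mul_pow, pow_succ]; ring

/-- sign -/
noncomputable def sg (n : ℕ) : ℂ := PP (n := n) fun _ _ => -1

lemma sg_mul_self (n : ℕ) : sg n * sg n = 1 := by
  unfold sg
  rw [← PP_mul]
  simp [PP]

lemma sg_ne_zero (n : ℕ) : sg n ≠ 0 := fun h => by
  have := sg_mul_self n; rw [h] at this; simp at this

/-- base of an index -/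
def bs {n : ℕ} (l : Fin n → ℕ) : Fin (n + ∑ i, l i) → Fin n :=
  Fin.append id (fun x => (finSigmaFinEquiv.symm x).1)

/-- level of an index -/
def lv {n : ℕ} (l : Fin n → ℕ) : Fin (n + ∑ i, l i) → ℕ :=
  Fin.append (fun _ => 0) (fun x => ((finSigmaFinEquiv.symm x).2 : ℕ) + 1)

section
variable {n : ℕ} (l : Fin n → ℕ)

@[simp] lemma bs_left (k : Fin n) : bs l (Fin.castAdd _ k) = k := by simp [bs]
@[simp] lemma lv_left (k : Fin n) : lv l (Fin.castAdd _ k) = 0 := by simp [lv]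

lemma bs_right (k : Fin n) (x : Fin (l k)) :
    bs l (Fin.natAdd n (finSigmaFinEquiv ⟨k, x⟩)) = k := by simp [bs]
lemma lv_right (k : Fin n) (x : Fin (l k)) :
    lv l (Fin.natAdd n (finSigmaFinEquiv ⟨k, x⟩)) = x + 1 := by
  simp only [lv, Fin.append_right]
  exact congrArg (fun s : (i : Fin n) × Fin (l i) => (s.2 : ℕ) + 1) (Equiv.symm_apply_apply _ _)

lemma ind_cases (b : Fin (n + ∑ i, l i)) : (∃ k, b = Fin.castAdd _ k) ∨
    ∃ k, ∃ x : Fin (l k), b = Fin.natAdd n (finSigmaFinEquiv ⟨k, x⟩) := by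
  refine Fin.addCases (fun k => Or.inl ⟨k, rfl⟩) (fun x => Or.inr ?_) b
  exact ⟨(finSigmaFinEquiv.symm x).1, (finSigmaFinEquiv.symm x).2, by simp⟩

lemma exists_pred (b : Fin (n + ∑ i, l i)) (hb : lv l b ≠ 0) :
    ∃ b', bs l b' = bs l b ∧ lv l b' + 1 = lv l b := by
  rcases ind_cases l b with ⟨k, rfl⟩ | ⟨k, ⟨x, hx⟩, rfl⟩
  · simp at hb
  · rcases x with _ | x
    · exact ⟨Fin.castAdd _ k, by rw [bs_right]; simp, by rw [lv_right]; simp⟩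
    · refine ⟨Fin.natAdd n (finSigmaFinEquiv ⟨k, ⟨x, by omega⟩⟩), ?_, ?_⟩
      · rw [bs_right, bs_right]
      · rw [lv_right, lv_right]

lemma lv_le (b : Fin (n + ∑ i, l i)) : lv l b ≤ l (bs l b) := by
  rcases ind_cases l b with ⟨k, rfl⟩ | ⟨k, ⟨x, hx⟩, rfl⟩
  · simp
  · rw [bs_right, lv_right]; exact hx

lemma ind_inj (b b' : Fin (n + ∑ i, l i)) (h1 : bs l b = bs l b') (h2 : lv l b = lv l b') :
    b = b' := by
  rcases ind_cases l b with ⟨k, rfl⟩ | ⟨k, x, rfl⟩ <;>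
  rcases ind_cases l b' with ⟨k', rfl⟩ | ⟨k', x', rfl⟩
  · simp at h1; rw [h1]
  · rw [lv_right, lv_left] at h2; omega
  · rw [lv_right, lv_left] at h2; omega
  · rw [bs_right, bs_right] at h1
    subst h1
    rw [lv_right, lv_right] at h2
    have : x = x' := Fin.ext (by omega)
    rw [this]

lemma prod_right {M : Type*} [CommMonoid M] (f : Fin n → ℕ → M) :
    ∏ x : Fin (∑ i, l i), f (bs l (Fin.natAdd n x)) (lv l (Fin.natAdd n x)) =
      ∏ k, ∏ r ∈ Finset.range (l k), f k (r + 1) := by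
  rw [← finSigmaFinEquiv.prod_comp, Fintype.prod_sigma]
  refine Finset.prod_congr rfl fun k _ => ?_
  simp_rw [bs_right, lv_right]
  rw [Finset.prod_range]

lemma prod_all {M : Type*} [CommMonoid M] (f : Fin n → ℕ → M) :
    ∏ b, f (bs l b) (lv l b) = ∏ k, ∏ r ∈ Finset.range (l k + 1), f k r := by
  rw [Fin.prod_univ_add, prod_right]
  simp only [bs_left, lv_left]
  rw [← Finset.prod_mul_distrib]
  refine Finset.prod_congr rfl fun k _ => ?_
  rw [Finset.prod_range_succ', mul_comm]

/-- column parameters -/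
noncomputable def yy (q : ℂ) (r : Fin n → ℂ) (x : Fin (∑ i, l i)) : ℂ :=
  q ^ lv l (Fin.natAdd n x) / r (bs l (Fin.natAdd n x))
end

/-- degenerate integrand -/
noncomputable def Dn (p q : ℂ) {n d K : ℕ} (r : Fin n → ℂ) (y : Fin d → ℂ) (α : Fin K → ℂ)
    (z : Fin n → ℂ) : ℂ :=
  (∏ j, (∏ x, th p (y x / z j)) / ((∏ k, th q (r k * z j)) * ∏ a, th p (α a * z j))) *
    PP fun i j => th p (z i / z j) * th q (z j / z i)

lemma dl_flip {p x y : ℂ} (hp0 : p ≠ 0) (hp : ‖p‖ < 1) (hx : x ≠ 0) (hy : y ≠ 0) :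
    dl p x y = -x * th p (y / x) := by
  rw [dl_antisymm hp0 hp hy hx, dl]; ring

lemma vec_eq {p q : ℂ} (hq0 : q ≠ 0) (hq : ‖q‖ < 1) {n : ℕ} (z : Fin n → ℂ) (hz : ∀ j, z j ≠ 0) :
    VV p z * VV q z = sg n * (∏ j, z j) ^ (n - 1) *
      PP fun i j => th p (z i / z j) * th q (z j / z i) := by
  rw [VV_eq_PP, VV_eq_PP, sg, ← PP_pair, ← PP_mul, ← PP_mul, ← PP_mul]
  refine PP_congr fun a b _ => ?_
  rw [dl_flip hq0 hq (hz a) (hz b), dl]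
  ring

section
variable {p q σ τ : ℂ} (hp0 : p ≠ 0) (hp : ‖p‖ < 1) (hq0 : q ≠ 0) (hq : ‖q‖ < 1)
  (hσ : σ ≠ 0) (hτ : τ ≠ 0) (hσ1 : th p σ ≠ 0) (hτ1 : th q τ ≠ 0)

include hp0 hp hq0 hq hσ hτ hσ1 hτ1 in
lemma det_det {n d : ℕ} (r : Fin n → ℂ) (y : Fin d → ℂ) (α : Fin (n + d) → ℂ) (z : Fin n → ℂ)
    (hz : ∀ j, z j ≠ 0) (hr : ∀ j, r j ≠ 0) (hy : ∀ j, y j ≠ 0) (hα : ∀ j, α j ≠ 0)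
    (h1 : ∀ k j, th q (r k * z j) ≠ 0) (h2 : ∀ a j, th p (α a * z j) ≠ 0)
    (h3 : ∀ a x, th p (α a * y x) ≠ 0) :
    (Matrix.of fun k j => ph q τ (r k * z j)).det *
      (Matrix.of fun a b => ph p σ (α a * Fin.append z y b)).det * (th q τ * th p σ) =
    th q (τ * ((∏ k, r k) * ∏ j, z j)) * th p (σ * (((∏ a, α a) * ∏ x, y x) * ∏ j, z j)) *
      (∏ j, z j) ^ (n - 1 + d) * Dn p q r y α z *
      (VV q r * VV p α * VV p y / (∏ a, ∏ x, th p (α a * y x)) * (sg n * (-1) ^ (n * d))) := by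
  rw [frobenius hq0 hq n r z τ hτ hτ1 hr hz h1, frobenius hp0 hp (n + d) α (Fin.append z y) σ hσ hσ1
    hα (Fin.addCases (by simpa using hz) (by simpa using hy)) (fun a => Fin.addCases
    (by simpa using h2 a) (by simpa using h3 a)), VV_append]
  have e1 : ∏ b, Fin.append z y b = (∏ j, z j) * ∏ x, y x := by
    rw [Fin.prod_univ_add]; simp
  have e2 : ∏ a, ∏ b, th p (α a * Fin.append z y b) =
      (∏ a, ∏ j, th p (α a * z j)) * ∏ a, ∏ x, th p (α a * y x) := by
    rw [← Finset.prod_mul_distrib]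
    refine Finset.prod_congr rfl fun a _ => ?_
    rw [Fin.prod_univ_add]; simp
  have e3 : ∏ i, ∏ j, dl p (z i) (y j) = (-1) ^ (n * d) * (∏ j, z j) ^ d *
      ∏ i, ∏ j, th p (y j / z i) := by
    have : ∀ i j, dl p (z i) (y j) = -z i * th p (y j / z i) := fun i j =>
      dl_flip hp0 hp (hz i) (hy j)
    simp_rw [this, Finset.prod_mul_distrib, Finset.prod_const, Finset.card_univ, Fintype.card_fin,
      Finset.prod_pow, Finset.prod_neg, Finset.card_univ, Fintype.card_fin, mul_pow, pow_mul]
  have e4 : ∏ a, ∏ j, th p (α a * z j) = ∏ j, ∏ a, th p (α a * z j) := Finset.prod_comm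
  have e5 : ∏ a, ∏ j, th q (r a * z j) = ∏ j, ∏ a, th q (r a * z j) := Finset.prod_comm
  have n1 : ∏ j, ∏ a, th p (α a * z j) ≠ 0 :=
    Finset.prod_ne_zero_iff.mpr fun a _ => Finset.prod_ne_zero_iff.mpr fun b _ => h2 _ _
  have n2 : ∏ j, ∏ a, th q (r a * z j) ≠ 0 :=
    Finset.prod_ne_zero_iff.mpr fun a _ => Finset.prod_ne_zero_iff.mpr fun b _ => h1 _ _
  have n3 : (∏ a, ∏ x, th p (α a * y x)) ≠ 0 :=
    Finset.prod_ne_zero_iff.mpr fun a _ => Finset.prod_ne_zero_iff.mpr fun b _ => h3 _ _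
  have hv := vec_eq (p := p) hq0 hq z hz
  rw [e1, e2, e3, e4, e5]
  unfold Dn
  rw [Finset.prod_div_distrib, Finset.prod_mul_distrib]
  rw [show (∏ a, α a) * ((∏ j, z j) * ∏ x, y x) = ((∏ a, α a) * ∏ x, y x) * ∏ j, z j by ring,
    pow_add]
  generalize (∏ j, ∏ a, th p (α a * z j)) = A1 at *
  generalize (∏ j, ∏ a, th q (r a * z j)) = A2 at *
  generalize (∏ a, ∏ x, th p (α a * y x)) = A3 at *
  generalize th q (τ * ((∏ k, r k) * ∏ j, z j)) = A4 at *
  generalize th p (σ * (((∏ a, α a) * ∏ x, y x) * ∏ j, z j)) = A5 at *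
  generalize (PP fun i j => th p (z i / z j) * th q (z j / z i)) = A6 at *
  generalize VV p z = A7 at *
  generalize VV q z = A8 at *
  generalize (∏ i, ∏ j, th p (y j / z i)) = A9 at *
  field_simp
  linear_combination A4 * VV q r * A5 * VV p α * VV p y * (∏ j, z j) ^ d * A9 * hv


include hp0 hp hq0 hq hσ hτ hσ1 hτ1 in
theorem side {n : ℕ} (l : Fin n → ℕ) (r : Fin n → ℂ) (α : Fin (n + ∑ i, l i) → ℂ)
    (hr1 : ∀ k, ‖q‖ < ‖r k‖) (hr2 : ∀ k, ‖r k‖ < 1) (hα2 : ∀ a, ‖α a‖ < 1)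
    (hα1 : ∀ a k, ‖p‖ < ‖q‖ ^ l k * ‖α a‖) (hα1' : ∀ a, ‖p‖ < ‖α a‖) :
    (pochInf q q ^ 2)⁻¹ ^ (∑ i, l i) * ((∫ x : Fin n → UnitAddCircle,
      (th q (τ * ((∏ k, r k) * ex (∑ j, x j))) *
        th p (σ * (((∏ a, α a) * ∏ x, yy l q r x) * ex (∑ j, x j))) *
        ex (∑ j, x j) ^ (n - 1 + ∑ i, l i)) * Dn p q r (yy l q r) α (fun j => ex (x j))) *
      (VV q r * VV p α * VV p (yy l q r) / (∏ a, ∏ x, th p (α a * yy l q r x)) *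
        (sg n * (-1) ^ (n * ∑ i, l i)))) =
    th q τ * th p σ * n.factorial *
      (Matrix.of fun a b => GG p q σ τ (q ^ lv l b * α a) (r (bs l b))).det := by
  have hq' : 0 < ‖q‖ := norm_pos_iff.mpr hq0
  have hr0 : ∀ k, r k ≠ 0 := fun k => norm_pos_iff.mp (hq'.trans (hr1 k))
  have hα0 : ∀ k, α k ≠ 0 := fun k => norm_pos_iff.mp ((norm_nonneg p).trans_lt (hα1' k))
  have hlow : ∀ a b, ‖p‖ < ‖q‖ ^ lv l b * ‖α a‖ := fun a b =>
    (hα1 a (bs l b)).trans_le (mul_le_mul_of_nonneg_right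
      (pow_le_pow_of_le_one hq'.le hq.le (lv_le l b)) (norm_nonneg _))
  have hy0 : ∀ x, yy l q r x ≠ 0 := fun x => div_ne_zero (pow_ne_zero _ hq0) (hr0 _)
  have hthy : ∀ a x, th p (α a * yy l q r x) ≠ 0 := by
    intro a x
    have hrr := hr1 (bs l (Fin.natAdd n x))
    have hrr2 := hr2 (bs l (Fin.natAdd n x))
    have hrpos := hq'.trans hrr
    have hlv : lv l (Fin.natAdd n x) ≠ 0 := by simp [lv]
    have hh := hlow a (Fin.natAdd n x)
    have hpw : ‖q‖ ^ lv l (Fin.natAdd n x) ≤ ‖q‖ := pow_le_of_le_one hq'.le hq.le hlv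
    have ha := hα2 a
    have ha0 : 0 < ‖α a‖ := norm_pos_iff.mpr (hα0 a)
    refine th_ne_zero_of_annulus hp ?_ ?_
    · rw [yy, norm_mul, norm_div, norm_pow, mul_div_assoc', lt_div_iff₀ hrpos]
      nlinarith [norm_nonneg p]
    · rw [yy, norm_mul, norm_div, norm_pow, mul_div_assoc', div_lt_one hrpos]
      nlinarith
  choose! pred hpred1 hpred2 using exists_pred l
  let M : Matrix (Fin (n + ∑ i, l i)) (Fin (n + ∑ i, l i)) ℂ := Matrix.of fun a =>
    Fin.append (fun k => GG p q σ τ (α a) (r k)) (fun x => ph p σ (α a * yy l q r x))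
  have hPM := det_columns (lv l) pred hpred2 τ (pochInf q q ^ 2)⁻¹
    (Matrix.of fun a b => GG p q σ τ (q ^ lv l b * α a) (r (bs l b))) M (by
      intro a b hb
      rcases ind_cases l b with ⟨k, rfl⟩ | ⟨k, x, rfl⟩
      · simp [M]
      · rw [lv_right] at hb; omega) (by
      intro a b hb
      simp only [Matrix.of_apply]
      rw [hpred1 b hb, ← hpred2 b hb, pow_succ']
      have hl := hlow a b
      rw [← hpred2 b hb, pow_succ'] at hl
      rw [mul_assoc, GG_shift hp hq0 hq hσ hτ hσ1 hτ1 _ _ (hr1 _) (hr2 _)]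
      · congr 2
        rcases ind_cases l b with ⟨k, rfl⟩ | ⟨k, x, rfl⟩
        · rw [lv_left] at hb; omega
        · have := hpred2 _ hb
          simp only [M, Matrix.of_apply, Fin.append_right, yy]
          rw [← this]
          congr 1
          ring
      · rwa [← mul_assoc, norm_mul, norm_mul, norm_pow]
      · rw [norm_mul, norm_pow]
        have := pow_le_one₀ (n := lv l (pred b)) hq'.le hq.le
        have ha := hα2 a
        have ha0 : 0 < ‖α a‖ := norm_pos_iff.mpr (hα0 a)
        nlinarith)
  have hprod : (∏ b, if lv l b = 0 then (1 : ℂ) else (pochInf q q ^ 2)⁻¹) =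
      (pochInf q q ^ 2)⁻¹ ^ (∑ i, l i) := by
    rw [Fin.prod_univ_add]
    simp [lv]
  rw [hprod] at hPM
  rw [hPM]
  let e := finSumFinEquiv (m := n) (n := ∑ i, l i)
  have hand := andreief (fun k x => ph q τ (r k * ex x)) (fun a x => ph p σ (α (e a) * ex x))
    (fun a x => ph p σ (α (e a) * yy l q r x))
    (fun k => ph_continuous hq hτ hτ1 (hr0 k) (hr1 k) (hr2 k))
    (fun a => ph_continuous hp hσ hσ1 (hα0 _) (hα1' _) (hα2 _))
  have hM : (Matrix.of fun a b => Sum.elim (fun k => ∫ x, ph q τ (r k * ex x) *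
      ph p σ (α (e a) * ex x)) (fun x => ph p σ (α (e a) * yy l q r x)) b).det = M.det := by
    rw [← Matrix.det_submatrix_equiv_self e M]
    congr 1
    ext a b
    rcases b with b | b
    · simp [M, e, GG]
    · simp [M, e]
  rw [hM] at hand
  have hN : ∀ x : Fin n → UnitAddCircle, (Matrix.of fun a b => Sum.elim (fun j => ph p σ (α (e a) * ex (x j)))
      (fun x => ph p σ (α (e a) * yy l q r x)) b).det = (Matrix.of fun a b => ph p σ (α a *
        Fin.append (fun j => ex (x j)) (yy l q r) b)).det := by
    intro x
    rw [← Matrix.det_submatrix_equiv_self e (Matrix.of fun a b => ph p σ (α a * Fin.append _ _ b))]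
    congr 1
    ext a b
    rcases b with b | b
    · simp [e]
    · simp [e]
  simp_rw [hN] at hand
  have hand2 : (∫ x : Fin n → UnitAddCircle, (Matrix.of fun k j => ph q τ (r k * ex (x j))).det *
      (Matrix.of fun a b => ph p σ (α a * Fin.append (fun j => ex (x j)) (yy l q r) b)).det *
        (th q τ * th p σ)) = n.factorial * M.det * (th q τ * th p σ) := by
    rw [integral_mul_const, hand]
  have hpt : ∀ x : Fin n → UnitAddCircle, _ := fun x => det_det hp0 hp hq0 hq hσ hτ hσ1 hτ1 r
    (yy l q r) α (fun j => ex (x j)) (fun j => ex_ne_zero _) hr0 hy0 hα0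
    (fun k j => th_ne_zero_of_annulus hq (by simpa using hr1 k) (by simpa using hr2 k))
    (fun k j => th_ne_zero_of_annulus hp (by simpa using hα1' k) (by simpa using hα2 k)) hthy
  simp_rw [hpt] at hand2
  rw [integral_mul_const] at hand2
  simp_rw [ex_sum]
  rw [hand2]
  ring

end

end SD

namespace SD
open Filter Topology MeasureTheory

section
variable {p q : ℂ} (hp : ‖p‖ < 1) (hq0 : q ≠ 0) (hq : ‖q‖ < 1)
include hp hq

lemma EE_iter (x : ℂ) (k : ℕ) :
    EE x p q = (∏ r ∈ Finset.range k, pochInf (q ^ r * x) p) * EE (q ^ k * x) p q := by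
  induction k with
  | zero => simp
  | succ k ih =>
    rw [ih, Finset.prod_range_succ, EE_rec' (q ^ k * x) hp hq, pow_succ']
    ring_nf

include hq0 in
lemma EE_iter' (x : ℂ) (k : ℕ) :
    EE (x / q ^ k) p q = (∏ r ∈ Finset.range k, pochInf (x / q ^ (r + 1)) p) * EE x p q := by
  induction k with
  | zero => simp
  | succ k ih =>
    rw [EE_rec' (x / q ^ (k + 1)) hp hq, Finset.prod_range_succ,
      show q * (x / q ^ (k + 1)) = x / q ^ k by (field_simp; ring), ih]
    ring

/-- norm of a reduced argument -/
lemma EE_ne_zero_pow {x : ℂ} (k : ℕ) (hx : ‖q * x‖ < 1) : EE (q ^ (k + 1) * x) p q ≠ 0 := by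
  refine EE_ne_zero_of_lt hp hq ?_
  rw [pow_succ, mul_assoc, norm_mul, norm_pow]
  have := pow_le_one₀ (n := k) (norm_nonneg q) hq.le
  nlinarith [norm_nonneg (q * x)]

include hq0 in
lemma specA {w : ℂ} (hw0 : w ≠ 0) (κ : ℕ) (h1 : ‖q‖ < ‖w‖) (h2 : ‖w‖ < 1) :
    EE (p * q / w) p q * EE (q ^ (κ + 1) * w) p q / (EE w p q * EE (p / q ^ κ / w) p q) =
      (∏ r ∈ Finset.range (κ + 1), th p (q ^ r * w))⁻¹ := by
  have hw : 0 < ‖w‖ := norm_pos_iff.mpr hw0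
  rw [EE_iter hp hq w (κ + 1), show p / q ^ κ / w = (p * q / w) / q ^ (κ + 1) by
    (field_simp; ring), EE_iter' hp hq0 hq (p * q / w) (κ + 1)]
  have n1 : EE (q ^ (κ + 1) * w) p q ≠ 0 := EE_ne_zero_pow hp hq κ (by
    rw [norm_mul]; nlinarith [norm_nonneg q])
  have n2 : EE (p * q / w) p q ≠ 0 := EE_ne_zero_of_lt hp hq (by
    rw [norm_div, norm_mul, div_lt_one hw]
    nlinarith [norm_nonneg q])
  simp only [th]
  rw [Finset.prod_mul_distrib]
  have : ∀ r ∈ Finset.range (κ + 1), pochInf (p * q / w / q ^ (r + 1)) p =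
      pochInf (p / (q ^ r * w)) p := by
    intro r _
    congr 1
    field_simp
    ring
  rw [Finset.prod_congr rfl this]
  rw [show ∀ a b c d : ℂ, a * b / (c * b * (d * a)) = (a * b) / ((a * b) * (c * d)) from
    fun a b c d => by congr 1; ring]
  rw [div_mul_eq_div_div, div_self (mul_ne_zero n2 n1), one_div]

include hq0 in
lemma specB {w : ℂ} (hw0 : w ≠ 0) (l : ℕ) (h1 : ‖q‖ < ‖w‖) (h2 : ‖w‖ < 1) :
    EE (p * q / w) p q * EE (p / q ^ l * w) p q / (EE w p q * EE (q ^ (l + 1) / w) p q) =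
      (∏ r ∈ Finset.range l, th p (q ^ (r + 1) / w)) / th q w := by
  have hw : 0 < ‖w‖ := norm_pos_iff.mpr hw0
  have a1 := EE_rec w hp hq
  have a2 := EE_rec (q / w) hp hq
  have a3 := EE_iter hp hq (q / w) l
  have a4 := EE_iter' hp hq0 hq (p * w) l
  have n1 : EE (q ^ (l + 1) / w) p q ≠ 0 := by
    have := EE_ne_zero_pow hp hq (x := w⁻¹) l (by
      rw [norm_mul, norm_inv, ← div_eq_mul_inv, div_lt_one hw]; exact h1)
    rwa [← div_eq_mul_inv] at this
  have n2 : EE (p * w) p q ≠ 0 := EE_ne_zero_of_lt hp hq (by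
    rw [norm_mul]; nlinarith [norm_nonneg p])
  have n3 : pochInf (q / w) q ≠ 0 := pochInf_ne_zero_of_lt hq (by
    rw [norm_div, div_lt_one hw]; exact h1)
  have n4 : pochInf w q ≠ 0 := pochInf_ne_zero_of_lt hq h2
  rw [show p * (q / w) = p * q / w by ring] at a2
  rw [show q ^ l * (q / w) = q ^ (l + 1) / w by ring] at a3
  rw [show p * w / q ^ l = p / q ^ l * w by ring] at a4
  simp only [th]
  rw [Finset.prod_mul_distrib]
  have e1 : ∀ r ∈ Finset.range l, pochInf (p / (q ^ (r + 1) / w)) p =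
      pochInf (p * w / q ^ (r + 1)) p := by
    intro r _
    congr 1
    field_simp
  have e2 : ∀ r ∈ Finset.range l, pochInf (q ^ r * (q / w)) p =
      pochInf (q ^ (r + 1) / w) p := by
    intro r _
    congr 1
    ring
  rw [Finset.prod_congr rfl e1]
  rw [Finset.prod_congr rfl e2] at a3
  rw [a1, a4]
  generalize (∏ r ∈ Finset.range l, pochInf (p * w / q ^ (r + 1)) p) = A1 at *
  generalize (∏ r ∈ Finset.range l, pochInf (q ^ (r + 1) / w) p) = A2 at *
  rw [div_eq_div_iff (by positivity) (by positivity)]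
  rw [a2] at a3
  linear_combination A1 * EE (p * w) p q * pochInf w q * a3

include hq0 in
/-- prefactor, first kind; no vanishing needed in numerators -/
lemma gA {x : ℂ} (hx0 : x ≠ 0) (κ : ℕ) (h1 : EE (p / q ^ κ * x) p q ≠ 0) :
    EE (q ^ (κ + 1) / x) p q / EE (p / q ^ κ * x) p q * ∏ r ∈ Finset.range κ, th p (q ^ (r + 1) / x) =
      EE (q / x) p q / EE (p * x) p q := by
  have a3 := EE_iter hp hq (q / x) κ
  have a4 := EE_iter' hp hq0 hq (p * x) κ
  rw [show q ^ κ * (q / x) = q ^ (κ + 1) / x by ring] at a3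
  rw [show p * x / q ^ κ = p / q ^ κ * x by ring] at a4
  have e1 : ∀ r ∈ Finset.range κ, pochInf (p / (q ^ (r + 1) / x)) p =
      pochInf (p * x / q ^ (r + 1)) p := by
    intro r _
    congr 1
    field_simp
  have e2 : ∀ r ∈ Finset.range κ, pochInf (q ^ r * (q / x)) p =
      pochInf (q ^ (r + 1) / x) p := by
    intro r _
    congr 1
    ring
  simp only [th]
  rw [Finset.prod_mul_distrib, Finset.prod_congr rfl e1]
  rw [Finset.prod_congr rfl e2] at a3
  rw [a4] at h1
  rw [a3, a4]
  have h2 := left_ne_zero_of_mul h1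
  have h3 := right_ne_zero_of_mul h1
  generalize (∏ r ∈ Finset.range κ, pochInf (p * x / q ^ (r + 1)) p) = A1 at *
  field_simp

include hq0 in
/-- prefactor, second kind -/
lemma gB {x : ℂ} (hx0 : x ≠ 0) (l : ℕ) (h1 : ‖q * x‖ < 1) :
    EE (p / q ^ l / x) p q / EE (q ^ (l + 1) * x) p q =
      (∏ r ∈ Finset.range l, th p (q ^ (r + 1) * x)) * (EE (p / x) p q / EE (q * x) p q) := by
  have a3 := EE_iter hp hq (q * x) l
  have a4 := EE_iter' hp hq0 hq (p / x) l
  rw [show q ^ l * (q * x) = q ^ (l + 1) * x by ring] at a3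
  rw [show p / x / q ^ l = p / q ^ l / x by ring] at a4
  have e1 : ∀ r ∈ Finset.range l, pochInf (p / (q ^ (r + 1) * x)) p =
      pochInf (p / x / q ^ (r + 1)) p := by
    intro r _
    congr 1
    field_simp
  have e2 : ∀ r ∈ Finset.range l, pochInf (q ^ r * (q * x)) p =
      pochInf (q ^ (r + 1) * x) p := by
    intro r _
    congr 1
    ring
  simp only [th]
  rw [Finset.prod_mul_distrib, Finset.prod_congr rfl e1]
  rw [Finset.prod_congr rfl e2] at a3
  have n1 := EE_ne_zero_of_lt hp hq h1
  have n2 := EE_ne_zero_pow hp hq l h1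
  rw [a4]
  rw [a3] at n1 ⊢
  have n3 := left_ne_zero_of_mul n1
  generalize (∏ r ∈ Finset.range l, pochInf (p / x / q ^ (r + 1)) p) = A1 at *
  generalize (∏ r ∈ Finset.range l, pochInf (q ^ (r + 1) * x) p) = A2 at *
  generalize EE (q ^ (l + 1) * x) p q = A3 at *
  generalize EE (p / x) p q = A4 at *
  field_simp

lemma vecE {x : ℂ} (hx : x ≠ 0) (h1 : ‖p * q * x‖ < 1) (h2 : ‖p * q / x‖ < 1) :
    EE x p q * EE x⁻¹ p q / (EE (p * q * x) p q * EE (p * q / x) p q) = th p x * th q x⁻¹ := by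
  have n1 := EE_ne_zero_of_lt hp hq h1
  have n2 := EE_ne_zero_of_lt hp hq h2
  rw [EE_rec' x hp hq, EE_rec (q * x) hp hq, EE_rec x⁻¹ hp hq, EE_rec' (p * x⁻¹) hp hq]
  rw [show p * (q * x) = p * q * x by ring, show q * (p * x⁻¹) = p * q / x by field_simp]
  unfold th
  rw [show p * x⁻¹ = p / x by ring, show q / x⁻¹ = q * x by field_simp]
  generalize EE (p * q * x) p q = A1 at *
  generalize EE (p * q / x) p q = A2 at *
  generalize pochInf x p = B1
  generalize pochInf (p / x) p = B2
  generalize pochInf (q * x) q = B3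
  generalize pochInf x⁻¹ q = B4
  field_simp

end

lemma prod_offdiag : ∀ {n : ℕ} (F : Fin n → Fin n → ℂ),
    ∏ i, ∏ k, F i k = (∏ i, F i i) * PP fun i k => F i k * F k i := by
  intro n
  induction n with
  | zero => intro F; simp [PP]
  | succ n ih =>
    intro F
    rw [PP_succ, Fin.prod_univ_succ]
    simp_rw [Fin.prod_univ_succ]
    simp only [Finset.prod_mul_distrib]
    rw [ih (fun i k => F i.succ k.succ)]
    ring

lemma VV_inv {q : ℂ} (hq0 : q ≠ 0) (hq : ‖q‖ < 1) {n : ℕ} (f : Fin n → ℂ) (hf : ∀ i, f i ≠ 0) :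
    VV q f = sg n * (∏ i, f i) ^ (n - 1) * VV q (fun i => (f i)⁻¹) := by
  rw [VV_eq_PP, VV_eq_PP, sg, ← PP_pair, ← PP_mul, ← PP_mul]
  refine PP_congr fun a b _ => ?_
  rw [dl_flip hq0 hq (hf a) (hf b), dl]
  have := hf a
  have := hf b
  rw [show (f a)⁻¹ / (f b)⁻¹ = f b / f a by field_simp]
  field_simp

lemma baseE {p q : ℂ} (hp : ‖p‖ < 1) (hq : ‖q‖ < 1)
    {n : ℕ} (f : Fin n → ℂ) (hf : ∀ i, f i ≠ 0) (h1 : ∀ i k, ‖p * (f i / f k)‖ < 1)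
    (h2 : ∀ i k, i ≠ k → th p (f i / f k) ≠ 0) :
    (∏ i, ∏ k, EE (q / (f i / f k)) p q / EE (p * (f i / f k)) p q) * pochInf p p ^ n * VV p f =
      pochInf q q ^ n * VV q f := by
  have hpp : pochInf p p ≠ 0 := pochInf_ne_zero_of_lt hp hp
  rw [prod_offdiag]
  have e1 : ∀ i, EE (q / (f i / f i)) p q / EE (p * (f i / f i)) p q = pochInf q q / pochInf p p := by
    intro i
    rw [div_self (hf i), div_one, mul_one, EE_rec q hp hq, EE_rec' p hp hq, mul_comm q p]
    have : EE (p * q) p q ≠ 0 := EE_ne_zero_of_lt hp hq (by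
      rw [norm_mul]; nlinarith [norm_nonneg p, norm_nonneg q])
    field_simp
  simp_rw [e1]
  rw [Finset.prod_const, Finset.card_univ, Fintype.card_fin, div_pow]
  have e2 : (PP fun i k => EE (q / (f i / f k)) p q / EE (p * (f i / f k)) p q *
      (EE (q / (f k / f i)) p q / EE (p * (f k / f i)) p q)) * VV p f = VV q f := by
    rw [VV_eq_PP, VV_eq_PP, ← PP_mul]
    refine PP_congr fun i k hik => ?_
    unfold dl
    have hth := h2 i k hik.ne
    have m1 := EE_ne_zero_of_lt hp hq (h1 i k)
    have m2 := EE_ne_zero_of_lt hp hq (h1 k i)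
    have hx : f i / f k ≠ 0 := div_ne_zero (hf _) (hf _)
    rw [show f k / f i = (f i / f k)⁻¹ by rw [inv_div]] at *
    generalize f i / f k = x at *
    have hx1 : 1 - x⁻¹ ≠ 0 := by
      intro h
      have : x = 1 := by rw [sub_eq_zero] at h; simpa using h.symm
      rw [this, th_one] at hth; exact hth rfl
    have b1 := (EE_rec x hp hq).symm.trans (EE_rec' x hp hq)
    have b2 := (EE_rec x⁻¹ hp hq).symm.trans (EE_rec' x⁻¹ hp hq)
    rw [pochInf_rec x⁻¹ hp, pochInf_rec x⁻¹ hq] at b2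
    unfold th at *
    rw [show q / x⁻¹ = q * x by field_simp]
    rw [show q * x⁻¹ = q / x by ring] at *
    rw [show p * x⁻¹ = p / x by ring] at *
    generalize EE (p * x) p q = A1 at *
    generalize EE (p / x) p q = A2 at *
    generalize EE (q * x) p q = A3 at *
    generalize EE (q / x) p q = A4 at *
    generalize pochInf x p = B1 at *
    generalize pochInf (p / x) p = B2 at *
    generalize pochInf x q = B3 at *
    generalize pochInf (q / x) q = B4 at *
    apply mul_left_cancel₀ hx1
    apply mul_left_cancel₀ (mul_ne_zero m1 m2)
    rw [show A1 * A2 * ((1 - x⁻¹) * (A4 / A1 * (A3 / A2) * (f k * (B1 * B2)))) =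
      (1 - x⁻¹) * A4 * A3 * f k * B1 * B2 by field_simp]
    linear_combination f k * (-(A4 * (1 - x⁻¹) * B2) * b1 - B3 * A1 * b2)
  rw [← e2]
  generalize PP _ = A1
  field_simp

end SD

namespace SD
open Filter Topology MeasureTheory

/-- full vector -/
noncomputable def al {n : ℕ} (l : Fin n → ℕ) (q : ℂ) (f : Fin n → ℂ) (a : Fin (n + ∑ i, l i)) : ℂ :=
  q ^ lv l a * f (bs l a)

lemma al_append {n : ℕ} (l : Fin n → ℕ) (q : ℂ) (f : Fin n → ℂ) :
    al l q f = Fin.append f (yy l q fun i => (f i)⁻¹) := by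
  funext a
  refine Fin.addCases (fun i => ?_) (fun x => ?_) a
  · simp [al]
  · simp [al, yy]

lemma VV_al {p q : ℂ} (hp0 : p ≠ 0) (hp : ‖p‖ < 1) (hq0 : q ≠ 0) {n : ℕ} (l : Fin n → ℕ)
    (f : Fin n → ℂ) (hf : ∀ i, f i ≠ 0) :
    VV p (al l q f) = VV p f * VV p (yy l q fun i => (f i)⁻¹) *
      ((-1) ^ (n * ∑ i, l i) * (∏ i, f i) ^ (∑ i, l i) *
        ∏ i, ∏ k, ∏ r ∈ Finset.range (l k), th p (q ^ (r + 1) * (f k / f i))) := by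
  rw [al_append, VV_append]
  congr 1
  have h : ∀ i : Fin n, ∏ j, dl p (f i) (yy l q (fun i => (f i)⁻¹) j) =
      (-1) ^ (∑ i, l i) * (f i) ^ (∑ i, l i) *
        ∏ k, ∏ r ∈ Finset.range (l k), th p (q ^ (r + 1) * (f k / f i)) := by
    intro i
    have h2 : ∀ j, dl p (f i) (yy l q (fun i => (f i)⁻¹) j) = (-1) * f i *
        th p (q ^ lv l (Fin.natAdd n j) * (f (bs l (Fin.natAdd n j)) / f i)) := by
      intro j
      rw [dl_flip hp0 hp (hf i) (by
        unfold yy; exact div_ne_zero (pow_ne_zero _ hq0) (inv_ne_zero (hf _)))]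
      unfold yy
      rw [div_inv_eq_mul, mul_div_assoc]; ring
    rw [Finset.prod_congr rfl fun j _ => h2 j, Finset.prod_mul_distrib, Finset.prod_const,
      Finset.card_univ, Fintype.card_fin, prod_right l fun k t => th p (q ^ t * (f k / f i)), mul_pow]
  rw [Finset.prod_congr rfl fun i _ => h i, Finset.prod_mul_distrib, Finset.prod_mul_distrib,
    Finset.prod_const, Finset.card_univ, Fintype.card_fin, Finset.prod_pow, ← pow_mul,
    mul_comm n]

lemma PP_const (c : ℂ) : ∀ n : ℕ, PP (n := n) (fun _ _ => c) = c ^ (n.choose 2) := by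
  intro n
  induction n with
  | zero => simp [PP]
  | succ n ih =>
    rw [PP_succ, ih]
    simp [Nat.choose_succ_succ' n 1, pow_add]

lemma choose_two_add (m : ℕ) : ∀ c : ℕ, (m + c).choose 2 = m.choose 2 + c.choose 2 + m * c := by
  intro c
  induction c with
  | zero => simp
  | succ c ih =>
    rw [← add_assoc, Nat.choose_succ_succ' _ 1, Nat.choose_succ_succ' c 1, ih]
    simp only [Nat.reduceAdd, Nat.choose_one_right]
    ring

lemma VV_smul {p c : ℂ} (hc : c ≠ 0) {n : ℕ} (f : Fin n → ℂ) :
    VV p (fun i => c * f i) = c ^ (n.choose 2) * VV p f := by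
  rw [VV_eq_PP, VV_eq_PP, ← PP_const, ← PP_mul]
  exact PP_congr fun a b _ => dl_smul hc

section
variable {p q : ℂ} (hp0 : p ≠ 0) (hp : ‖p‖ < 1) (hq0 : q ≠ 0) (hq : ‖q‖ < 1)
  {m n : ℕ} (κ : Fin m → ℕ) (l : Fin n → ℕ) (s : Fin m → ℂ) (r : Fin n → ℂ)
  (hs : ∀ i, s i ≠ 0) (hr : ∀ i, r i ≠ 0)
include hp0 hp hq0 hq

include hs in
lemma starA (h0 : ∀ i k, ‖p / q ^ κ k * (s i / s k)‖ < 1) (h1 : ∀ i k, ‖p * (s i / s k)‖ < 1)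
    (h2 : ∀ i k, i ≠ k → th p (s i / s k) ≠ 0) :
    (∏ i, ∏ k, EE (q ^ (κ k + 1) / (s i / s k)) p q / EE (p / q ^ κ k * (s i / s k)) p q) *
      pochInf p p ^ m * VV p (al κ q s) = pochInf q q ^ m * VV q s * (-1) ^ (m * ∑ i, κ i) *
        (∏ i, s i) ^ (∑ i, κ i) * VV p (yy κ q fun i => (s i)⁻¹) := by
  have hb := baseE hp hq s hs h1 h2
  rw [VV_al hp0 hp hq0 κ s hs, ← hb]
  have : ∀ i k, EE (q / (s i / s k)) p q / EE (p * (s i / s k)) p q =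
      EE (q ^ (κ k + 1) / (s i / s k)) p q / EE (p / q ^ κ k * (s i / s k)) p q *
      ∏ r ∈ Finset.range (κ k), th p (q ^ (r + 1) * (s k / s i)) := by
    intro i k
    rw [← gA hp hq0 hq (div_ne_zero (hs i) (hs k)) (κ k) (EE_ne_zero_of_lt hp hq (h0 i k))]
    congr 1
    refine Finset.prod_congr rfl fun t _ => ?_
    rw [← inv_div (s i), div_eq_mul_inv]
  simp_rw [this, Finset.prod_mul_distrib]
  ring

include hr in
lemma starB (h1 : ∀ i k, ‖q * (r i / r k)‖ < 1)
    (h2 : ∀ i k, i ≠ k → th q (r i / r k) ≠ 0) :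
    (∏ i, ∏ k, EE (p / q ^ l k / (r i / r k)) p q / EE (q ^ (l k + 1) * (r i / r k)) p q) *
      pochInf q q ^ n * VV q r * VV p (yy l q r) = pochInf p p ^ n * sg n * (∏ i, r i) ^ (n - 1) *
       (-1) ^ (n * ∑ i, l i) * (∏ i, r i) ^ (∑ i, l i) * VV p (al l q fun i => (r i)⁻¹) := by
  have hb := baseE hq hp r hr h1 h2
  simp_rw [EE_symm _ q p] at hb
  rw [VV_inv hp0 hp r hr] at hb
  rw [VV_al hp0 hp hq0 l _ (fun i => inv_ne_zero (hr i))]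
  have : ∀ i k, EE (p / q ^ l k / (r i / r k)) p q / EE (q ^ (l k + 1) * (r i / r k)) p q = _ :=
    fun i k => gB hp hq0 hq (div_ne_zero (hr i) (hr k)) (l k) (h1 i k)
  simp_rw [this, Finset.prod_mul_distrib]
  have h3 : ∀ i k, (r k)⁻¹ / (r i)⁻¹ = r i / r k := fun i k => by
    rw [inv_div_inv]
  simp_rw [h3, inv_inv]
  rw [Finset.prod_inv_distrib]
  have hR : (∏ i, r i) ^ (∑ i, l i) * ((∏ i, r i)⁻¹) ^ (∑ i, l i) = 1 := by
    rw [← mul_pow, mul_inv_cancel₀ (Finset.prod_ne_zero_iff.mpr fun i _ => hr i), one_pow]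
  have hm : ((-1 : ℂ) ^ (n * ∑ i, l i)) * (-1) ^ (n * ∑ i, l i) = 1 := by
    rw [← mul_pow]; simp
  simp_rw [← Finset.prod_mul_distrib] at hb ⊢
  simp_rw [Finset.prod_mul_distrib] at hb ⊢
  generalize (∏ i, ∏ k, ∏ t ∈ Finset.range (l k), th p (q ^ (t + 1) * (r i / r k))) = X at *
  generalize (∏ i, r i) ^ (∑ i, l i) = Y at *
  generalize ((∏ i, r i)⁻¹) ^ (∑ i, l i) = Y' at *
  generalize ((-1 : ℂ) ^ (n * ∑ i, l i)) = Z at *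
  generalize VV p (yy l q r) = W at *
  generalize VV p (fun i => (r i)⁻¹) = W' at *
  linear_combination X * W * hb - pochInf p p ^ n * sg n * (∏ i, r i) ^ (n - 1) * W' * W * X * hR * Z * Z - pochInf p p ^ n * sg n * (∏ i, r i) ^ (n - 1) * W' * W * X * hm

include hs hr in
lemma starAB (h0 : ∀ i k, ‖p / q ^ κ i / (s i / r k)‖ < 1) (h1 : ∀ i k, ‖p / (s i / r k)‖ < 1)
    (h2 : ∀ i k, ‖q * (s i / r k)‖ < 1) :
    (∏ i, ∏ k, EE (q ^ (κ i + 1) * (s i / r k)) p q / EE (p / q ^ κ i / (s i / r k)) p q *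
      (EE (p / q ^ l k / (s i / r k)) p q / EE (q ^ (l k + 1) * (s i / r k)) p q)) *
      (∏ b, ∏ x, th p (al l q (fun i => (r i)⁻¹) b * yy κ q (fun i => (s i)⁻¹) x)) =
      ∏ a, ∏ x, th p (al κ q s a * yy l q r x) := by
  have e1 : ∏ b, ∏ x, th p (al l q (fun i => (r i)⁻¹) b * yy κ q (fun i => (s i)⁻¹) x) =
      ∏ i, ∏ k, (∏ t ∈ Finset.range (κ i), th p (q ^ (t + 1) * (s i / r k))) *
        ∏ t ∈ Finset.range (κ i), ∏ u ∈ Finset.range (l k), th p (q ^ (t + 1) * q ^ (u + 1) * (s i / r k)) := by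
    have : ∀ b, ∏ x, th p (al l q (fun i => (r i)⁻¹) b * yy κ q (fun i => (s i)⁻¹) x) =
        ∏ i, ∏ t ∈ Finset.range (κ i), th p (q ^ (t + 1) * q ^ lv l b * (s i / r (bs l b))) := by
      intro b
      rw [← prod_right κ fun i t => th p (q ^ t * q ^ lv l b * (s i / r (bs l b)))]
      refine Finset.prod_congr rfl fun x _ => ?_
      congr 1
      simp only [al, yy, div_inv_eq_mul]
      ring
    rw [Finset.prod_congr rfl fun b _ => this b, prod_all l fun k u =>
      ∏ i, ∏ t ∈ Finset.range (κ i), th p (q ^ (t + 1) * q ^ u * (s i / r k))]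
    simp_rw [Finset.prod_range_succ']
    rw [Finset.prod_congr rfl fun k _ => by rw [Finset.prod_comm, ← Finset.prod_mul_distrib], Finset.prod_comm]
    refine Finset.prod_congr rfl fun i _ => Finset.prod_congr rfl fun k _ => ?_
    rw [Finset.prod_comm, mul_comm]
    simp
  have e2 : ∏ a, ∏ x, th p (al κ q s a * yy l q r x) =
      ∏ i, ∏ k, (∏ u ∈ Finset.range (l k), th p (q ^ (u + 1) * (s i / r k))) *
        ∏ t ∈ Finset.range (κ i), ∏ u ∈ Finset.range (l k), th p (q ^ (t + 1) * q ^ (u + 1) * (s i / r k)) := by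
    have : ∀ a, ∏ x, th p (al κ q s a * yy l q r x) =
        ∏ k, ∏ u ∈ Finset.range (l k), th p (q ^ lv κ a * q ^ (u + 1) * (s (bs κ a) / r k)) := by
      intro a
      rw [← prod_right l fun k u => th p (q ^ lv κ a * q ^ u * (s (bs κ a) / r k))]
      refine Finset.prod_congr rfl fun x _ => ?_
      congr 1
      simp only [al, yy]
      ring
    rw [Finset.prod_congr rfl fun b _ => this b, prod_all κ fun i t =>
      ∏ k, ∏ u ∈ Finset.range (l k), th p (q ^ t * q ^ (u + 1) * (s i / r k))]
    simp_rw [Finset.prod_range_succ']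
    refine Finset.prod_congr rfl fun i _ => ?_
    rw [Finset.prod_comm, ← Finset.prod_mul_distrib]
    refine Finset.prod_congr rfl fun k _ => ?_
    rw [mul_comm]
    simp
  rw [e1, e2, ← Finset.prod_mul_distrib]
  refine Finset.prod_congr rfl fun i _ => ?_
  rw [← Finset.prod_mul_distrib]
  refine Finset.prod_congr rfl fun k _ => ?_
  rw [← mul_assoc]
  congr 1
  have hw : s i / r k ≠ 0 := div_ne_zero (hs i) (hr k)
  have h0' := h0 i k
  have h1' := EE_ne_zero_of_lt hp hq (h1 i k)
  have h2' := h2 i k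
  have n2 := EE_ne_zero_of_lt hp hq h2'
  generalize s i / r k = w at *
  have g1 := gB hp hq0 hq hw (l k) h2'
  have g2 := gA hp hq0 hq (inv_ne_zero hw) (κ i) (EE_ne_zero_of_lt hp hq (by
    rw [← div_eq_mul_inv]; exact h0'))
  simp only [div_inv_eq_mul] at g2
  simp only [← div_eq_mul_inv] at g2
  rw [g1]
  rw [show ∀ a b c d : ℂ, a * (b * c) * d = b * c * (a * d) from fun a b c d => by ring, g2]
  generalize EE (p / w) p q = A1 at *
  generalize EE (q * w) p q = A2 at *
  generalize (∏ x ∈ Finset.range (l k), th p (q ^ (x + 1) * w)) = A3 at *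
  field_simp

include hs hr in
lemma star {a : ℂ} (ha : a ≠ 0) (ham : a ^ m = (∏ i, s i) * ∏ k, r k) (hm : 0 < m) (hn : 0 < n)
    (hK : n + ∑ k, l k = m + ∑ i, κ i)
    (hA0 : ∀ i k, ‖p / q ^ κ k * (s i / s k)‖ < 1) (hA1 : ∀ i k, ‖p * (s i / s k)‖ < 1)
    (hA2 : ∀ i k, i ≠ k → th p (s i / s k) ≠ 0)
    (hB1 : ∀ i k, ‖q * (r i / r k)‖ < 1)
    (hB2 : ∀ i k, i ≠ k → th q (r i / r k) ≠ 0)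
    (h0 : ∀ i k, ‖p / q ^ κ i / (s i / r k)‖ < 1) (h1 : ∀ i k, ‖p / (s i / r k)‖ < 1)
    (h2 : ∀ i k, ‖q * (s i / r k)‖ < 1)
    (hT : ∀ a x, th p (al κ q s a * yy l q r x) ≠ 0) :
    ((∏ i, ∏ k, EE (q ^ (κ k + 1) / (s i / s k)) p q / EE (p / q ^ κ k * (s i / s k)) p q) *
     (∏ i, ∏ k, EE (q ^ (κ i + 1) * (s i / r k)) p q / EE (p / q ^ κ i / (s i / r k)) p q *
      (EE (p / q ^ l k / (s i / r k)) p q / EE (q ^ (l k + 1) * (s i / r k)) p q)) *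
     (∏ i, ∏ k, EE (p / q ^ l k / (r i / r k)) p q / EE (q ^ (l k + 1) * (r i / r k)) p q)) *
     pochInf p p ^ m * pochInf q q ^ n *
     (VV q r * VV p (al κ q s) * VV p (yy l q r) / (∏ a, ∏ x, th p (al κ q s a * yy l q r x)) *
       (sg n * (-1) ^ (n * ∑ k, l k))) =
     pochInf p p ^ n * pochInf q q ^ m *
     (VV q (fun i => a / s i) * VV p (al l q fun k => a / r k) * VV p (yy κ q fun i => a / s i) /
       (∏ b, ∏ x, th p (al l q (fun k => a / r k) b * yy κ q (fun i => a / s i) x)) *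
       (sg m * (-1) ^ (m * ∑ i, κ i))) := by
  have eA := starA hp0 hp hq0 hq κ s hs hA0 hA1 hA2
  have eB := starB hp0 hp hq0 hq l r hr hB1 hB2
  have eAB := starAB hp0 hp hq0 hq κ l s r hs hr h0 h1 h2
  have f1 : (fun i => a / s i) = fun i => a * (s i)⁻¹ := by funext i; rw [div_eq_mul_inv]
  have f2 : (al l q fun k => a / r k) = fun b => a * al l q (fun k => (r k)⁻¹) b := by
    funext b; simp only [al]; ring
  have f3 : (yy κ q fun i => a / s i) = fun x => a⁻¹ * yy κ q (fun i => (s i)⁻¹) x := by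
    funext x; simp only [yy, div_inv_eq_mul, div_div_eq_mul_div]; ring
  have f4 : ∀ b x, a * al l q (fun k => (r k)⁻¹) b * (a⁻¹ * yy κ q (fun i => (s i)⁻¹) x) =
      al l q (fun k => (r k)⁻¹) b * yy κ q (fun i => (s i)⁻¹) x := by
    intro b x; field_simp
  rw [f2, f3, f1, VV_smul ha, VV_smul ha, VV_smul (inv_ne_zero ha)]
  simp_rw [f4]
  rw [VV_inv hq0 hq s hs] at eA
  have hTn : (∏ a, ∏ x, th p (al κ q s a * yy l q r x)) ≠ 0 :=
    Finset.prod_ne_zero_iff.mpr fun a _ => Finset.prod_ne_zero_iff.mpr fun x _ => hT a x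
  rw [← eAB] at hTn ⊢
  have hT' := right_ne_zero_of_mul hTn
  have hAB' := left_ne_zero_of_mul hTn
  have hpw : a ^ (m.choose 2) * a ^ ((n + ∑ k, l k).choose 2) * a⁻¹ ^ ((∑ i, κ i).choose 2) =
      (∏ i, s i) ^ (m - 1) * (∏ i, s i) ^ (∑ i, κ i) * ((∏ k, r k) ^ (n - 1) * (∏ k, r k) ^ (∑ k, l k)) := by
    rw [← pow_add (∏ i, s i), ← pow_add (∏ k, r k), show n - 1 + ∑ k, l k = m - 1 + ∑ i, κ i by omega, ← mul_pow, ← ham,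
      hK, choose_two_add, pow_add, pow_add, inv_pow]
    have : a ^ m.choose 2 * a ^ m.choose 2 = (a ^ m) ^ (m - 1) := by
      rw [← pow_add, ← pow_mul, Nat.choose_two_right, ← Nat.mul_two,
        Nat.div_mul_cancel (Nat.even_mul_pred_self m).two_dvd]
    rw [pow_add (a ^ m), ← this, ← pow_mul]
    have h3 : a ^ (∑ i, κ i).choose 2 ≠ 0 := pow_ne_zero _ ha
    field_simp
  have hZ : ((-1 : ℂ) ^ (n * ∑ i, l i)) * (-1) ^ (n * ∑ i, l i) = 1 := by
    rw [← mul_pow]; simp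
  have hsg := sg_mul_self n
  generalize (∏ b, ∏ x, th p (al l q (fun i => (r i)⁻¹) b * yy κ q (fun i => (s i)⁻¹) x)) = T' at *
  generalize (∏ i, ∏ k, EE (q ^ (κ i + 1) * (s i / r k)) p q / EE (p / q ^ κ i / (s i / r k)) p q *
      (EE (p / q ^ l k / (s i / r k)) p q / EE (q ^ (l k + 1) * (s i / r k)) p q)) = AB at *
  generalize (∏ i, ∏ k, EE (q ^ (κ k + 1) / (s i / s k)) p q / EE (p / q ^ κ k * (s i / s k)) p q) = AA at *
  generalize (∏ i, ∏ k, EE (p / q ^ l k / (r i / r k)) p q / EE (q ^ (l k + 1) * (r i / r k)) p q) = BB at *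
  generalize ((-1 : ℂ) ^ (n * ∑ i, l i)) = Z at *
  generalize a ^ (m.choose 2) = a1 at *
  generalize a ^ ((n + ∑ k, l k).choose 2) = a2 at *
  generalize a⁻¹ ^ ((∑ i, κ i).choose 2) = a3 at *
  generalize VV q r = V1 at *
  generalize VV p (al κ q s) = V2 at *
  generalize VV p (yy l q r) = V3 at *
  generalize VV q (fun i => (s i)⁻¹) = V4 at *
  generalize VV p (al l q fun k => (r k)⁻¹) = V5 at *
  generalize VV p (yy κ q fun i => (s i)⁻¹) = V6 at *
  calc _ = (AA * pochInf p p ^ m * V2) * (BB * pochInf q q ^ n * V1 * V3) * (sg n * Z) / T' := by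
        field_simp
    _ = (sg n * sg n) * (Z * Z) * (pochInf p p ^ n * pochInf q q ^ m * V4 * V5 * V6 * (sg m * (-1) ^ (m * ∑ i, κ i))) / T' *
        ((∏ i, s i) ^ (m - 1) * (∏ i, s i) ^ (∑ i, κ i) * ((∏ k, r k) ^ (n - 1) * (∏ k, r k) ^ (∑ k, l k))) := by
        rw [eA, eB]; ring
    _ = _ := by rw [hsg, hZ, ← hpw]; ring

end

end SD

namespace SD
open Filter Topology MeasureTheory

noncomputable def FE (p q w v v' : ℂ) : ℂ :=
  EE (p * q / w) p q * EE (v' * w) p q / (EE w p q * EE (v / w) p q)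

noncomputable def GE (p q x : ℂ) : ℂ :=
  EE x p q * EE x⁻¹ p q / (EE (p * q * x) p q * EE (p * q / x) p q)

noncomputable def Je (p q : ℂ) {ι : Type*} [Fintype ι] (S v v' : ι → ℂ) {n : ℕ} (z : Fin n → ℂ) : ℂ :=
  (∏ j, ∏ i, FE p q (S i * z j) (v i) (v' i)) * PP fun i j => GE p q (z i / z j)

noncomputable def pref (p q : ℂ) {ι : Type*} [Fintype ι] (S v v' : ι → ℂ) : ℂ :=
  ∏ x, ∏ y, EE (v' y / (S x / S y)) p q / EE (v y * (S x / S y)) p q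

noncomputable def JJ (p q : ℂ) {ι : Type*} [Fintype ι] (S v v' : ι → ℂ) (n : ℕ) : ℂ :=
  cInt n (fun x => Je p q S v v' fun j => ex (x j)) 0

noncomputable def DD (p q : ℂ) {ι : Type*} [Fintype ι] (n m : ℕ) (S : ι → ℂ) (a : ℂ) (v v' : ι → ℂ) : ℂ :=
  pochInf p p ^ n * pochInf q q ^ n / ((n + 1).factorial : ℂ) * JJ p q S v v' n -
  pochInf p p ^ m * pochInf q q ^ m / ((m + 1).factorial : ℂ) * pref p q S v v' *
    JJ p q (fun i => a / S i) v' v m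

lemma Je_equiv (p q : ℂ) {ι ι' : Type*} [Fintype ι] [Fintype ι'] (e : ι' ≃ ι) (S v v' : ι → ℂ) {n : ℕ}
    (z : Fin n → ℂ) : Je p q (fun i => S (e i)) (fun i => v (e i)) (fun i => v' (e i)) z = Je p q S v v' z := by
  unfold Je
  congr 1
  refine Finset.prod_congr rfl fun j _ => ?_
  exact e.prod_comp fun i => FE p q (S i * z j) (v i) (v' i)

lemma pref_equiv (p q : ℂ) {ι ι' : Type*} [Fintype ι] [Fintype ι'] (e : ι' ≃ ι) (S v v' : ι → ℂ) :
    pref p q (fun i => S (e i)) (fun i => v (e i)) (fun i => v' (e i)) = pref p q S v v' := by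
  unfold pref
  rw [← e.prod_comp]
  refine Finset.prod_congr rfl fun j _ => ?_
  exact e.prod_comp fun i => EE (v' i / (S (e j) / S i)) p q / EE (v i * (S (e j) / S i)) p q

lemma DD_equiv (p q : ℂ) {ι ι' : Type*} [Fintype ι] [Fintype ι'] (e : ι' ≃ ι) (n m : ℕ) (S : ι → ℂ) (a : ℂ)
    (v v' : ι → ℂ) : DD p q n m (fun i => S (e i)) a (fun i => v (e i)) (fun i => v' (e i)) =
      DD p q n m S a v v' := by
  unfold DD JJ
  rw [pref_equiv]
  simp_rw [Je_equiv p q e, Je_equiv p q e (fun i => a / S i)]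

section
variable {α : Type*} [TopologicalSpace α] {q : ℂ} (hq : ‖q‖ < 1) {s : Set α}
include hq

lemma GE_continuousOn {P x : α → ℂ} (hP : ContinuousOn P s) (hx : ContinuousOn x s)
    (h1 : ∀ a ∈ s, ‖P a‖ < 1) (h2 : ∀ a ∈ s, ‖x a‖ = 1) :
    ContinuousOn (fun a => GE (P a) q (x a)) s := by
  have hx0 : ∀ a ∈ s, x a ≠ 0 := fun a ha => norm_pos_iff.mp (by rw [h2 a ha]; exact one_pos)
  have hpq : ∀ a ∈ s, ‖P a * q‖ < 1 := fun a ha => by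
    rw [norm_mul]; nlinarith [norm_nonneg (P a), norm_nonneg q, h1 a ha]
  unfold GE
  refine ContinuousOn.div₀ (.mul (EE_continuousOn hq hx hP h1) (EE_continuousOn hq (hx.inv₀ hx0) hP h1))
    (.mul (EE_continuousOn hq ((hP.mul continuousOn_const).mul hx) hP h1)
      (EE_continuousOn hq ((hP.mul continuousOn_const).div₀ hx hx0) hP h1)) fun a ha => ?_
  refine mul_ne_zero (EE_ne_zero_of_lt (h1 a ha) hq ?_) (EE_ne_zero_of_lt (h1 a ha) hq ?_)
  · rw [norm_mul, h2 a ha, mul_one]; exact hpq a ha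
  · rw [norm_div, h2 a ha, div_one]; exact hpq a ha

lemma FE_continuousOn {P w v v' : α → ℂ} (hP : ContinuousOn P s) (hw : ContinuousOn w s)
    (hv : ContinuousOn v s) (hv' : ContinuousOn v' s)
    (h1 : ∀ a ∈ s, ‖P a‖ < 1) (h0 : ∀ a ∈ s, w a ≠ 0) (h2 : ∀ a ∈ s, ‖w a‖ < 1)
    (h3 : ∀ a ∈ s, ‖v a‖ < ‖w a‖) :
    ContinuousOn (fun a => FE (P a) q (w a) (v a) (v' a)) s := by
  unfold FE
  refine ContinuousOn.div₀ (.mul (EE_continuousOn hq ((hP.mul continuousOn_const).div₀ hw h0) hP h1)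
      (EE_continuousOn hq (hv'.mul hw) hP h1))
    (.mul (EE_continuousOn hq hw hP h1)
      (EE_continuousOn hq (hv.div₀ hw h0) hP h1)) fun a ha => ?_
  refine mul_ne_zero (EE_ne_zero_of_lt (h1 a ha) hq (h2 a ha)) (EE_ne_zero_of_lt (h1 a ha) hq ?_)
  rw [norm_div, div_lt_one (norm_pos_iff.mpr (h0 a ha))]; exact h3 a ha

lemma Je_continuousOn {ι : Type*} [Fintype ι] {n : ℕ} {P : α → ℂ} {S v v' : α → ι → ℂ} {z : α → Fin n → ℂ}
    (hP : ContinuousOn P s) (hS : ∀ i, ContinuousOn (fun a => S a i) s)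
    (hv : ∀ i, ContinuousOn (fun a => v a i) s) (hv' : ∀ i, ContinuousOn (fun a => v' a i) s)
    (hz : ∀ j, ContinuousOn (fun a => z a j) s)
    (h1 : ∀ a ∈ s, ‖P a‖ < 1) (hz1 : ∀ a ∈ s, ∀ j, ‖z a j‖ = 1)
    (h2 : ∀ a ∈ s, ∀ i, ‖S a i‖ < 1) (h3 : ∀ a ∈ s, ∀ i, ‖v a i‖ < ‖S a i‖) :
    ContinuousOn (fun a => Je (P a) q (S a) (v a) (v' a) (z a)) s := by
  have hz0 : ∀ a ∈ s, ∀ j, z a j ≠ 0 := fun a ha j => norm_pos_iff.mp (by rw [hz1 a ha j]; exact one_pos)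
  unfold Je
  refine .mul (continuousOn_finset_prod _ fun j _ => continuousOn_finset_prod _ fun i _ => ?_) ?_
  · refine FE_continuousOn hq hP ((hS i).mul (hz j)) (hv i) (hv' i) h1 (fun a ha => ?_) (fun a ha => ?_)
      (fun a ha => ?_)
    · exact mul_ne_zero (norm_pos_iff.mp ((norm_nonneg _).trans_lt (h3 a ha i))) (hz0 a ha j)
    · rw [norm_mul, hz1 a ha j, mul_one]; exact h2 a ha i
    · rw [norm_mul, hz1 a ha j, mul_one]; exact h3 a ha i
  · unfold PP
    refine continuousOn_finset_prod _ fun i _ => continuousOn_finset_prod _ fun j _ => ?_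
    split_ifs
    · refine GE_continuousOn hq hP ((hz i).div₀ (hz j) (fun a ha => hz0 a ha j)) h1 fun a ha => ?_
      rw [norm_div, hz1 a ha, hz1 a ha, div_one]
    · exact continuousOn_const
end

section
variable {q : ℂ} (hq : ‖q‖ < 1) {U : Set ℂ} (hU : IsOpen U)
include hq hU

lemma GE_differentiableOn {P x : ℂ → ℂ} (hP : DifferentiableOn ℂ P U) (hx : DifferentiableOn ℂ x U)
    (h1 : ∀ a ∈ U, ‖P a‖ < 1) (h2 : ∀ a ∈ U, ‖x a‖ = 1) :
    DifferentiableOn ℂ (fun a => GE (P a) q (x a)) U := by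
  have hx0 : ∀ a ∈ U, x a ≠ 0 := fun a ha => norm_pos_iff.mp (by rw [h2 a ha]; exact one_pos)
  have hpq : ∀ a ∈ U, ‖P a * q‖ < 1 := fun a ha => by
    rw [norm_mul]; nlinarith [norm_nonneg (P a), norm_nonneg q, h1 a ha]
  unfold GE
  refine DifferentiableOn.fun_div (.fun_mul (EE_differentiableOn hq hU hx hP h1) (EE_differentiableOn hq hU (hx.fun_inv hx0) hP h1))
    (.fun_mul (EE_differentiableOn hq hU ((hP.fun_mul (differentiableOn_const _)).fun_mul hx) hP h1)
      (EE_differentiableOn hq hU ((hP.fun_mul (differentiableOn_const _)).fun_div hx hx0) hP h1)) fun a ha => ?_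
  refine mul_ne_zero (EE_ne_zero_of_lt (h1 a ha) hq ?_) (EE_ne_zero_of_lt (h1 a ha) hq ?_)
  · rw [norm_mul, h2 a ha, mul_one]; exact hpq a ha
  · rw [norm_div, h2 a ha, div_one]; exact hpq a ha

lemma FE_differentiableOn {P w v v' : ℂ → ℂ} (hP : DifferentiableOn ℂ P U) (hw : DifferentiableOn ℂ w U)
    (hv : DifferentiableOn ℂ v U) (hv' : DifferentiableOn ℂ v' U)
    (h1 : ∀ a ∈ U, ‖P a‖ < 1) (h0 : ∀ a ∈ U, w a ≠ 0) (h2 : ∀ a ∈ U, ‖w a‖ < 1)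
    (h3 : ∀ a ∈ U, ‖v a‖ < ‖w a‖) :
    DifferentiableOn ℂ (fun a => FE (P a) q (w a) (v a) (v' a)) U := by
  unfold FE
  refine DifferentiableOn.fun_div (.fun_mul (EE_differentiableOn hq hU ((hP.fun_mul (differentiableOn_const _)).fun_div hw h0) hP h1)
      (EE_differentiableOn hq hU (hv'.fun_mul hw) hP h1))
    (.fun_mul (EE_differentiableOn hq hU hw hP h1)
      (EE_differentiableOn hq hU (hv.fun_div hw h0) hP h1)) fun a ha => ?_
  refine mul_ne_zero (EE_ne_zero_of_lt (h1 a ha) hq (h2 a ha)) (EE_ne_zero_of_lt (h1 a ha) hq ?_)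
  rw [norm_div, div_lt_one (norm_pos_iff.mpr (h0 a ha))]; exact h3 a ha

variable {ι : Type*} [Fintype ι] {P : ℂ → ℂ} {S v v' : ℂ → ι → ℂ}
    (hP : DifferentiableOn ℂ P U) (hS : ∀ i, DifferentiableOn ℂ (fun a => S a i) U)
    (hv : ∀ i, DifferentiableOn ℂ (fun a => v a i) U) (hv' : ∀ i, DifferentiableOn ℂ (fun a => v' a i) U)
    (h1 : ∀ a ∈ U, ‖P a‖ < 1)
    (h2 : ∀ a ∈ U, ∀ i, ‖S a i‖ < 1) (h3 : ∀ a ∈ U, ∀ i, ‖v a i‖ < ‖S a i‖)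
include hP hS hv hv' h1 h2 h3

lemma Je_differentiableOn {n : ℕ} (z : Fin n → ℂ) (hz1 : ∀ j, ‖z j‖ = 1) :
    DifferentiableOn ℂ (fun a => Je (P a) q (S a) (v a) (v' a) z) U := by
  have hz0 : ∀ j, z j ≠ 0 := fun j => norm_pos_iff.mp (by rw [hz1 j]; exact one_pos)
  unfold Je
  refine .fun_mul (DifferentiableOn.fun_finset_prod fun j _ => DifferentiableOn.fun_finset_prod fun i _ => ?_) ?_
  · refine FE_differentiableOn hq hU hP ((hS i).fun_mul (differentiableOn_const _)) (hv i) (hv' i) h1 (fun a ha => ?_) (fun a ha => ?_)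
      (fun a ha => ?_)
    · exact mul_ne_zero (norm_pos_iff.mp ((norm_nonneg _).trans_lt (h3 a ha i))) (hz0 j)
    · rw [norm_mul, hz1 j, mul_one]; exact h2 a ha i
    · rw [norm_mul, hz1 j, mul_one]; exact h3 a ha i
  · unfold PP
    refine DifferentiableOn.fun_finset_prod fun i _ => DifferentiableOn.fun_finset_prod fun j _ => ?_
    split_ifs
    · refine GE_differentiableOn hq hU hP (differentiableOn_const _) h1 fun a ha => ?_
      rw [norm_div, hz1, hz1, div_one]
    · exact differentiableOn_const _

lemma JJ_differentiableOn (n : ℕ) :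
    DifferentiableOn ℂ (fun a => JJ (P a) q (S a) (v a) (v' a) n) U := by
  unfold JJ cInt
  refine differentiableOn_integral volume hU (fun a (w : Fin n → UnitAddCircle) =>
    Je (P a) q (S a) (v a) (v' a) fun j =>
      ex ((Fin.snoc (α := fun _ => UnitAddCircle) w (0 - ∑ j, w j) : Fin (n + 1) → UnitAddCircle) j)) ?_ fun w => ?_
  · have hf : ContinuousOn (fun z : ℂ × (Fin n → UnitAddCircle) => z.1) (U ×ˢ Set.univ) :=
      continuous_fst.continuousOn
    have hm : Set.MapsTo (fun z : ℂ × (Fin n → UnitAddCircle) => z.1) (U ×ˢ Set.univ) U :=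
      fun z hz => hz.1
    refine Je_continuousOn hq (P := fun z : ℂ × (Fin n → UnitAddCircle) => P z.1)
      (S := fun z => S z.1) (v := fun z => v z.1) (v' := fun z => v' z.1)
      (hP.continuousOn.comp hf hm) (fun i => (hS i).continuousOn.comp hf hm)
      (fun i => (hv i).continuousOn.comp hf hm) (fun i => (hv' i).continuousOn.comp hf hm) (fun j => ?_)
      (fun a ha => h1 _ ha.1) (fun a ha j => norm_ex _) (fun a ha => h2 _ ha.1) (fun a ha => h3 _ ha.1)
    have hF : Continuous fun x : Fin (n + 1) → UnitAddCircle => ex (x j) := by fun_prop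
    have := (cInt_aux hF).comp (Continuous.prodMk continuous_const
      (continuous_snd (X := ℂ) (Y := Fin n → UnitAddCircle)) : Continuous fun z : ℂ × (Fin n → UnitAddCircle) =>
        ((0 : UnitAddCircle), z.2))
    exact this.continuousOn
  · exact Je_differentiableOn hq hU hP hS hv hv' h1 h2 h3 _ fun j => norm_ex _

lemma pref_differentiableOn :
    DifferentiableOn ℂ (fun a => pref (P a) q (S a) (v a) (v' a)) U := by
  unfold pref
  have hS0 : ∀ a ∈ U, ∀ i, 0 < ‖S a i‖ := fun a ha i => (norm_nonneg _).trans_lt (h3 a ha i)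
  refine DifferentiableOn.fun_finset_prod fun x _ => DifferentiableOn.fun_finset_prod fun y _ => ?_
  have hxy : DifferentiableOn ℂ (fun a => S a x / S a y) U := (hS x).fun_div (hS y) fun a ha =>
    norm_pos_iff.mp (hS0 a ha y)
  refine .fun_div (EE_differentiableOn hq hU ((hv' y).fun_div hxy fun a ha => ?_) hP h1)
    (EE_differentiableOn hq hU ((hv y).fun_mul hxy) hP h1) fun a ha => EE_ne_zero_of_lt (h1 a ha) hq ?_
  · exact div_ne_zero (norm_pos_iff.mp (hS0 a ha x)) (norm_pos_iff.mp (hS0 a ha y))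
  · rw [norm_mul, norm_div, ← mul_div_assoc, div_lt_one (hS0 a ha y)]
    nlinarith [h3 a ha y, h2 a ha x, norm_nonneg (v a y), norm_nonneg (S a x)]

lemma pochInf_differentiableOn : DifferentiableOn ℂ (fun a => pochInf (P a) (P a)) U := by
  simp_rw [pochInf_eq_EE]
  exact EE_differentiableOn (by simp) hU hP hP h1

lemma DD_differentiableOn (n m : ℕ) (A : ℂ → ℂ) (hA : DifferentiableOn ℂ A U)
    (h4 : ∀ a ∈ U, ∀ i, ‖A a‖ < ‖S a i‖) (h5 : ∀ a ∈ U, ∀ i, ‖v' a i‖ < ‖A a / S a i‖) :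
    DifferentiableOn ℂ (fun a => DD (P a) q n m (S a) (A a) (v a) (v' a)) U := by
  unfold DD
  have hS0 : ∀ a ∈ U, ∀ i, 0 < ‖S a i‖ := fun a ha i => (norm_nonneg _).trans_lt (h3 a ha i)
  have hpo := pochInf_differentiableOn hq hU hP hS hv hv' h1 h2 h3
  refine .fun_sub (.fun_mul ?_ (JJ_differentiableOn hq hU hP hS hv hv' h1 h2 h3 n))
    (.fun_mul (.fun_mul ?_ (pref_differentiableOn hq hU hP hS hv hv' h1 h2 h3))
      (JJ_differentiableOn hq hU hP (fun i => hA.fun_div (hS i) fun a ha => norm_pos_iff.mp (hS0 a ha i))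
        hv' hv h1 (fun a ha i => ?_) h5 m))
  · exact ((hpo.fun_pow n).mul_const _).div_const _
  · exact ((hpo.fun_pow m).mul_const _).div_const _
  · rw [norm_div, div_lt_one (hS0 a ha i)]; exact h4 a ha i

end
end SD

namespace SD
open Filter Topology MeasureTheory

lemma Dn_cast (p q : ℂ) {n d K K' : ℕ} (h : K = K') (r : Fin n → ℂ) (y : Fin d → ℂ) (α : Fin K' → ℂ)
    (z : Fin n → ℂ) : Dn p q r y (fun a => α (Fin.cast h a)) z = Dn p q r y α z := by
  subst h; rfl

lemma prod_cast {K K' : ℕ} (h : K = K') (f : Fin K' → ℂ) :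
    ∏ a, f (Fin.cast h a) = ∏ a, f a := by
  subst h; rfl

lemma det_cast {K K' : ℕ} (h : K = K') (f : Fin K' → Fin K → ℂ) :
    (Matrix.of fun a b : Fin K => f (Fin.cast h a) b).det =
      (Matrix.of fun a b : Fin K' => f b (Fin.cast h.symm a)).det := by
  subst h
  rw [← Matrix.det_transpose]; rfl

section
variable {p q : ℂ} (hp0 : p ≠ 0) (hp : ‖p‖ < 1) (hq0 : q ≠ 0) (hq : ‖q‖ < 1)
include hp hq0 hq

lemma spec {m n : ℕ} (κ : Fin m → ℕ) (l : Fin n → ℕ) (s : Fin m → ℂ) (r : Fin n → ℂ)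
    (hs1 : ∀ i, ‖q‖ < ‖s i‖) (hs2 : ∀ i, ‖s i‖ < 1) (hr1 : ∀ k, ‖q‖ < ‖r k‖) (hr2 : ∀ k, ‖r k‖ < 1)
    {N : ℕ} (z : Fin N → ℂ) (hz : ∀ j, ‖z j‖ = 1) :
    (∏ j, ∏ i, FE p q (Sum.elim s r i * z j)
        (Sum.elim (fun i => p / q ^ κ i) (fun k => q ^ (l k + 1)) i)
        (Sum.elim (fun i => q ^ (κ i + 1)) (fun k => p / q ^ l k) i)) =
      ∏ j, (∏ x, th p (yy l q r x / z j)) / ((∏ k, th q (r k * z j)) * ∏ a, th p (al κ q s a * z j)) := by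
  refine Finset.prod_congr rfl fun j _ => ?_
  have hz0 : z j ≠ 0 := norm_pos_iff.mp (by rw [hz j]; exact one_pos)
  have hs0 : ∀ i, s i ≠ 0 := fun i => norm_pos_iff.mp ((norm_nonneg q).trans_lt (hs1 i))
  have hr0 : ∀ i, r i ≠ 0 := fun i => norm_pos_iff.mp ((norm_nonneg q).trans_lt (hr1 i))
  rw [Fintype.prod_sum_type]
  simp only [Sum.elim_inl, Sum.elim_inr]
  have e1 : ∀ i, FE p q (s i * z j) (p / q ^ κ i) (q ^ (κ i + 1)) = _ := fun i =>
    specA hp hq0 hq (mul_ne_zero (hs0 i) hz0) (κ i) (by rw [norm_mul, hz, mul_one]; exact hs1 i)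
      (by rw [norm_mul, hz, mul_one]; exact hs2 i)
  have e2 : ∀ k, FE p q (r k * z j) (q ^ (l k + 1)) (p / q ^ l k) = _ := fun k =>
    specB hp hq0 hq (mul_ne_zero (hr0 k) hz0) (l k) (by rw [norm_mul, hz, mul_one]; exact hr1 k)
      (by rw [norm_mul, hz, mul_one]; exact hr2 k)
  simp_rw [e1, e2]
  have f1 : ∏ a, th p (al κ q s a * z j) =
      ∏ i, ∏ t ∈ Finset.range (κ i + 1), th p (q ^ t * (s i * z j)) := by
    rw [← prod_all κ fun i t => th p (q ^ t * (s i * z j))]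
    refine Finset.prod_congr rfl fun a _ => ?_
    rw [al, mul_assoc]
  have f2 : ∏ x, th p (yy l q r x / z j) =
      ∏ k, ∏ t ∈ Finset.range (l k), th p (q ^ (t + 1) / (r k * z j)) := by
    rw [← prod_right l fun k t => th p (q ^ t / (r k * z j))]
    refine Finset.prod_congr rfl fun a _ => ?_
    rw [yy, div_div]
  rw [f1, f2, Finset.prod_inv_distrib, Finset.prod_div_distrib]
  rw [div_mul_eq_div_div, div_eq_mul_inv (_ / _), mul_comm]

lemma spec' {m n : ℕ} (κ : Fin m → ℕ) (l : Fin n → ℕ) (s : Fin m → ℂ) (r : Fin n → ℂ)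
    (hs1 : ∀ i, ‖q‖ < ‖s i‖) (hs2 : ∀ i, ‖s i‖ < 1) (hr1 : ∀ k, ‖q‖ < ‖r k‖) (hr2 : ∀ k, ‖r k‖ < 1)
    (z : Fin n → ℂ) (hz : ∀ j, ‖z j‖ = 1) :
    Je p q (Sum.elim s r) (Sum.elim (fun i => p / q ^ κ i) (fun k => q ^ (l k + 1)))
      (Sum.elim (fun i => q ^ (κ i + 1)) (fun k => p / q ^ l k)) z =
      Dn p q r (yy l q r) (al κ q s) z := by
  unfold Je Dn
  rw [spec hp hq0 hq κ l s r hs1 hs2 hr1 hr2 z hz]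
  congr 1
  refine PP_congr fun i j _ => ?_
  have hz0 : ∀ j, z j ≠ 0 := fun j => norm_pos_iff.mp (by rw [hz j]; exact one_pos)
  have hn : ‖z i / z j‖ = 1 := by rw [norm_div, hz, hz, div_one]
  have hpq : ‖p * q‖ < 1 := by rw [norm_mul]; nlinarith [norm_nonneg p, norm_nonneg q]
  rw [GE, vecE hp hq (div_ne_zero (hz0 i) (hz0 j)) (by rw [norm_mul, hn, mul_one]; exact hpq)
    (by rw [norm_div, hn, div_one]; exact hpq), inv_div]

end

lemma th_zpow {q : ℂ} (hq0 : q ≠ 0) (hq : ‖q‖ < 1) (k : ℤ) :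
    ∃ c : ℂ, c ≠ 0 ∧ ∀ x : ℂ, x ≠ 0 → th q (q ^ k * x) = c * x ^ (-k) * th q x := by
  induction k using Int.induction_on with
  | zero => exact ⟨1, one_ne_zero, fun x _ => by simp⟩
  | succ k ih =>
    obtain ⟨c, hc, h⟩ := ih
    refine ⟨-c * (q ^ (k : ℤ))⁻¹, mul_ne_zero (neg_ne_zero.mpr hc) (inv_ne_zero (zpow_ne_zero _ hq0)), fun x hx => ?_⟩
    rw [zpow_add₀ hq0, zpow_one, show q ^ (k : ℤ) * q * x = q * (q ^ (k : ℤ) * x) by ring,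
      th_mul_p hq0 hq (mul_ne_zero (zpow_ne_zero _ hq0) hx), h x hx, mul_inv, neg_add, zpow_add₀ hx,
      zpow_neg_one]
    ring
  | pred k ih =>
    obtain ⟨c, hc, h⟩ := ih
    refine ⟨-c * q ^ (-(k : ℤ) - 1), mul_ne_zero (neg_ne_zero.mpr hc) (zpow_ne_zero _ hq0), fun x hx => ?_⟩
    have h1 := th_mul_p hq0 hq (mul_ne_zero (zpow_ne_zero (-(k : ℤ) - 1) hq0) hx)
    rw [← mul_assoc, ← zpow_one_add₀ hq0, show 1 + (-(k : ℤ) - 1) = -k by ring, h x hx] at h1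
    have hne : q ^ (-(k : ℤ) - 1) * x ≠ 0 := mul_ne_zero (zpow_ne_zero _ hq0) hx
    have h2 : th q (q ^ (-(k : ℤ) - 1) * x) = - (q ^ (-(k : ℤ) - 1) * x) * (c * x ^ (- -(k : ℤ)) * th q x) := by
      rw [h1]; field_simp
    rw [h2, show -(-(k : ℤ) - 1) = - -(k : ℤ) + 1 by ring, zpow_add_one₀ hx]
    ring

lemma exists_avoid {q : ℂ} (hq0 : q ≠ 0) {R : ℂ} (hR : R ≠ 0) :
    ∃ τ : ℂ, τ ≠ 0 ∧ (∀ k : ℤ, τ ≠ q ^ k) ∧ ∀ k : ℤ, τ * R ≠ q ^ k := by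
  have hc : (Set.range (fun k : ℤ => q ^ k) ∪ Set.range (fun k : ℤ => q ^ k / R) ∪ {0}).Countable :=
    ((Set.countable_range _).union (Set.countable_range _)).union (Set.countable_singleton _)
  obtain ⟨τ, hτ⟩ := (Set.Countable.dense_compl ℂ hc).nonempty
  simp only [Set.mem_compl_iff, Set.mem_union, Set.mem_range, Set.mem_singleton_iff, not_or, not_exists] at hτ
  refine ⟨τ, hτ.2, fun k h => hτ.1.1 k h.symm, fun k h => hτ.1.2 k ?_⟩
  rw [← h]; field_simp

lemma unconstrain {p q : ℂ} (hp0 : p ≠ 0) (hp : ‖p‖ < 1) (hq0 : q ≠ 0) (hq : ‖q‖ < 1)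
    {n m : ℕ} {Fn : (Fin (n + 1) → UnitAddCircle) → ℂ} {Fm : (Fin (m + 1) → UnitAddCircle) → ℂ}
    (hn : Continuous Fn) (hm : Continuous Fm) (wn wm R C : ℂ) (hR : R ≠ 0) (hC : C ≠ 0) (K : ℕ)
    (H : ∀ σ τ : ℂ, σ ≠ 0 → τ ≠ 0 → (∀ k : ℤ, σ ≠ p ^ k) → (∀ k : ℤ, τ ≠ q ^ k) →
      wn * (∫ x, (th q (τ * (R * ex (∑ j, x j))) * th p (σ * (C * ex (∑ j, x j))) * ex (∑ j, x j) ^ K) * Fn x) =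
      wm * (∫ x, (th q (τ * (R * ex (∑ j, x j))) * th p (σ * (C * ex (∑ j, x j))) * ex (∑ j, x j) ^ K) * Fm x)) :
    wn * cInt n Fn 0 = wm * cInt m Fm 0 := by
  obtain ⟨τ, hτ0, hτ1, hτ2⟩ := exists_avoid hq0 hR
  obtain ⟨σ, hσ0, hσ1, hσ2⟩ := exists_avoid hp0 hC
  have hcq : ∀ t : ℂ, t ≠ 0 → Continuous fun y : UnitAddCircle => th q (t * (R * ex y)) := fun t ht =>
    th_continuousOn hq (by fun_prop) fun y => mul_ne_zero ht (mul_ne_zero hR (ex_ne_zero y))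
  have hcp : ∀ t : ℂ, t ≠ 0 → Continuous fun y : UnitAddCircle => th p (t * (C * ex y)) := fun t ht =>
    th_continuousOn hp (by fun_prop) fun y => mul_ne_zero ht (mul_ne_zero hC (ex_ne_zero y))
  have hcx : ∀ K : ℕ, Continuous fun y : UnitAddCircle => ex y ^ K := fun K => by fun_prop
  have hg : ∀ t : ℂ, t ≠ 0 → Continuous fun y : UnitAddCircle =>
      th q (t * (R * ex y)) * th p (σ * (C * ex y)) * ex y ^ K := fun t ht =>
    ((hcq t ht).mul (hcp σ hσ0)).mul (hcx K)
  have hD : Continuous fun y => wn * cInt n Fn y - wm * cInt m Fm y :=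
    (continuous_const.mul (cInt_continuous hn)).sub (continuous_const.mul (cInt_continuous hm))
  have key : ∀ t : ℂ, t ≠ 0 → (∀ k : ℤ, t ≠ q ^ k) → ∫ y, th q (t * (R * ex y)) * th p (σ * (C * ex y)) * ex y ^ K *
      (wn * cInt n Fn y - wm * cInt m Fm y) = 0 := by
    intro t ht ht1
    have h1 := H σ t hσ0 ht hσ1 ht1
    rw [integral_constraint hn (hg t ht), integral_constraint hm (hg t ht), ← integral_const_mul,
      ← integral_const_mul, ← sub_eq_zero, ← integral_sub] at h1
    · rw [← h1]
      congr 1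
      funext y
      ring
    · exact integrable_cc _ (continuous_const.mul ((hg t ht).mul (cInt_continuous hn)))
    · exact integrable_cc _ (continuous_const.mul ((hg t ht).mul (cInt_continuous hm)))
  have hf := fourier_unique ((hg τ hτ0).mul hD) (fun k => by
    obtain ⟨c, hc, h⟩ := th_zpow hq0 hq (-k)
    have h1 := key (q ^ (-k) * τ) (mul_ne_zero (zpow_ne_zero _ hq0) hτ0) (fun j hj => hτ1 (j + k) (by
      rw [zpow_add₀ hq0, ← hj, mul_right_comm, ← zpow_add₀ hq0]; simp))
    have e : ∀ y, th q (q ^ (-k) * τ * (R * ex y)) * th p (σ * (C * ex y)) * ex y ^ K *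
      (wn * cInt n Fn y - wm * cInt m Fm y) = (c * (τ * R) ^ k) * (ex y ^ k *
        (th q (τ * (R * ex y)) * th p (σ * (C * ex y)) * ex y ^ K * (wn * cInt n Fn y - wm * cInt m Fm y))) := by
      intro y
      rw [mul_assoc (q ^ (-k)), h _ (mul_ne_zero hτ0 (mul_ne_zero hR (ex_ne_zero y))), neg_neg, ← mul_assoc τ,
        mul_zpow (τ * R)]
      ring
    simp_rw [e] at h1
    rw [integral_const_mul] at h1
    exact (mul_eq_zero.mp h1).resolve_left (mul_ne_zero hc (zpow_ne_zero _ (mul_ne_zero hτ0 hR))))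
  have h0 := congrFun hf 0
  simp only [Pi.mul_apply, ex_zero, mul_one, one_pow, Pi.zero_apply] at h0
  rw [mul_eq_zero] at h0
  rcases h0 with h0 | h0
  · exfalso
    exact mul_ne_zero (th_ne_zero hq0 hq (mul_ne_zero hτ0 hR) hτ2) (th_ne_zero hp0 hp (mul_ne_zero hσ0 hC) hσ2) h0
  · exact sub_eq_zero.mp h0

lemma th_nz {p : ℂ} (hp0 : p ≠ 0) (hp : ‖p‖ < 1) {x : ℂ} (h1 : ‖p‖ < ‖x‖) (h2 : ‖p‖ * ‖x‖ < 1)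
    (h3 : x ≠ 1) : th p x ≠ 0 := by
  have hp' : 0 < ‖p‖ := norm_pos_iff.mpr hp0
  refine th_ne_zero hp0 hp (norm_pos_iff.mp (hp'.trans h1)) fun k hk => ?_
  rcases lt_trichotomy k 0 with h | h | h
  · obtain ⟨j, rfl⟩ : ∃ j : ℕ, k = -((j : ℤ) + 1) := ⟨(-k - 1).toNat, by omega⟩
    have : p ^ (j : ℕ) * (p * x) = 1 := by
      rw [hk, zpow_neg, zpow_add₀ hp0, zpow_one, zpow_natCast]
      field_simp
    have h4 := congrArg norm this
    rw [norm_mul, norm_pow, norm_mul, norm_one] at h4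
    have := pow_le_one₀ (n := j) hp'.le hp.le
    have := mul_nonneg hp'.le (norm_nonneg x)
    nlinarith
  · rw [h, zpow_zero] at hk; exact h3 hk
  · obtain ⟨j, rfl⟩ : ∃ j : ℕ, k = (j : ℤ) + 1 := ⟨(k - 1).toNat, by omega⟩
    rw [hk, zpow_add₀ hp0, zpow_one, zpow_natCast, norm_mul, norm_pow] at h1
    have := pow_le_one₀ (n := j) hp'.le hp.le
    nlinarith

end SD

namespace SD
open Filter Topology MeasureTheory

lemma VV_ne_zero {p : ℂ} {n : ℕ} {f : Fin n → ℂ} (hf : ∀ i, f i ≠ 0)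
    (h : ∀ i k, i ≠ k → th p (f i / f k) ≠ 0) : VV p f ≠ 0 := by
  rw [VV_eq_PP]
  refine PP_ne_zero fun a b hab => ?_
  exact mul_ne_zero (hf b) (h a b hab.ne)

lemma le_sum' {n : ℕ} (l : Fin n → ℕ) (k : Fin n) : l k ≤ ∑ i, l i :=
  Finset.single_le_sum (f := l) (fun _ _ => Nat.zero_le _) (Finset.mem_univ k)

section
variable {p q : ℂ} (hp0 : p ≠ 0) (hp : ‖p‖ < 1) (hq0 : q ≠ 0) (hq : ‖q‖ < 1)

include hq in
lemma al_lt {n : ℕ} (l : Fin n → ℕ) {f : Fin n → ℂ} (hf : ∀ i, ‖f i‖ < 1) (a) : ‖al l q f a‖ < 1 := by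
  rw [al, norm_mul, norm_pow]
  have := pow_le_one₀ (n := lv l a) (norm_nonneg q) hq.le
  have := hf (bs l a)
  nlinarith [norm_nonneg (f (bs l a)), pow_nonneg (norm_nonneg q) (lv l a)]

include hq0 hq in
lemma al_gt {n : ℕ} (l : Fin n → ℕ) {f : Fin n → ℂ} (hf : ∀ i, ‖q‖ < ‖f i‖) (a) :
    ‖q‖ ^ (∑ i, l i + 1) < ‖al l q f a‖ := by
  have hq' : 0 < ‖q‖ := norm_pos_iff.mpr hq0
  rw [al, norm_mul, norm_pow, pow_succ]
  have h1 : ‖q‖ ^ (∑ i, l i) ≤ ‖q‖ ^ lv l a := pow_le_pow_of_le_one hq'.le hq.le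
    ((lv_le l a).trans (le_sum' l _))
  have h2 := hf (bs l a)
  have := pow_pos hq' (∑ i, l i)
  nlinarith

include hq0 hq in
lemma ratio_gt {x y : ℂ} (x1 : ‖q‖ < ‖x‖) (y1 : ‖q‖ < ‖y‖) (y2 : ‖y‖ < 1) : ‖q‖ < ‖x / y‖ := by
  have hq' : 0 < ‖q‖ := norm_pos_iff.mpr hq0
  rw [norm_div, lt_div_iff₀ (hq'.trans y1)]
  nlinarith

include hq0 hq in
lemma ratio_lt {x y : ℂ} (x2 : ‖x‖ < 1) (y1 : ‖q‖ < ‖y‖) : ‖q‖ * ‖x / y‖ < 1 := by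
  have hq' : 0 < ‖q‖ := norm_pos_iff.mpr hq0
  rw [norm_div, ← mul_div_assoc, div_lt_one (hq'.trans y1)]
  nlinarith [norm_nonneg x]

include hp0 hp hq0 hq in
lemma ratio_nz {x y : ℂ} {j j' M : ℕ} (hj : j ≤ M) (hj' : j' ≤ M) (x1 : ‖q‖ < ‖x‖) (x2 : ‖x‖ < 1)
    (y1 : ‖q‖ < ‖y‖) (y2 : ‖y‖ < 1) (hP : ‖p‖ < ‖q‖ ^ (M + 1)) (hne : q ^ j * x ≠ q ^ j' * y) :
    th p (q ^ j * x / (q ^ j' * y)) ≠ 0 := by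
  have hq' : 0 < ‖q‖ := norm_pos_iff.mpr hq0
  have hy0 : q ^ j' * y ≠ 0 := mul_ne_zero (pow_ne_zero _ hq0) (norm_pos_iff.mp (hq'.trans y1))
  have hyp : 0 < ‖q ^ j' * y‖ := norm_pos_iff.mpr hy0
  have b1 : ∀ k ≤ M, ∀ u : ℂ, ‖q‖ < ‖u‖ → ‖p‖ < ‖q ^ k * u‖ := by
    intro k hk u hu
    refine hP.trans ?_
    rw [norm_mul, norm_pow, pow_succ]
    have h1 : ‖q‖ ^ M ≤ ‖q‖ ^ k := pow_le_pow_of_le_one hq'.le hq.le hk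
    have := pow_pos hq' M
    nlinarith
  have b2 : ∀ k, ∀ u : ℂ, ‖u‖ < 1 → ‖q ^ k * u‖ < 1 := by
    intro k u hu
    rw [norm_mul, norm_pow]
    have := pow_le_one₀ (n := k) (norm_nonneg q) hq.le
    nlinarith [norm_nonneg u, pow_nonneg (norm_nonneg q) k]
  refine th_nz hp0 hp ?_ ?_ fun h => hne ((div_eq_one_iff_eq hy0).mp h)
  · rw [norm_div, lt_div_iff₀ hyp]
    have := b1 j hj x x1
    have := b2 j' y y2
    nlinarith [norm_nonneg p]
  · rw [norm_div, ← mul_div_assoc, div_lt_one hyp]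
    have := b1 j' hj' y y1
    have := b2 j x x2
    nlinarith [norm_nonneg p]

include hq0 hq in
lemma pow_inj' {j j' : ℕ} (h : q ^ j = q ^ j') : j = j' := by
  have hq' : 0 < ‖q‖ := norm_pos_iff.mpr hq0
  have := congrArg norm h
  rw [norm_pow, norm_pow] at this
  exact pow_right_injective₀ hq' hq.ne this

include hq0 hq in
lemma gen_ne {n : ℕ} (l : Fin n → ℕ) {f : Fin n → ℂ} (hf : ∀ i, f i ≠ 0)
    (hg : ∀ i k, i ≠ k → ∀ j : ℤ, f i / f k ≠ q ^ j) {b b' : Fin (n + ∑ i, l i)} (hb : b ≠ b') :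
    q ^ lv l b * f (bs l b) ≠ q ^ lv l b' * f (bs l b') := by
  intro h
  by_cases hbs : bs l b = bs l b'
  · rw [hbs] at h
    exact hb (ind_inj l b b' hbs (pow_inj' hq0 hq (mul_right_cancel₀ (hf _) h)))
  · apply hg _ _ hbs ((lv l b' : ℤ) - lv l b)
    rw [zpow_sub₀ hq0, zpow_natCast, zpow_natCast, div_eq_div_iff (hf _) (pow_ne_zero _ hq0)]
    rw [← h]; ring

end

lemma prod_al {n : ℕ} (l : Fin n → ℕ) (q : ℂ) (f : Fin n → ℂ) :
    ∏ b, al l q f b = (∏ i, f i) * ∏ x, yy l q (fun i => (f i)⁻¹) x := by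
  rw [al_append, Fin.prod_univ_add]
  simp only [Fin.append_left, Fin.append_right]

theorem core {p q : ℂ} (hp0 : p ≠ 0) (hq0 : q ≠ 0) (hq : ‖q‖ < 1)
    {n' m' : ℕ} (κ : Fin (m' + 1) → ℕ) (l : Fin (n' + 1) → ℕ) (s : Fin (m' + 1) → ℂ) (r : Fin (n' + 1) → ℂ)
    (a : ℂ) (hqa : ‖q‖ < ‖a‖) (has : ∀ i, ‖a‖ < ‖s i‖) (hs2 : ∀ i, ‖s i‖ < 1)
    (har : ∀ k, ‖a‖ < ‖r k‖) (hr2 : ∀ k, ‖r k‖ < 1)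
    (ham : a ^ (m' + 1) = (∏ i, s i) * ∏ k, r k)
    (hgs : ∀ i k, i ≠ k → ∀ j : ℤ, s i / s k ≠ q ^ j) (hgr : ∀ i k, i ≠ k → ∀ j : ℤ, r i / r k ≠ q ^ j)
    (hK : n' + 1 + ∑ k, l k = m' + 1 + ∑ i, κ i)
    (hP : ‖p‖ < ‖q‖ ^ (∑ i, κ i + ∑ k, l k + 3)) :
    DD p q n' m' (Sum.elim s r) a (Sum.elim (fun i => p / q ^ κ i) (fun k => q ^ (l k + 1)))
      (Sum.elim (fun i => q ^ (κ i + 1)) (fun k => p / q ^ l k)) = 0 := by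
  have hq' : 0 < ‖q‖ := norm_pos_iff.mpr hq0
  have ha' : 0 < ‖a‖ := hq'.trans hqa
  have ha0 : a ≠ 0 := norm_pos_iff.mp ha'
  have hs1 : ∀ i, ‖q‖ < ‖s i‖ := fun i => hqa.trans (has i)
  have hr1 : ∀ i, ‖q‖ < ‖r i‖ := fun i => hqa.trans (har i)
  have hs0 : ∀ i, s i ≠ 0 := fun i => norm_pos_iff.mp (hq'.trans (hs1 i))
  have hr0 : ∀ i, r i ≠ 0 := fun i => norm_pos_iff.mp (hq'.trans (hr1 i))
  have hPle : ∀ j : ℕ, j ≤ ∑ i, κ i + ∑ k, l k + 3 → ‖p‖ < ‖q‖ ^ j := fun j hj =>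
    hP.trans_le (pow_le_pow_of_le_one hq'.le hq.le hj)
  have hpq : ‖p‖ < ‖q‖ := by simpa using hPle 1 (by omega)
  have hp : ‖p‖ < 1 := hpq.trans hq
  have hdiv : ∀ {k j : ℕ}, k + j ≤ ∑ i, κ i + ∑ k, l k + 3 → ‖p / q ^ k‖ < ‖q‖ ^ j := by
    intro k j hkj
    rw [norm_div, norm_pow, div_lt_iff₀ (pow_pos hq' _), ← pow_add, add_comm]
    exact hPle _ hkj
  have has1 : ∀ i, ‖q‖ < ‖a / s i‖ := fun i => by
    rw [norm_div, lt_div_iff₀ (hq'.trans (hs1 i))]; nlinarith [hs2 i]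
  have has2 : ∀ i, ‖a / s i‖ < 1 := fun i => by
    rw [norm_div, div_lt_one (hq'.trans (hs1 i))]; exact has i
  have har1 : ∀ i, ‖q‖ < ‖a / r i‖ := fun i => by
    rw [norm_div, lt_div_iff₀ (hq'.trans (hr1 i))]; nlinarith [hr2 i]
  have har2 : ∀ i, ‖a / r i‖ < 1 := fun i => by
    rw [norm_div, div_lt_one (hq'.trans (hr1 i))]; exact har i
  -- the two integrands
  set v : Fin (m' + 1) ⊕ Fin (n' + 1) → ℂ := Sum.elim (fun i => p / q ^ κ i) (fun k => q ^ (l k + 1)) with hv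
  set v' : Fin (m' + 1) ⊕ Fin (n' + 1) → ℂ := Sum.elim (fun i => q ^ (κ i + 1)) (fun k => p / q ^ l k) with hv'
  have hqpow : ∀ k : ℕ, ‖q ^ (k + 1)‖ ≤ ‖q‖ := fun k => by
    rw [norm_pow, pow_succ]
    exact mul_le_of_le_one_left hq'.le (pow_le_one₀ hq'.le hq.le)
  have hpdk : ∀ k, ‖p / q ^ κ k‖ < ‖q‖ := fun k => by
    have := hdiv (k := κ k) (j := 1) (by have := le_sum' κ k; omega)
    simpa using this
  have hpdl : ∀ k, ‖p / q ^ l k‖ < ‖q‖ := fun k => by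
    have := hdiv (k := l k) (j := 1) (by have := le_sum' l k; omega)
    simpa using this
  have hcn : Continuous fun x : Fin (n' + 1) → UnitAddCircle => Je p q (Sum.elim s r) v v' fun j => ex (x j) := by
    rw [← continuousOn_univ]
    refine Je_continuousOn hq continuousOn_const (fun i => continuousOn_const) (fun i => continuousOn_const)
      (fun i => continuousOn_const) (fun j => by fun_prop) (fun _ _ => hp) (fun _ _ j => norm_ex _) ?_ ?_
    · rintro _ _ (i | i)
      exacts [hs2 i, hr2 i]
    · rintro _ _ (i | i)
      · exact (hpdk i).trans (hs1 i)
      · exact (hqpow _).trans_lt (hr1 i)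
  have hcm : Continuous fun x : Fin (m' + 1) → UnitAddCircle =>
      Je p q (fun i => a / Sum.elim s r i) v' v fun j => ex (x j) := by
    rw [← continuousOn_univ]
    refine Je_continuousOn hq continuousOn_const (fun i => continuousOn_const) (fun i => continuousOn_const)
      (fun i => continuousOn_const) (fun j => by fun_prop) (fun _ _ => hp) (fun _ _ j => norm_ex _) ?_ ?_
    · rintro _ _ (i | i)
      exacts [has2 i, har2 i]
    · rintro _ _ (i | i)
      · exact (hqpow _).trans_lt (has1 i)
      · exact (hpdl i).trans (har1 i)
  have hFn : ∀ x : Fin (n' + 1) → UnitAddCircle, Dn p q r (yy l q r) (fun a => al κ q s (Fin.cast hK a)) (fun j => ex (x j)) =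
      Je p q (Sum.elim s r) v v' fun j => ex (x j) := fun x => by
    rw [Dn_cast, ← spec' hp hq0 hq κ l s r hs1 hs2 hr1 hr2 _ fun j => norm_ex _]
  have hFm : ∀ x : Fin (m' + 1) → UnitAddCircle, Dn p q (fun i => a / s i) (yy κ q fun i => a / s i)
      (fun b => al l q (fun k => a / r k) (Fin.cast hK.symm b)) (fun j => ex (x j)) =
      Je p q (fun i => a / Sum.elim s r i) v' v fun j => ex (x j) := fun x => by
    rw [Dn_cast, ← spec' hp hq0 hq l κ _ _ har1 har2 has1 has2 _ fun j => norm_ex _,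
      ← Je_equiv p q (Equiv.sumComm _ _)]
    congr 1
    · funext i; rcases i with i | i <;> rfl
    · funext i; rcases i with i | i <;> rfl
    · funext i; rcases i with i | i <;> rfl
  set cn : ℂ := VV q r * VV p (al κ q s) * VV p (yy l q r) / (∏ a, ∏ x, th p (al κ q s a * yy l q r x)) *
       (sg (n' + 1) * (-1) ^ ((n' + 1) * ∑ k, l k)) with hcndef
  set cm : ℂ := VV q (fun i => a / s i) * VV p (al l q fun k => a / r k) * VV p (yy κ q fun i => a / s i) /
       (∏ b, ∏ x, th p (al l q (fun k => a / r k) b * yy κ q (fun i => a / s i) x)) *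
       (sg (m' + 1) * (-1) ^ ((m' + 1) * ∑ i, κ i)) with hcmdef
  have hR : ∏ i, a / s i = ∏ k, r k := by
    rw [Finset.prod_div_distrib, Finset.prod_const, Finset.card_univ, Fintype.card_fin, ham]
    have : ∏ i, s i ≠ 0 := Finset.prod_ne_zero_iff.mpr fun i _ => hs0 i
    field_simp
  have hR0 : ∏ k, r k ≠ 0 := Finset.prod_ne_zero_iff.mpr fun i _ => hr0 i
  have hC : (∏ b, al l q (fun k => a / r k) b) * ∏ x, yy κ q (fun i => a / s i) x =
      (∏ a, al κ q s a) * ∏ x, yy l q r x := by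
    rw [prod_al, prod_al]
    have f1 : ∀ x, yy l q (fun i => (a / r i)⁻¹) x = a * yy l q r x := fun x => by
      simp only [yy, inv_div]; field_simp
    have f2 : ∀ x, yy κ q (fun i => a / s i) x = a⁻¹ * yy κ q (fun i => (s i)⁻¹) x := fun x => by
      simp only [yy]; field_simp
    simp only [f1, f2, Finset.prod_mul_distrib, Finset.prod_div_distrib, Finset.prod_const, Finset.card_univ,
      Fintype.card_fin]
    have e1 : a ^ (n' + 1) * a ^ (∑ k, l k) * a⁻¹ ^ (∑ i, κ i) = (∏ i, s i) * ∏ k, r k := by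
      rw [← pow_add, hK, pow_add, ham, inv_pow]
      have := pow_ne_zero (∑ i, κ i) ha0
      field_simp
    generalize a⁻¹ ^ (∑ i, κ i) = a3 at *
    generalize (∏ x, yy κ q (fun i => (s i)⁻¹) x) = Y1
    generalize (∏ x, yy l q r x) = Y2
    generalize (∏ i, r i) = Y3 at *
    generalize (∏ i, s i) = Y4 at *
    field_simp
    linear_combination (Y1 * Y2) * e1
  have hyn : ∀ x, yy l q r x ≠ 0 := fun x => div_ne_zero (pow_ne_zero _ hq0) (hr0 _)
  have haln : ∀ x, al κ q s x ≠ 0 := fun x => mul_ne_zero (pow_ne_zero _ hq0) (hs0 _)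
  have hC0 : (∏ a, al κ q s a) * ∏ x, yy l q r x ≠ 0 := mul_ne_zero
    (Finset.prod_ne_zero_iff.mpr fun i _ => haln i) (Finset.prod_ne_zero_iff.mpr fun i _ => hyn i)
  set c0 : ℂ := (pochInf q q ^ 2)⁻¹ with hc0
  have bnd : ∀ {X : ℝ} {j k : ℕ}, ‖q‖ ^ k < X → j + k ≤ ∑ i, κ i + ∑ k, l k + 3 → ‖p‖ < ‖q‖ ^ j * X := by
    intro X j k hX hjk
    refine (hPle _ hjk).trans ?_
    rw [pow_add]
    exact mul_lt_mul_of_pos_left hX (pow_pos hq' _)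
  have hmain := unconstrain hp0 hp hq0 hq hcn hcm (c0 ^ (∑ k, l k) * cn / ((n' + 1).factorial : ℂ))
    (c0 ^ (∑ i, κ i) * cm / ((m' + 1).factorial : ℂ)) _ _ hR0 hC0 (n' + 1 - 1 + ∑ k, l k) (by
    intro σ τ hσ hτ hσk hτk
    have hσ1 : th p σ ≠ 0 := th_ne_zero hp0 hp hσ hσk
    have hτ1 : th q τ ≠ 0 := th_ne_zero hq0 hq hτ hτk
    have S1 := side hp0 hp hq0 hq hσ hτ hσ1 hτ1 l r (fun a => al κ q s (Fin.cast hK a)) hr1 hr2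
      (fun a => al_lt hq κ hs2 _)
      (fun a k => bnd (al_gt hq0 hq κ hs1 _) (by have := le_sum' l k; omega))
      (fun a => by simpa using bnd (j := 0) (al_gt hq0 hq κ hs1 (Fin.cast hK a)) (by omega))
    have S2 := side hp0 hp hq0 hq hσ hτ hσ1 hτ1 κ (fun i => a / s i)
      (fun b => al l q (fun k => a / r k) (Fin.cast hK.symm b)) has1 has2
      (fun a => al_lt hq l har2 _)
      (fun a k => bnd (al_gt hq0 hq l har1 _) (by have := le_sum' κ k; omega))
      (fun b => by simpa using bnd (j := 0) (al_gt hq0 hq l har1 (Fin.cast hK.symm b)) (by omega))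
    rw [VV_cast hK, prod_cast hK, prod_cast hK (fun a => ∏ x, th p (al κ q s a * yy l q r x)), ← hcndef] at S1
    rw [VV_cast hK.symm, prod_cast hK.symm,
      prod_cast hK.symm (fun b => ∏ x, th p (al l q (fun k => a / r k) b * yy κ q (fun i => a / s i) x)),
      ← hcmdef, hC, hR, show m' + 1 - 1 + ∑ i, κ i = n' + 1 - 1 + ∑ k, l k by omega] at S2
    simp only [hFn] at S1
    simp only [hFm] at S2
    have hdet : (Matrix.of fun a b => GG p q σ τ (q ^ lv l b * al κ q s (Fin.cast hK a)) (r (bs l b))).det =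
        (Matrix.of fun b b' => GG p q σ τ (q ^ lv κ b' * al l q (fun k => a / r k) (Fin.cast hK.symm b))
          (a / s (bs κ b'))).det := by
      rw [det_cast hK fun A b => GG p q σ τ (q ^ lv l b * al κ q s A) (r (bs l b))]
      congr 1
      funext x y
      simp only [Matrix.of_apply]
      set x' := Fin.cast hK.symm x
      have hsn := hs0 (bs κ y)
      have hrn := hr0 (bs l x')
      have w1 : q ^ lv κ y * al l q (fun k => a / r k) x' =
          a / (s (bs κ y) * r (bs l x')) * (q ^ lv l x' * al κ q s y) := by
        simp only [al]; field_simp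
      have w2 : a / s (bs κ y) = a / (s (bs κ y) * r (bs l x')) * r (bs l x') := by field_simp
      have w3 := bnd (j := lv l x') (al_gt hq0 hq κ hs1 y) (by
        have := (lv_le l x').trans (le_sum' l _); omega)
      have w4 := bnd (j := lv κ y) (al_gt hq0 hq l har1 x') (by
        have := (lv_le κ y).trans (le_sum' κ _); omega)
      have w5 : ∀ (k : ℕ) (X : ℂ), ‖X‖ < 1 → ‖q ^ k * X‖ < 1 := fun k X hX => by
        rw [norm_mul, norm_pow]
        have := pow_le_one₀ (n := k) (norm_nonneg q) hq.le
        nlinarith [norm_nonneg X, pow_nonneg (norm_nonneg q) k]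
      rw [← norm_pow, ← norm_mul] at w3 w4
      have w6 := w5 (lv κ y) _ (al_lt hq l har2 x')
      have w7 := has1 (bs κ y)
      have w8 := has2 (bs κ y)
      rw [w1] at w4 w6 ⊢
      rw [w2] at w7 w8 ⊢
      exact (GG_scale hp hq hσ hτ hσ1 hτ1 (div_ne_zero ha0 (mul_ne_zero hsn hrn)) w3
        (w5 _ _ (al_lt hq κ hs2 y)) (hr1 _) (hr2 _) w4 w6 w7 w8).symm
    rw [hdet] at S1
    have hf1 : ((n' + 1).factorial : ℂ) ≠ 0 := Nat.cast_ne_zero.mpr (Nat.factorial_ne_zero _)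
    have hf2 : ((m' + 1).factorial : ℂ) ≠ 0 := Nat.cast_ne_zero.mpr (Nat.factorial_ne_zero _)
    generalize (∫ x : Fin (n' + 1) → UnitAddCircle, _ : ℂ) = I1 at S1 ⊢
    generalize (∫ x : Fin (m' + 1) → UnitAddCircle, _ : ℂ) = I2 at S2 ⊢
    rw [← hc0] at S1 S2
    rw [div_mul_eq_mul_div, div_mul_eq_mul_div, div_eq_div_iff hf1 hf2]
    linear_combination ((m' + 1).factorial : ℂ) * S1 - ((n' + 1).factorial : ℂ) * S2)
  have hyl : ∀ x, ‖q‖ ^ (∑ k, l k) ≤ ‖yy l q r x‖ ∧ ‖yy l q r x‖ < 1 := fun x => by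
    have hlv : lv l (Fin.natAdd _ x) ≠ 0 := by simp [lv]
    have h1 : ‖q‖ ^ lv l (Fin.natAdd _ x) ≤ ‖q‖ := pow_le_of_le_one hq'.le hq.le hlv
    have h2 := hr1 (bs l (Fin.natAdd _ x))
    have h3 := hr2 (bs l (Fin.natAdd _ x))
    have h4 : ‖q‖ ^ (∑ k, l k) ≤ ‖q‖ ^ lv l (Fin.natAdd _ x) := pow_le_pow_of_le_one hq'.le hq.le
      ((lv_le l _).trans (le_sum' l _))
    have h5 := pow_pos hq' (∑ k, l k)
    rw [yy, norm_div, norm_pow, le_div_iff₀ (hq'.trans h2), div_lt_one (hq'.trans h2)]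
    constructor
    · nlinarith
    · linarith
  have hT : ∀ a x, th p (al κ q s a * yy l q r x) ≠ 0 := fun b x => by
    have h1 := bnd (j := ∑ k, l k) (al_gt hq0 hq κ hs1 b) (by omega)
    have h2 := al_lt hq κ hs2 b
    obtain ⟨h3, h4⟩ := hyl x
    refine th_ne_zero_of_annulus hp ?_ ?_ <;> rw [norm_mul]
    · refine h1.trans_le ?_
      rw [mul_comm]
      exact mul_le_mul_of_nonneg_left h3 (norm_nonneg _)
    · nlinarith [norm_nonneg (yy l q r x), norm_nonneg (al κ q s b)]
  have hA2 : ∀ i k, i ≠ k → th p (s i / s k) ≠ 0 := fun i k hik => by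
    have := ratio_nz hp0 hp hq0 hq (j := 0) (j' := 0) (M := 0) le_rfl le_rfl (hs1 i) (hs2 i) (hs1 k) (hs2 k)
      (hPle _ (by omega)) (fun h => hgs i k hik 0 (by
        simp only [pow_zero, one_mul] at h; rw [h, zpow_zero, div_self (hs0 k)]))
    simpa using this
  have hB2 : ∀ i k, i ≠ k → th q (r i / r k) ≠ 0 := fun i k hik =>
    th_ne_zero hq0 hq (div_ne_zero (hr0 i) (hr0 k)) (hgr i k hik)
  have hcn0 : cn ≠ 0 := by
    refine mul_ne_zero (div_ne_zero (mul_ne_zero (mul_ne_zero ?_ ?_) ?_) ?_)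
      (mul_ne_zero (sg_ne_zero _) (pow_ne_zero _ (by norm_num)))
    · exact VV_ne_zero hr0 hB2
    · refine VV_ne_zero haln fun i k hik => ?_
      exact ratio_nz hp0 hp hq0 hq (M := ∑ i, κ i) ((lv_le κ _).trans (le_sum' κ _))
        ((lv_le κ _).trans (le_sum' κ _)) (hs1 _) (hs2 _) (hs1 _) (hs2 _) (hPle _ (by omega))
        (gen_ne hq0 hq κ hs0 hgs hik)
    · refine VV_ne_zero hyn fun i k hik => ?_
      have := ratio_nz hp0 hp hq0 hq (M := ∑ i, l i) (j := lv l (Fin.natAdd _ i)) (j' := lv l (Fin.natAdd _ k))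
        (x := a / r (bs l (Fin.natAdd _ i))) (y := a / r (bs l (Fin.natAdd _ k)))
        ((lv_le l _).trans (le_sum' l _))
        ((lv_le l _).trans (le_sum' l _)) (har1 _) (har2 _) (har1 _) (har2 _) (hPle _ (by omega))
        (gen_ne hq0 hq l (f := fun i => a / r i) (fun i => div_ne_zero ha0 (hr0 i)) (fun i k hik j hj => by
          refine hgr k i hik.symm j ?_
          rw [← hj]; have := hr0 i; have := hr0 k; field_simp) (fun h => hik (Fin.natAdd_injective _ _ h)))
      convert this using 2
      simp only [yy]
      have h1 := hr0 (bs l (Fin.natAdd _ i))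
      have h2 := hr0 (bs l (Fin.natAdd _ k))
      have h3 := pow_ne_zero (lv l (Fin.natAdd _ k)) hq0
      field_simp
    · exact Finset.prod_ne_zero_iff.mpr fun a _ => Finset.prod_ne_zero_iff.mpr fun x _ => hT a x
  have small : ∀ {X Y : ℂ}, ‖X‖ < ‖q‖ → ‖q‖ * ‖Y‖ < 1 → ‖X * Y‖ < 1 := by
    intro X Y h1 h2
    rw [norm_mul]; nlinarith [norm_nonneg Y]
  have hst := star hp0 hp hq0 hq κ l s r hs0 hr0 ha0 ham (by omega) (by omega) hK
    (fun i k => small (hpdk k) (ratio_lt hq0 hq (hs2 i) (hs1 k)))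
    (fun i k => small hpq (ratio_lt hq0 hq (hs2 i) (hs1 k))) hA2
    (fun i k => by rw [norm_mul]; exact ratio_lt hq0 hq (hr2 i) (hr1 k)) hB2
    (fun i k => by rw [div_eq_mul_inv, inv_div]; exact small (hpdk i) (ratio_lt hq0 hq (hr2 k) (hs1 i)))
    (fun i k => by rw [div_eq_mul_inv, inv_div]; exact small hpq (ratio_lt hq0 hq (hr2 k) (hs1 i)))
    (fun i k => by rw [norm_mul]; exact ratio_lt hq0 hq (hs2 i) (hr1 k)) hT
  rw [← hcndef, ← hcmdef] at hst
  have hpref : pref p q (Sum.elim s r) v v' = (∏ i, ∏ k, EE (q ^ (κ k + 1) / (s i / s k)) p q / EE (p / q ^ κ k * (s i / s k)) p q) *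
     (∏ i, ∏ k, EE (q ^ (κ i + 1) * (s i / r k)) p q / EE (p / q ^ κ i / (s i / r k)) p q *
      (EE (p / q ^ l k / (s i / r k)) p q / EE (q ^ (l k + 1) * (s i / r k)) p q)) *
     (∏ i, ∏ k, EE (p / q ^ l k / (r i / r k)) p q / EE (q ^ (l k + 1) * (r i / r k)) p q) := by
    simp only [pref, Fintype.prod_sum_type, Sum.elim_inl, Sum.elim_inr, hv, hv', Finset.prod_mul_distrib]
    have : (∏ k, ∏ i, EE (q ^ (κ i + 1) / (r k / s i)) p q / EE (p / q ^ κ i * (r k / s i)) p q) =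
        ∏ i, ∏ k, EE (q ^ (κ i + 1) * (s i / r k)) p q / EE (p / q ^ κ i / (s i / r k)) p q := by
      rw [Finset.prod_comm]
      refine Finset.prod_congr rfl fun i _ => Finset.prod_congr rfl fun k _ => ?_
      rw [div_eq_mul_inv _ (r k / s i), inv_div, div_eq_mul_inv _ (s i / r k), inv_div]
    rw [this]; ring
  rw [← hpref] at hst
  unfold DD JJ
  generalize pref p q (Sum.elim s r) v v' = pr at *
  rw [sub_eq_zero]
  generalize cInt n' _ 0 = J1 at hmain ⊢
  generalize cInt m' _ 0 = J2 at hmain ⊢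
  have hf1 : ((n' + 1).factorial : ℂ) ≠ 0 := Nat.cast_ne_zero.mpr (Nat.factorial_ne_zero _)
  have hf2 : ((m' + 1).factorial : ℂ) ≠ 0 := Nat.cast_ne_zero.mpr (Nat.factorial_ne_zero _)
  have hPn : pochInf p p ≠ 0 := pochInf_ne_zero_of_lt hp hp
  have hQn : pochInf q q ≠ 0 := pochInf_ne_zero_of_lt hq hq
  have hc00 : c0 ≠ 0 := inv_ne_zero (pow_ne_zero _ hQn)
  clear_value c0
  generalize pochInf p p = P at *
  generalize pochInf q q = Q at *
  have hpow : Q ^ (n' + (n' + 1)) * c0 ^ (∑ i, κ i) = Q ^ (m' + (m' + 1)) * c0 ^ (∑ k, l k) := by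
    rw [hc0, inv_pow, inv_pow, ← pow_mul, ← pow_mul, ← div_eq_mul_inv, ← div_eq_mul_inv,
      div_eq_div_iff (pow_ne_zero _ hQn) (pow_ne_zero _ hQn), ← pow_add, ← pow_add]
    congr 1; omega
  rw [pow_add Q n', pow_add Q m'] at hpow
  rw [div_mul_eq_mul_div, div_mul_eq_mul_div, div_eq_div_iff hf1 hf2] at hmain
  rw [div_mul_eq_mul_div, div_mul_eq_mul_div, div_mul_eq_mul_div, div_eq_div_iff hf1 hf2]
  have hX : c0 ^ (∑ k, l k) * cn * P ^ (m' + 1) * Q ^ (n' + 1) ≠ 0 :=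
    mul_ne_zero (mul_ne_zero (mul_ne_zero (pow_ne_zero _ hc00) hcn0) (pow_ne_zero _ hPn)) (pow_ne_zero _ hQn)
  refine mul_left_cancel₀ hX ?_
  clear_value cn cm
  rw [pow_succ P n'] at hst
  rw [pow_succ P m'] at hst ⊢
  generalize c0 ^ (∑ k, l k) = x1 at *
  generalize c0 ^ (∑ k, κ k) = x2 at *
  generalize Q ^ n' = x3 at *
  generalize Q ^ m' = x4 at *
  generalize Q ^ (n' + 1) = x5 at *
  generalize Q ^ (m' + 1) = x6 at *
  generalize ((n' + 1).factorial : ℂ) = g1 at *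
  generalize ((m' + 1).factorial : ℂ) = g2 at *
  generalize P ^ n' = x7 at *
  generalize P ^ m' = x8 at *
  linear_combination x8 * P * x5 * x7 * x3 * hmain - x1 * x8 * x4 * J2 * g1 * hst + x8 * P * x7 * cm * J2 * g1 * hpow

end SD

namespace SD
open Filter Topology MeasureTheory

lemma one_var_zero {g : ℂ → ℂ} {ρ : ℝ} (hg : DifferentiableOn ℂ g (Metric.ball 0 ρ))
    (hρ : 0 < ρ) (h : ∃ᶠ z in 𝓝[≠] (0 : ℂ), g z = 0) {z : ℂ} (hz : ‖z‖ < ρ) : g z = 0 :=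
  (hg.analyticOnNhd Metric.isOpen_ball).eqOn_zero_of_preconnected_of_frequently_eq_zero
    (convex_ball _ _).isPreconnected (Metric.mem_ball_self hρ) h (by simpa using hz)

lemma iter_zero {ι : Type*} [Fintype ι] [DecidableEq ι] (F : (ι → ℂ) → ℂ) {ε : ℝ} (hε : 0 < ε)
    (hF : ∀ (c : ι → ℂ) i, (∀ j, j ≠ i → ‖c j‖ ≤ 1) →
      DifferentiableOn ℂ (fun z => F (Function.update c i z)) (Metric.ball 0 (1 + ε)))
    (k0 : ι) (Z : ι → Set ℂ) (hZ : ∀ i, i ≠ k0 → ∃ᶠ z in 𝓝[≠] (0 : ℂ), z ∈ Z i)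
    (hZ1 : ∀ i, ∀ z ∈ Z i, ‖z‖ ≤ 1)
    (h0 : ∀ c : ι → ℂ, (∀ i, i ≠ k0 → c i ∈ Z i) → ∀ᶠ z in 𝓝[≠] (0 : ℂ), F (Function.update c k0 z) = 0) :
    F (fun _ => 1) = 0 := by
  have key : ∀ T : Finset ι, k0 ∉ T → ∀ c : ι → ℂ, ‖c k0‖ ≤ 1 → (∀ i ∈ T, ‖c i‖ ≤ 1) →
      (∀ i, i ∉ T → i ≠ k0 → c i ∈ Z i) → F c = 0 := by
    intro T
    induction T using Finset.induction_on with
    | empty =>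
      intro _ c hk _ hc
      have := one_var_zero (hF c k0 fun j hj => hZ1 j _ (hc j (by simp) hj)) (by linarith)
        (h0 c fun i hi => hc i (by simp) hi).frequently (z := c k0) (by linarith)
      simpa using this
    | insert i T hi ih =>
      intro hk0 c hk hT hc
      rw [Finset.mem_insert, not_or] at hk0
      have := one_var_zero (hF c i fun j hj => ?_) (by linarith)
        ((hZ i (Ne.symm hk0.1)).mono fun z hz => ih hk0.2 (Function.update c i z) ?_ ?_ ?_) (z := c i)
        (by have := hT i (Finset.mem_insert_self _ _); linarith)
      · simpa using this
      · by_cases h1 : j = k0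
        · rw [h1]; exact hk
        · by_cases h2 : j ∈ T
          · exact hT j (Finset.mem_insert_of_mem h2)
          · exact hZ1 j _ (hc j (by simp [hj, h2]) h1)
      · rw [Function.update_of_ne hk0.1]; exact hk
      · intro j hj
        rw [Function.update_of_ne (show j ≠ i from fun h => hi (h ▸ hj))]
        exact hT j (Finset.mem_insert_of_mem hj)
      · intro j hj hjk
        by_cases h1 : j = i
        · subst h1; simpa using hz
        · rw [Function.update_of_ne h1]
          exact hc j (by simp [h1, hj]) hjk
  refine key (Finset.univ.erase k0) (by simp) _ (by simp) (by simp) fun i hi hik => ?_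
  simp [hik] at hi

open Classical in
noncomputable def mono {ι : Type*} [Fintype ι] (E : ι → Prop) (c : ι → ℂ) : ℂ := ∏ j, if E j then c j else 1

lemma mono_mul {ι : Type*} [Fintype ι] (E : ι → Prop) (c : ι → ℂ) :
    mono E c * mono (fun j => ¬ E j) c = ∏ j, c j := by
  unfold mono
  rw [← Finset.prod_mul_distrib]
  refine Finset.prod_congr rfl fun j _ => ?_
  by_cases h : E j <;> simp [h]

lemma mono_norm {ι : Type*} [Fintype ι] [DecidableEq ι] (E : ι → Prop) (c : ι → ℂ) (i : ι) {z : ℂ} {R : ℝ}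
    (hR : 1 ≤ R) (hz : ‖z‖ ≤ R) (hc : ∀ j, j ≠ i → ‖c j‖ ≤ 1) : ‖mono E (Function.update c i z)‖ ≤ R := by
  unfold mono
  rw [norm_prod]
  calc _ ≤ ∏ j, (if j = i then R else 1) := by
        refine Finset.prod_le_prod (fun _ _ => norm_nonneg _) fun j _ => ?_
        by_cases h : j = i
        · subst h; by_cases h2 : E j <;> simp [h2, hz, hR]
        · by_cases h2 : E j <;> simp [h2, h, hc j h]
    _ = R := by simp

lemma mono_diff {ι : Type*} [Fintype ι] [DecidableEq ι] (E : ι → Prop) (c : ι → ℂ) (i : ι) :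
    Differentiable ℂ fun z => mono E (Function.update c i z) := by
  unfold mono
  refine Differentiable.fun_finsetProd fun j _ => ?_
  by_cases h : j = i
  · subst h; by_cases h2 : E j <;> simp [h2]
  · by_cases h2 : E j <;> simp [h2, h]

/-- exponents of the monomials -/
def Eexp {m n : ℕ} : Fin (m + 1) ⊕ Fin (n + 1) → Fin (m + 1) ⊕ Fin (n + 1) → Prop
  | Sum.inl i, y => if i = 0 then ¬ (y = Sum.inl 0 ∨ ∃ k : Fin n, y = Sum.inr k.succ) else y ≠ Sum.inl i
  | Sum.inr k, y => if k = 0 then ∃ i, y = Sum.inl i else y = Sum.inr k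

section
variable {m n : ℕ} (c : Fin (m + 1) ⊕ Fin (n + 1) → ℂ)

lemma mono_A0 : mono (fun y => ¬ Eexp (Sum.inl 0) y) c = c (Sum.inl 0) * ∏ k : Fin n, c (Sum.inr k.succ) := by
  simp [mono, Eexp, Fintype.prod_sum_type, Fin.prod_univ_succ, (Fin.succ_ne_zero _).symm]

lemma mono_AS (i : Fin m) : mono (fun y => ¬ Eexp (Sum.inl i.succ) y) c = c (Sum.inl i.succ) := by
  simp [mono, Eexp]

lemma mono_B0 : mono (Eexp (Sum.inr 0)) c = ∏ i, c (Sum.inl i) := by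
  simp [mono, Eexp, Fintype.prod_sum_type]

lemma mono_BS (k : Fin n) : mono (Eexp (Sum.inr k.succ)) c = c (Sum.inr k.succ) := by
  simp [mono, Eexp]

end

set_option maxHeartbeats 1000000 in
theorem phase1 {p q : ℂ} (hp0 : p ≠ 0) (hp : ‖p‖ < 1) (hq0 : q ≠ 0) (hq : ‖q‖ < 1)
    {n' m' : ℕ} (s : Fin (m' + 1) → ℂ) (r : Fin (n' + 1) → ℂ)
    (a : ℂ) (hqa : ‖q‖ < ‖a‖) (has : ∀ i, ‖a‖ < ‖s i‖) (hs2 : ∀ i, ‖s i‖ < 1)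
    (har : ∀ k, ‖a‖ < ‖r k‖) (hr2 : ∀ k, ‖r k‖ < 1)
    (ham : a ^ (m' + 1) = (∏ i, s i) * ∏ k, r k)
    (hgs : ∀ i k, i ≠ k → ∀ j : ℤ, s i / s k ≠ q ^ j) (hgr : ∀ i k, i ≠ k → ∀ j : ℤ, r i / r k ≠ q ^ j)
    (v v' : Fin (m' + 1) ⊕ Fin (n' + 1) → ℂ) (hvv : ∀ x, v x * v' x = p * q)
    (hprod : ∏ x, v x = (p * q) ^ (m' + 1))
    (hv : ∀ x, ‖v x‖ < ‖Sum.elim s r x‖) (hv' : ∀ x, ‖v' x‖ < ‖a / Sum.elim s r x‖) :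
    DD p q n' m' (Sum.elim s r) a v v' = 0 := by
  classical
  have hq' : 0 < ‖q‖ := norm_pos_iff.mpr hq0
  have hpq0 : p * q ≠ 0 := mul_ne_zero hp0 hq0
  have hv0 : ∀ x, v x ≠ 0 := fun x h => hpq0 (by rw [← hvv x, h, zero_mul])
  have hv'0 : ∀ x, v' x ≠ 0 := fun x h => hpq0 (by rw [← hvv x, h, mul_zero])
  obtain ⟨ε, hε, hε1, hε2, hε3⟩ : ∃ ε : ℝ, 0 < ε ∧ ‖p‖ * (1 + ε) < 1 ∧
      (∀ x, ‖v x‖ * (1 + ε) < ‖Sum.elim s r x‖) ∧ (∀ x, ‖v' x‖ * (1 + ε) < ‖a / Sum.elim s r x‖) := by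
    have lim : ∀ A B : ℝ, A < B → ∀ᶠ ε in 𝓝[>] (0 : ℝ), A * (1 + ε) < B := fun A B h => by
      have : Tendsto (fun ε : ℝ => A * (1 + ε)) (𝓝[>] 0) (𝓝 (A * (1 + 0))) :=
        (Continuous.tendsto (by fun_prop) _).mono_left nhdsWithin_le_nhds
      exact this.eventually (gt_mem_nhds (by simpa using h))
    have := ((lim _ _ hp).and ((eventually_all.mpr fun x => lim _ _ (hv x)).and
      (eventually_all.mpr fun x => lim _ _ (hv' x)))).and self_mem_nhdsWithin
    obtain ⟨ε, ⟨h1, h2, h3⟩, h4⟩ := this.exists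
    exact ⟨ε, h4, h1, h2, h3⟩
  set F : (Fin (m' + 1) ⊕ Fin (n' + 1) → ℂ) → ℂ := fun c => DD (p * mono (fun _ => True) c) q n' m' (Sum.elim s r) a
    (fun x => v x * mono (Eexp x) c) (fun x => v' x * mono (fun y => ¬ Eexp x y) c) with hFdef
  set W : ℂ := (∏ k : Fin n', v (Sum.inr k.succ)) / (v' (Sum.inl 0) / q) with hW
  have hW0 : W ≠ 0 := div_ne_zero (Finset.prod_ne_zero_iff.mpr fun k _ => hv0 _) (div_ne_zero (hv'0 _) hq0)
  set w : Fin (m' + 1) ⊕ Fin (n' + 1) → ℂ := Sum.elim (fun i => if i = 0 then W else q / v' (Sum.inl i))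
    (fun k => q / v (Sum.inr k)) with hw
  have hw0 : ∀ x, w x ≠ 0 := by
    rintro (i | k)
    · by_cases h : i = 0
      · simpa [hw, h] using hW0
      · simpa [hw, h] using ⟨hq0, hv'0 _⟩
    · simpa [hw] using ⟨hq0, hv0 _⟩
  set Z : Fin (m' + 1) ⊕ Fin (n' + 1) → Set ℂ := fun x => {z | ‖z‖ ≤ 1 ∧ ∃ k : ℕ, z = q ^ k * w x} with hZ
  have hlim : ∀ x, Tendsto (fun k : ℕ => q ^ k * w x) atTop (𝓝[≠] 0) := fun x => by
    refine tendsto_nhdsWithin_of_tendsto_nhds_of_eventually_within _ ?_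
      (Eventually.of_forall fun k => mul_ne_zero (pow_ne_zero _ hq0) (hw0 x))
    simpa using (tendsto_pow_atTop_nhds_zero_of_norm_lt_one hq).mul_const (w x)
  have hmain := iter_zero F hε (fun c i hc => ?_) (Sum.inr 0) Z (fun x _ => ?_) (fun i z hz => hz.1) (fun c hc => ?_)
  · simpa [hFdef, mono] using hmain
  · have hb : ∀ E, ∀ z ∈ Metric.ball (0 : ℂ) (1 + ε), ‖mono E (Function.update c i z)‖ ≤ 1 + ε := fun E z hz =>
      mono_norm E c i (by linarith) (by simpa using (Metric.mem_ball.mp hz).le) hc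
    have hb2 : ∀ {A : ℂ} {B : ℝ} {E}, ‖A‖ * (1 + ε) < B → ∀ z ∈ Metric.ball (0 : ℂ) (1 + ε),
        ‖A * mono E (Function.update c i z)‖ < B := fun {A B E} h z hz => by
      rw [norm_mul]
      exact (mul_le_mul_of_nonneg_left (hb E z hz) (norm_nonneg _)).trans_lt h
    simp only [hFdef]
    refine DD_differentiableOn (P := fun z => p * mono (fun _ => True) (Function.update c i z))
      (S := fun _ => Sum.elim s r) (v := fun z x => v x * mono (Eexp x) (Function.update c i z))
      (v' := fun z x => v' x * mono (fun y => ¬ Eexp x y) (Function.update c i z)) hq Metric.isOpen_ball ((mono_diff _ c i).const_mul p).differentiableOn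
      (fun x => differentiableOn_const _) (fun x => ((mono_diff _ c i).const_mul _).differentiableOn)
      (fun x => ((mono_diff _ c i).const_mul _).differentiableOn) (fun z hz => hb2 hε1 z hz) ?_
      (fun z hz x => hb2 (hε2 x) z hz) n' m' (fun _ => a) (differentiableOn_const _) ?_
      (fun z hz x => hb2 (hε3 x) z hz)
    · rintro _ _ (i | i)
      exacts [hs2 i, hr2 i]
    · rintro _ _ (i | i)
      exacts [has i, har i]
  · refine (hlim x).frequently (Eventually.frequently ?_)
    have h1 := ((hlim x).mono_right nhdsWithin_le_nhds).norm
    rw [norm_zero] at h1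
    filter_upwards [h1.eventually (gt_mem_nhds one_pos)] with k hk
    exact ⟨hk.le, k, rfl⟩
  · choose e he using fun i (hi : i ≠ Sum.inr 0) => (hc i hi).2
    set z : ℕ := e (Sum.inl 0) (by simp) with hz
    set κ' : Fin m' → ℕ := fun i => e (Sum.inl i.succ) (by simp) with hκ'
    set l' : Fin n' → ℕ := fun k => e (Sum.inr k.succ) (by simp) with hl'
    set κ : Fin (m' + 1) → ℕ := Fin.cons (z + ∑ k, (l' k + 1)) κ' with hκ
    set l : Fin (n' + 1) → ℕ := Fin.cons (z + ∑ i, κ' i + m') l' with hl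
    have hcne : ∀ i, i ≠ Sum.inr 0 → c i ≠ 0 := fun i hi => by
      rw [he i hi]; exact mul_ne_zero (pow_ne_zero _ hq0) (hw0 i)
    have hc1 : c (Sum.inl 0) = q ^ z * W := by rw [he _ (by simp)]; simp [hw, hz]
    have hc2 : ∀ i : Fin m', c (Sum.inl i.succ) = q ^ κ' i * (q / v' (Sum.inl i.succ)) := fun i => by
      rw [he _ (by simp)]; simp [hw, hκ']
    have hc3 : ∀ k : Fin n', c (Sum.inr k.succ) = q ^ l' k * (q / v (Sum.inr k.succ)) := fun k => by
      rw [he _ (by simp)]; simp [hw, hl']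
    have hsmall : ∀ᶠ t in 𝓝[≠] (0 : ℂ), t ≠ 0 ∧
        ‖p * mono (fun _ => True) (Function.update c (Sum.inr 0) t)‖ < ‖q‖ ^ (∑ i, κ i + ∑ k, l k + 3) := by
      refine Eventually.and self_mem_nhdsWithin ?_
      have h1 : Tendsto (fun t => ‖p * mono (fun _ => True) (Function.update c (Sum.inr 0) t)‖) (𝓝[≠] (0 : ℂ))
          (𝓝 ‖p * mono (fun _ => True) (Function.update c (Sum.inr 0) 0)‖) :=
        (Continuous.tendsto ((mono_diff _ c _).const_mul p).continuous.norm _).mono_left nhdsWithin_le_nhds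
      refine h1.eventually (gt_mem_nhds ?_)
      have : mono (fun _ => True) (Function.update c (Sum.inr 0) 0) = 0 := by
        unfold mono
        refine Finset.prod_eq_zero (Finset.mem_univ (Sum.inr 0)) (by simp)
      rw [this, mul_zero, norm_zero]
      exact pow_pos hq' _
    filter_upwards [hsmall] with t ⟨ht0, ht⟩
    set d := Function.update c (Sum.inr 0) t with hd
    set P := p * mono (fun _ => True) d with hPdef
    have hdA : ∀ i, d (Sum.inl i) = c (Sum.inl i) := fun i => by simp [hd]
    have hdB : ∀ k : Fin n', d (Sum.inr k.succ) = c (Sum.inr k.succ) := fun k => by simp [hd]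
    have hP0 : P ≠ 0 := by
      refine mul_ne_zero hp0 (Finset.prod_ne_zero_iff.mpr fun x _ => ?_)
      rw [if_pos trivial]
      by_cases hx : x = Sum.inr 0
      · subst hx; simpa [hd] using ht0
      · rw [hd, Function.update_of_ne hx]; exact hcne x hx
    have hPq : ∀ x, (v x * mono (Eexp x) d) * (v' x * mono (fun y => ¬ Eexp x y) d) = P * q := fun x => by
      have h1 : mono (fun _ => True) d = ∏ j, d j := by simp [mono]
      rw [hPdef, h1, ← mono_mul (Eexp x)]
      linear_combination (mono (Eexp x) d * mono (fun y => ¬ Eexp x y) d) * hvv x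
    have hbal : ∏ k, v (Sum.inr k) = q ^ (m' + 1) * ∏ i, (v' (Sum.inl i) / q) := by
      rw [Fintype.prod_sum_type] at hprod
      have h1 : ∏ i, v (Sum.inl i) ≠ 0 := Finset.prod_ne_zero_iff.mpr fun i _ => hv0 _
      have h2 : (∏ i, v (Sum.inl i)) * ∏ i, v' (Sum.inl i) = (p * q) ^ (m' + 1) := by
        rw [← Finset.prod_mul_distrib, Finset.prod_congr rfl fun i _ => hvv (Sum.inl i), Finset.prod_const,
          Finset.card_univ, Fintype.card_fin]
      refine mul_left_cancel₀ h1 ?_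
      rw [hprod, ← h2, Finset.prod_div_distrib, Finset.prod_const, Finset.card_univ, Fintype.card_fin]
      have := pow_ne_zero (m' + 1) hq0
      field_simp
    have hv'A : ∀ i, v' (Sum.inl i) * mono (fun y => ¬ Eexp (Sum.inl i) y) d = q ^ (κ i + 1) := by
      refine Fin.cases ?_ fun i => ?_
      · rw [mono_A0, hdA, hc1, Finset.prod_congr rfl fun k _ => (hdB k).trans (hc3 k)]
        simp only [Finset.prod_mul_distrib, Finset.prod_div_distrib, hκ, Fin.cons_zero, Finset.prod_const,
          Finset.card_univ, Fintype.card_fin, hW, Finset.prod_pow_eq_pow_sum, Finset.sum_add_distrib,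
          Finset.sum_const, pow_add, smul_eq_mul, mul_one]
        have h1 := hv'0 (Sum.inl 0)
        have h2 : ∏ k : Fin n', v (Sum.inr k.succ) ≠ 0 := Finset.prod_ne_zero_iff.mpr fun k _ => hv0 _
        field_simp
      · rw [mono_AS, hdA, hc2, hκ, Fin.cons_succ, pow_succ]
        have h1 := hv'0 (Sum.inl i.succ)
        field_simp
    have hvB : ∀ k, v (Sum.inr k) * mono (Eexp (Sum.inr k)) d = q ^ (l k + 1) := by
      refine Fin.cases ?_ fun k => ?_
      · rw [mono_B0, Fin.prod_univ_succ, hdA, hc1, Finset.prod_congr rfl fun i _ => (hdA _).trans (hc2 i)]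
        rw [Fin.prod_univ_succ, Fin.prod_univ_succ] at hbal
        simp only [Finset.prod_mul_distrib, Finset.prod_div_distrib, Finset.prod_const,
          Finset.card_univ, Fintype.card_fin] at hbal
        simp only [Finset.prod_mul_distrib, Finset.prod_div_distrib, hl, Fin.cons_zero, Finset.prod_const,
          Finset.card_univ, Fintype.card_fin, hW, Finset.prod_pow_eq_pow_sum, pow_add, pow_one]
        have h1 := hv'0 (Sum.inl 0)
        have h2 : ∏ k : Fin m', v' (Sum.inl k.succ) ≠ 0 := Finset.prod_ne_zero_iff.mpr fun k _ => hv'0 _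
        field_simp at hbal ⊢
        refine mul_left_cancel₀ (pow_ne_zero (m' + 1) hq0) ?_
        linear_combination hbal
      · rw [mono_BS, hdB, hc3, hl, Fin.cons_succ, pow_succ]
        have h1 := hv0 (Sum.inr k.succ)
        field_simp
    have e1 : (fun x => v x * mono (Eexp x) d) = Sum.elim (fun i => P / q ^ κ i) (fun k => q ^ (l k + 1)) := by
      funext x
      rcases x with i | k
      · have h := hPq (Sum.inl i)
        rw [hv'A, pow_succ, ← mul_assoc] at h
        rw [Sum.elim_inl, eq_div_iff (pow_ne_zero _ hq0)]
        exact mul_right_cancel₀ hq0 h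
      · exact hvB k
    have e2 : (fun x => v' x * mono (fun y => ¬ Eexp x y) d) =
        Sum.elim (fun i => q ^ (κ i + 1)) (fun k => P / q ^ l k) := by
      funext x
      rcases x with i | k
      · exact hv'A i
      · have h := hPq (Sum.inr k)
        rw [hvB, pow_succ] at h
        rw [Sum.elim_inr, eq_div_iff (pow_ne_zero _ hq0)]
        refine mul_right_cancel₀ hq0 ?_
        linear_combination h
    change DD P q n' m' _ a (fun x => v x * mono (Eexp x) d) (fun x => v' x * mono (fun y => ¬ Eexp x y) d) = 0
    rw [e1, e2]
    refine core hP0 hq0 hq κ l s r a hqa has hs2 har hr2 ham hgs hgr ?_ ht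
    rw [Fin.sum_univ_succ, Fin.sum_univ_succ]
    simp only [hκ, hl, Fin.cons_zero, Fin.cons_succ, Finset.sum_add_distrib, Finset.sum_const,
      Finset.card_univ, Fintype.card_fin, smul_eq_mul, mul_one]
    omega

end SD

namespace SD
open Filter Topology MeasureTheory

lemma norm_path {X L : ℂ} (hX : X ≠ 0) (hL : L.re = Real.log ‖X‖) (t : ℝ) :
    ‖X * Complex.exp ((t : ℂ) * L)‖ = Real.exp ((1 + t) * Real.log ‖X‖) := by
  rw [norm_mul, Complex.norm_exp, Complex.re_ofReal_mul, hL, add_mul, Real.exp_add, one_mul,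
    Real.exp_log (norm_pos_iff.mpr hX)]

lemma re_mean {ι : Type*} [Fintype ι] {m : ℕ} (hm : m ≠ 0) {S L : ι → ℂ} {a : ℂ} (ham : a ^ m = ∏ i, S i)
    (hS : ∀ i, S i ≠ 0) (hL : ∀ i, (L i).re = Real.log ‖S i‖) :
    ((∑ i, L i) / (m : ℂ)).re = Real.log ‖a‖ := by
  have h1 := congrArg (fun z => Real.log ‖z‖) ham
  simp only [norm_pow, Real.log_pow, norm_prod] at h1
  rw [Real.log_prod fun i _ => norm_ne_zero_iff.mpr (hS i)] at h1
  have hm' : (m : ℝ) ≠ 0 := Nat.cast_ne_zero.mpr hm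
  rw [Complex.div_natCast_re, Complex.re_sum, Finset.sum_congr rfl fun i _ => hL i, ← h1]
  field_simp

lemma path_prod {ι : Type*} [Fintype ι] {m : ℕ} (hm : m ≠ 0) {S L : ι → ℂ} {a : ℂ} (ham : a ^ m = ∏ i, S i)
    (t : ℂ) : (a * Complex.exp (t * ((∑ i, L i) / (m : ℂ)))) ^ m = ∏ i, (S i * Complex.exp (t * L i)) := by
  rw [mul_pow, ham, Finset.prod_mul_distrib, ← Complex.exp_nat_mul, ← Complex.exp_sum, ← Finset.mul_sum]
  congr 2
  have : (m : ℂ) ≠ 0 := Nat.cast_ne_zero.mpr hm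
  field_simp

lemma countable_bad {q D : ℂ} (hD : D ≠ 0) :
    {t : ℝ | ∃ j : ℤ, Complex.exp ((1 - (t : ℂ)) * D) = q ^ j}.Countable := by
  have h1 : {t : ℝ | ∃ j : ℤ, Complex.exp ((1 - (t : ℂ)) * D) = q ^ j} =
      ⋃ j : ℤ, {t : ℝ | Complex.exp ((1 - (t : ℂ)) * D) = q ^ j} := by
    ext t; simp
  rw [h1]
  refine Set.countable_iUnion fun j => ?_
  rcases Set.eq_empty_or_nonempty {t : ℝ | Complex.exp ((1 - (t : ℂ)) * D) = q ^ j} with h | ⟨t0, h0⟩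
  · rw [h]; exact Set.countable_empty
  · have h2 : {t : ℝ | Complex.exp ((1 - (t : ℂ)) * D) = q ^ j} ⊆
        ⋃ k : ℤ, {t : ℝ | (1 - (t : ℂ)) * D = (1 - (t0 : ℂ)) * D + k * (2 * Real.pi * Complex.I)} := by
      intro t ht
      have : Complex.exp ((1 - (t : ℂ)) * D) = Complex.exp ((1 - (t0 : ℂ)) * D) := by
        rw [Set.mem_setOf_eq] at ht h0; rw [ht, h0]
      obtain ⟨k, hk⟩ := Complex.exp_eq_exp_iff_exists_int.mp this
      exact Set.mem_iUnion.mpr ⟨k, hk⟩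
    refine (Set.countable_iUnion fun k => ?_).mono h2
    refine Set.Subsingleton.countable fun t ht t' ht' => ?_
    rw [Set.mem_setOf_eq] at ht ht'
    have := mul_right_cancel₀ hD (ht.trans ht'.symm)
    exact_mod_cast sub_right_injective this

set_option maxHeartbeats 1000000 in
theorem phase2 {p q : ℂ} (hp0 : p ≠ 0) (hp : ‖p‖ < 1) (hq0 : q ≠ 0) (hq : ‖q‖ < 1)
    {n' m' : ℕ} (S u : Fin (m' + 1) ⊕ Fin (n' + 1) → ℂ) (a β : ℂ) (ha0 : a ≠ 0) (hβ0 : β ≠ 0)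
    (haS : ∀ i, ‖a‖ < ‖S i‖) (hS1 : ∀ i, ‖S i‖ < 1) (hβu : ∀ i, ‖β‖ < ‖u i‖) (hu1 : ∀ i, ‖u i‖ < 1)
    (ham : a ^ (m' + 1) = ∏ i, S i) (hβm : β ^ (m' + 1) = ∏ i, u i) (hpq : a * β = p * q) :
    DD p q n' m' S a (fun i => S i * u i) (fun i => p * q / (S i * u i)) = 0 := by
  have ha' := norm_pos_iff.mpr ha0
  have hβ' := norm_pos_iff.mpr hβ0
  have hq' := norm_pos_iff.mpr hq0
  have hS0 : ∀ i, S i ≠ 0 := fun i => norm_pos_iff.mp (ha'.trans (haS i))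
  have hu0 : ∀ i, u i ≠ 0 := fun i => norm_pos_iff.mp (hβ'.trans (hβu i))
  have hla : Real.log ‖a‖ < 0 := Real.log_neg ha' ((haS (Sum.inl 0)).trans (hS1 _))
  have hlβ : Real.log ‖β‖ < 0 := Real.log_neg hβ' ((hβu (Sum.inl 0)).trans (hu1 _))
  -- distinct logarithms
  obtain ⟨L, hLexp, hLinj⟩ : ∃ L : Fin (m' + 1) ⊕ Fin (n' + 1) → ℂ, (∀ i, Complex.exp (L i) = S i) ∧
      Function.Injective L := by
    let e := Fintype.equivFin (Fin (m' + 1) ⊕ Fin (n' + 1))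
    have hL : ∀ i, Complex.exp (Complex.log (S i) + ((e i : ℕ) : ℂ) * (2 * Real.pi * Complex.I)) = S i := fun i => by
      rw [Complex.exp_add, Complex.exp_log (hS0 i), Complex.exp_nat_mul_two_pi_mul_I, mul_one]
    refine ⟨fun i => Complex.log (S i) + ((e i : ℕ) : ℂ) * (2 * Real.pi * Complex.I), hL, fun i k hik => ?_⟩
    simp only at hik
    have h1 : S i = S k := by rw [← hL i, ← hL k, hik]
    rw [h1] at hik
    have h2 := mul_right_cancel₀ Complex.two_pi_I_ne_zero (add_left_cancel hik)
    exact e.injective (Fin.ext (by exact_mod_cast h2))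
  have hLre : ∀ i, (L i).re = Real.log ‖S i‖ := fun i => by
    rw [← hLexp i, Complex.norm_exp, Real.log_exp]
  have hLure : ∀ i, (Complex.log (u i)).re = Real.log ‖u i‖ := fun i => Complex.log_re _
  set Λ : ℂ := (∑ i, L i) / ((m' + 1 : ℕ) : ℂ) with hΛ
  set Λu : ℂ := (∑ i, Complex.log (u i)) / ((m' + 1 : ℕ) : ℂ) with hΛu
  have hΛre : Λ.re = Real.log ‖a‖ := re_mean (Nat.succ_ne_zero _) ham hS0 hLre
  have hΛure : Λu.re = Real.log ‖β‖ := re_mean (Nat.succ_ne_zero _) hβm hu0 hLure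
  set M : ℝ := Real.log ‖a‖ / Real.log ‖β‖ with hM
  have hM0 : 0 < M := div_pos_of_neg_of_neg hla hlβ
  have hMβ : M * Real.log ‖β‖ = Real.log ‖a‖ := div_mul_cancel₀ _ hlβ.ne
  set St : ℂ → Fin (m' + 1) ⊕ Fin (n' + 1) → ℂ := fun τ i => S i * Complex.exp (-τ * L i) with hSt
  set ut : ℂ → Fin (m' + 1) ⊕ Fin (n' + 1) → ℂ := fun τ i => u i * Complex.exp (M * τ * Complex.log (u i)) with hut
  set At : ℂ → ℂ := fun τ => a * Complex.exp (-τ * Λ) with hAt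
  set Bt : ℂ → ℂ := fun τ => β * Complex.exp (M * τ * Λu) with hBt
  have hStn : ∀ (t : ℝ) i, ‖St t i‖ = Real.exp ((1 - t) * Real.log ‖S i‖) := fun t i => by
    have := norm_path (hS0 i) (hLre i) (-t)
    rw [Complex.ofReal_neg] at this
    rw [hSt, this]; ring_nf
  have hAtn : ∀ (t : ℝ), ‖At t‖ = Real.exp ((1 - t) * Real.log ‖a‖) := fun t => by
    have := norm_path ha0 hΛre (-t)
    rw [Complex.ofReal_neg] at this
    rw [hAt, this]; ring_nf
  have hutn : ∀ (t : ℝ) i, ‖ut t i‖ = Real.exp ((1 + M * t) * Real.log ‖u i‖) := fun t i => by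
    have := norm_path (hu0 i) (hLure i) (M * t)
    rw [Complex.ofReal_mul] at this
    rw [hut, this]
  have hBtn : ∀ (t : ℝ), ‖Bt t‖ = Real.exp ((1 + M * t) * Real.log ‖β‖) := fun t => by
    have := norm_path hβ0 hΛure (M * t)
    rw [Complex.ofReal_mul] at this
    rw [hBt, this]
  have hSt0 : ∀ τ i, St τ i ≠ 0 := fun τ i => mul_ne_zero (hS0 i) (Complex.exp_ne_zero _)
  have hut0 : ∀ τ i, ut τ i ≠ 0 := fun τ i => mul_ne_zero (hu0 i) (Complex.exp_ne_zero _)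
  have hAt0 : ∀ τ, At τ ≠ 0 := fun τ => mul_ne_zero ha0 (Complex.exp_ne_zero _)
  have hBt0 : ∀ τ, Bt τ ≠ 0 := fun τ => mul_ne_zero hβ0 (Complex.exp_ne_zero _)
  have dSt : ∀ i, Differentiable ℂ fun τ => St τ i := fun i => by simp only [hSt]; fun_prop
  have dut : ∀ i, Differentiable ℂ fun τ => ut τ i := fun i => by simp only [hut]; fun_prop
  have dAt : Differentiable ℂ At := by simp only [hAt]; fun_prop
  have dBt : Differentiable ℂ Bt := by simp only [hBt]; fun_prop
  set D : ℂ → ℂ := fun τ => DD (At τ * Bt τ / q) q n' m' (St τ) (At τ) (fun i => St τ i * ut τ i)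
    (fun i => At τ * Bt τ / (St τ i * ut τ i)) with hD
  set U : Set ℂ := {τ | ‖At τ * Bt τ / q‖ < 1 ∧ (∀ i, ‖St τ i‖ < 1) ∧ (∀ i, ‖At τ‖ < ‖St τ i‖) ∧
    (∀ i, ‖ut τ i‖ < 1) ∧ ∀ i, ‖Bt τ‖ < ‖ut τ i‖} with hU
  have hUo : IsOpen U := by
    have cS := fun i => (dSt i).continuous
    have cu := fun i => (dut i).continuous
    have cA := dAt.continuous
    have cB := dBt.continuous
    refine IsOpen.and (isOpen_lt (by fun_prop) (by fun_prop)) (IsOpen.and ?_ (IsOpen.and ?_ (IsOpen.and ?_ ?_))) <;>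
    · simp only [Set.ofPred_forall]
      refine isOpen_iInter_of_finite fun i => isOpen_lt ?_ ?_ <;> fun_prop
  have hDd : DifferentiableOn ℂ D U := by
    refine DD_differentiableOn (P := fun τ => At τ * Bt τ / q) (S := St) (v := fun τ i => St τ i * ut τ i)
      (v' := fun τ i => At τ * Bt τ / (St τ i * ut τ i)) hq hUo ((dAt.fun_mul dBt).div_const q).differentiableOn
      (fun i => (dSt i).differentiableOn) (fun i => ((dSt i).fun_mul (dut i)).differentiableOn)
      (fun i => ((dAt.fun_mul dBt).fun_div ((dSt i).fun_mul (dut i)) fun τ =>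
        mul_ne_zero (hSt0 τ i) (hut0 τ i)).differentiableOn)
      (fun τ hτ => hτ.1) (fun τ hτ => hτ.2.1) (fun τ hτ i => ?_) n' m' At dAt.differentiableOn
      (fun τ hτ => hτ.2.2.1) (fun τ hτ i => ?_)
    · rw [norm_mul (St τ i) (ut τ i)]
      exact mul_lt_of_lt_one_right (norm_pos_iff.mpr (hSt0 τ i)) (hτ.2.2.2.1 i)
    · have h1 := norm_pos_iff.mpr (hSt0 τ i)
      have h2 := norm_pos_iff.mpr (hut0 τ i)
      have h3 := norm_pos_iff.mpr (hAt0 τ)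
      rw [norm_div, norm_div, norm_mul (At τ) (Bt τ), norm_mul (St τ i) (ut τ i), div_lt_div_iff₀ (mul_pos h1 h2) h1]
      have := hτ.2.2.2.2 i
      have h4 := mul_pos h1 h3
      nlinarith
  have hseg : ∀ t : ℝ, 0 ≤ t → t < 1 → (t : ℂ) ∈ U := by
    intro t h0 h1
    have h2 : 0 < 1 - t := by linarith
    have h3 : 0 < 1 + M * t := by positivity
    refine ⟨?_, fun i => ?_, fun i => ?_, fun i => ?_, fun i => ?_⟩
    · have e1 : ‖At t * Bt t / q‖ = ‖p‖ := by
        have := congrArg norm hpq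
        rw [norm_mul, norm_mul] at this
        rw [norm_div, norm_mul (At t) (Bt t), hAtn, hBtn, ← Real.exp_add, div_eq_iff hq'.ne', ← this]
        rw [show ‖a‖ * ‖β‖ = Real.exp (Real.log ‖a‖ + Real.log ‖β‖) by
          rw [Real.exp_add, Real.exp_log ha', Real.exp_log hβ']]
        congr 1
        linear_combination t * hMβ
      rw [e1]; exact hp
    · rw [hStn, Real.exp_lt_one_iff]
      exact mul_neg_of_pos_of_neg h2 (Real.log_neg (norm_pos_iff.mpr (hS0 i)) (hS1 i))
    · rw [hStn, hAtn, Real.exp_lt_exp]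
      exact mul_lt_mul_of_pos_left (Real.log_lt_log ha' (haS i)) h2
    · rw [hutn, Real.exp_lt_one_iff]
      exact mul_neg_of_pos_of_neg h3 (Real.log_neg (norm_pos_iff.mpr (hu0 i)) (hu1 i))
    · rw [hutn, hBtn, Real.exp_lt_exp]
      exact mul_lt_mul_of_pos_left (Real.log_lt_log hβ' (hβu i)) h3
  -- the bad set
  set bad : Set ℝ := ⋃ x : {x : (Fin (m' + 1) ⊕ Fin (n' + 1)) × (Fin (m' + 1) ⊕ Fin (n' + 1)) // x.1 ≠ x.2},
    {t : ℝ | ∃ j : ℤ, Complex.exp ((1 - (t : ℂ)) * (L x.1.1 - L x.1.2)) = q ^ j} with hbad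
  have hbadc : bad.Countable := Set.countable_iUnion fun x =>
    countable_bad (sub_ne_zero.mpr fun h => x.2 (hLinj h))
  have hgood : ∀ t : ℝ, t ∉ bad → ∀ i k, i ≠ k → ∀ j : ℤ, St t i / St t k ≠ q ^ j := by
    intro t ht i k hik j h
    apply ht
    refine Set.mem_iUnion.mpr ⟨⟨(i, k), hik⟩, j, ?_⟩
    rw [← h]
    simp only [hSt]
    rw [← hLexp i, ← hLexp k, ← Complex.exp_add, ← Complex.exp_add, ← Complex.exp_sub]
    congr 1; ring
  -- close to the end of the path
  obtain ⟨t1, ht10, ht11, ht1⟩ : ∃ t1 : ℝ, 0 ≤ t1 ∧ t1 < 1 ∧ ∀ t, t1 < t → ‖q‖ < ‖At t‖ := by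
    have h1 : Tendsto (fun t : ℝ => Real.exp ((1 - t) * Real.log ‖a‖)) (𝓝[<] 1)
        (𝓝 (Real.exp ((1 - 1) * Real.log ‖a‖))) :=
      (Continuous.tendsto (by fun_prop) _).mono_left nhdsWithin_le_nhds
    rw [sub_self, zero_mul, Real.exp_zero] at h1
    have h2 := (h1.eventually (lt_mem_nhds hq)).and
      ((eventually_nhdsWithin_of_eventually_nhds (lt_mem_nhds (zero_lt_one (α := ℝ)))).and self_mem_nhdsWithin)
    obtain ⟨t1, h3, h4, h5⟩ := h2.exists
    refine ⟨t1, h4.le, h5, fun t ht => h3.trans ?_⟩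
    rw [hAtn, Real.exp_lt_exp]
    nlinarith
  have hzero : ∀ t : ℝ, t1 < t → t < 1 → t ∉ bad → D t = 0 := by
    intro t h1 h2 h3
    obtain ⟨c1, c2, c3, c4, c5⟩ := hseg t (ht10.trans h1.le) h2
    have hel : St t = Sum.elim (fun i => St t (Sum.inl i)) (fun k => St t (Sum.inr k)) := by
      funext x; rcases x with x | x <;> rfl
    have hAS : At t ^ (m' + 1) = ∏ i, St t i := path_prod (Nat.succ_ne_zero _) ham _
    have hBu : Bt t ^ (m' + 1) = ∏ i, ut t i := path_prod (Nat.succ_ne_zero _) hβm _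
    have hPq : At t * Bt t / q * q = At t * Bt t := div_mul_cancel₀ _ hq0
    simp only [hD]
    have := phase1 (p := At t * Bt t / q) (div_ne_zero (mul_ne_zero (hAt0 _) (hBt0 _)) hq0) c1 hq0 hq
      (fun i => St t (Sum.inl i)) (fun k => St t (Sum.inr k)) (At t) (ht1 t h1) (fun i => c3 _) (fun i => c2 _)
      (fun i => c3 _) (fun i => c2 _) (by rw [hAS, Fintype.prod_sum_type])
      (fun i k hik => hgood t h3 _ _ (by simpa using hik)) (fun i k hik => hgood t h3 _ _ (by simpa using hik))
      (fun i => St t i * ut t i) (fun i => At t * Bt t / (St t i * ut t i))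
      (fun x => by rw [hPq, mul_div_cancel₀ _ (mul_ne_zero (hSt0 _ x) (hut0 _ x))])
      (by rw [hPq, Finset.prod_mul_distrib, mul_pow, hAS, hBu])
      (fun x => by
        rw [← hel, norm_mul (St t x) (ut t x)]
        exact mul_lt_of_lt_one_right (norm_pos_iff.mpr (hSt0 _ x)) (c4 x))
      (fun x => by
        have h1 := norm_pos_iff.mpr (hSt0 t x)
        have h2 := norm_pos_iff.mpr (hut0 t x)
        have h3 := norm_pos_iff.mpr (hAt0 t)
        rw [← hel, norm_div, norm_div, norm_mul (At t) (Bt t), norm_mul (St t x) (ut t x), div_lt_div_iff₀ (mul_pos h1 h2) h1]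
        have := c5 x
        have h4 := mul_pos h1 h3
        nlinarith)
    rwa [← hel] at this
  have hfreq : ∃ᶠ z in 𝓝[≠] (t1 : ℂ), D z = 0 := by
    have hfr : ∃ᶠ t in 𝓝[>] t1, D ((t : ℝ) : ℂ) = 0 := by
      intro hcon
      obtain ⟨δ, hδ, hsub⟩ := mem_nhdsGT_iff_exists_Ioo_subset.mp hcon
      have hd : Dense badᶜ := hbadc.dense_compl ℝ
      obtain ⟨t, ht, htb⟩ := hd.inter_open_nonempty (Set.Ioo t1 (min δ 1)) isOpen_Ioo
        (Set.nonempty_Ioo.mpr (lt_min hδ ht11))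
      exact hsub ⟨ht.1, ht.2.trans_le (min_le_left _ _)⟩
        (hzero t ht.1 (ht.2.trans_le (min_le_right _ _)) htb)
    have hten : Tendsto (fun t : ℝ => (t : ℂ)) (𝓝[>] t1) (𝓝[≠] (t1 : ℂ)) := by
      refine tendsto_nhdsWithin_of_tendsto_nhds_of_eventually_within _
        ((Complex.continuous_ofReal.tendsto _).mono_left nhdsWithin_le_nhds) ?_
      filter_upwards [self_mem_nhdsWithin] with t ht
      simpa using (ne_of_gt ht)
    exact hten.frequently hfr
  have hconn : IsPreconnected ((fun t : ℝ => (t : ℂ)) '' Set.Ico 0 1) :=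
    isPreconnected_Ico.image _ Complex.continuous_ofReal.continuousOn
  have hsubU : (fun t : ℝ => (t : ℂ)) '' Set.Ico 0 1 ⊆ U := by
    rintro _ ⟨t, ht, rfl⟩
    exact hseg t ht.1 ht.2
  have hfin := ((hDd.analyticOnNhd hUo).mono hsubU).eqOn_zero_of_preconnected_of_frequently_eq_zero hconn
    ⟨t1, ⟨ht10, ht11⟩, rfl⟩ hfreq (x := ((0 : ℝ) : ℂ)) ⟨0, ⟨le_rfl, one_pos⟩, rfl⟩
  have e0 : D ((0 : ℝ) : ℂ) = DD p q n' m' S a (fun i => S i * u i) (fun i => p * q / (S i * u i)) := by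
    simp only [hD, hSt, hAt, hBt, hut, Complex.ofReal_zero, neg_zero, zero_mul, mul_zero, Complex.exp_zero, mul_one]
    rw [hpq, mul_div_cancel_right₀ _ hq0]
  rw [← e0, hfin]; rfl

end SD

namespace SD
open Filter Topology MeasureTheory

lemma prod_filter_lt {n : ℕ} (g : Fin n → Fin n → ℂ) :
    ∏ ij ∈ Finset.univ.filter (fun ij : Fin n × Fin n => ij.1 < ij.2), g ij.1 ij.2 = PP g := by
  rw [Finset.prod_filter, Fintype.prod_prod_type]; rfl

lemma integrand_eq {p q : ℂ} (hp : ‖p‖ < 1) (hq : ‖q‖ < 1) {ι : Type*} [Fintype ι] {n : ℕ}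
    (S u v v' : ι → ℂ) (hS : ∀ i, S i ≠ 0) (hu : ∀ i, u i ≠ 0) (hv : ∀ i, v i = S i * u i)
    (hv' : ∀ i, v' i = p * q / v i) (z : Fin n → ℂ) (hz : ∀ j, z j ≠ 0) :
    (∏ i, ∏ j, ellGamma (S i * z j) p q * ellGamma (u i * (z j)⁻¹) p q) /
      (∏ ij ∈ Finset.univ.filter (fun ij : Fin n × Fin n => ij.1 < ij.2),
        ellGamma (z ij.1 * (z ij.2)⁻¹) p q * ellGamma ((z ij.1)⁻¹ * z ij.2) p q) = Je p q S v v' z := by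
  rw [prod_filter_lt (fun i j => ellGamma (z i * (z j)⁻¹) p q * ellGamma ((z i)⁻¹ * z j) p q), div_eq_mul_inv, Je,
    Finset.prod_comm]
  congr 1
  · refine Finset.prod_congr rfl fun j _ => Finset.prod_congr rfl fun i _ => ?_
    rw [ellGamma_eq hp hq, ellGamma_eq hp hq, FE, div_mul_div_comm]
    have h1 : p * q / (u i * (z j)⁻¹) = v' i * (S i * z j) := by
      rw [hv', hv]; have := hS i; have := hu i; have := hz j; field_simp
    have h2 : u i * (z j)⁻¹ = v i / (S i * z j) := by
      rw [hv]; have := hS i; have := hz j; field_simp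
    rw [h1, h2]
  · unfold PP
    rw [← Finset.prod_inv_distrib]
    refine Finset.prod_congr rfl fun i _ => ?_
    rw [← Finset.prod_inv_distrib]
    refine Finset.prod_congr rfl fun j _ => ?_
    split_ifs
    · have e1 : z i * (z j)⁻¹ = z i / z j := rfl
      have e2 : (z i)⁻¹ * z j = (z i / z j)⁻¹ := by rw [inv_div, mul_comm]; rfl
      have e3 : p * q / (z i / z j)⁻¹ = p * q * (z i / z j) := by rw [div_inv_eq_mul]
      beta_reduce
      rw [ellGamma_eq hp hq, ellGamma_eq hp hq, e1, e2, e3, GE, div_mul_div_comm, inv_div,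
        mul_comm (EE (p * q / (z i / z j)) p q)]
    · exact inv_one

lemma torus_cInt (n : ℕ) (F : (Fin (n + 1) → ℂ) → ℂ)
    (hF : Continuous fun x : Fin (n + 1) → UnitAddCircle => F fun j => ex (x j)) :
    torusInt (n + 1 - 1) (fun z => F (zfull (n + 1) z)) = cInt n (fun x => F fun j => ex (x j)) 0 := by
  have key : ∀ w : Fin n → UnitAddCircle, zfull (n + 1) (fun j : Fin n => ex (w j)) =
      fun j => ex (Fin.snoc (α := fun _ => UnitAddCircle) w (0 - ∑ j, w j) j) := by
    intro w
    funext j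
    refine Fin.lastCases ?_ (fun j => ?_) j
    · simp only [zfull, Fin.snoc_last, Fin.val_last]
      rw [dif_neg (by simp), zero_sub, ex_neg, ex_sum]
      rfl
    · simp only [zfull, Fin.snoc_castSucc, Fin.val_castSucc]
      rw [dif_pos (by simp)]
      rfl
  change torusInt n (fun z => F (zfull (n + 1) z)) = _
  rw [torusInt_eq, cInt]
  · simp only [key]
  · simp only [key]
    exact (cInt_aux hF).comp (Continuous.prodMk continuous_const continuous_id : Continuous fun z : Fin n → UnitAddCircle =>
        ((0 : UnitAddCircle), z))

lemma torus_JJ {p q : ℂ} (hp : ‖p‖ < 1) (hq : ‖q‖ < 1) {ι : Type*} [Fintype ι] (n : ℕ)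
    (S u v v' : ι → ℂ) (hS : ∀ i, S i ≠ 0) (hu : ∀ i, u i ≠ 0) (hv : ∀ i, v i = S i * u i)
    (hv' : ∀ i, v' i = p * q / v i) (hS1 : ∀ i, ‖S i‖ < 1) (hu1 : ∀ i, ‖u i‖ < 1) :
    torusInt (n + 1 - 1) (fun z =>
      (∏ i, ∏ j : Fin (n + 1), ellGamma (S i * zfull (n + 1) z j) p q * ellGamma (u i * (zfull (n + 1) z j)⁻¹) p q) /
      ∏ ij ∈ Finset.univ.filter (fun ij : Fin (n + 1) × Fin (n + 1) => ij.1 < ij.2),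
        ellGamma (zfull (n + 1) z ij.1 * (zfull (n + 1) z ij.2)⁻¹) p q *
          ellGamma ((zfull (n + 1) z ij.1)⁻¹ * zfull (n + 1) z ij.2) p q) = JJ p q S v v' n := by
  have key : ∀ x : Fin (n + 1) → UnitAddCircle, _ := fun x =>
    integrand_eq hp hq S u v v' hS hu hv hv' (fun j => ex (x j)) (fun j => ex_ne_zero _)
  rw [torus_cInt n (fun z : Fin (n + 1) → ℂ => (∏ i, ∏ j, ellGamma (S i * z j) p q * ellGamma (u i * (z j)⁻¹) p q) /
      (∏ ij ∈ Finset.univ.filter (fun ij : Fin (n + 1) × Fin (n + 1) => ij.1 < ij.2),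
        ellGamma (z ij.1 * (z ij.2)⁻¹) p q * ellGamma ((z ij.1)⁻¹ * z ij.2) p q)), JJ]
  · simp only [key]
  · simp only [key]
    rw [← continuousOn_univ]
    refine Je_continuousOn hq (P := fun _ => p) (S := fun _ => S) (v := fun _ => v) (v' := fun _ => v')
      continuousOn_const (fun i => continuousOn_const) (fun i => continuousOn_const) (fun i => continuousOn_const)
      (fun j => Continuous.continuousOn (by fun_prop)) (fun _ _ => hp) (fun _ _ j => norm_ex _) (fun _ _ => hS1)
      (fun _ _ i => ?_)
    rw [hv, norm_mul]
    exact mul_lt_of_lt_one_right (norm_pos_iff.mpr (hS i)) (hu1 i)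

theorem main_aux (n' m' Nf : ℕ) (hNf : (m' + 1) + (n' + 1) = Nf)
    (p q : ℂ) (hp0 : 0 < ‖p‖) (hp1 : ‖p‖ < 1)
    (hq0 : 0 < ‖q‖) (hq1 : ‖q‖ < 1)
    (s t : Fin Nf → ℂ) (a b : ℂ) (ha0 : a ≠ 0) (hb0 : b ≠ 0)
    (hs0 : ∀ i, s i ≠ 0) (ht0 : ∀ i, t i ≠ 0)
    (haS : a ^ (m' + 1) = ∏ i, s i) (hbT : b ^ (m' + 1) = ∏ i, t i)
    (hab : a = p * q * b)
    (hslo : ∀ i, ‖a‖ < ‖s i‖) (hshi : ∀ i, ‖s i‖ < 1)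
    (htlo : ∀ i, 1 < ‖t i‖) (hthi : ∀ i, ‖t i‖ < ‖b‖) :
    pochInf p p ^ (n' + 1 - 1) * pochInf q q ^ (n' + 1 - 1) / ((n' + 1).factorial : ℂ) *
      torusInt (n' + 1 - 1) (fun z =>
        (∏ i : Fin Nf, ∏ j : Fin (n' + 1),
            ellGamma (s i * zfull (n' + 1) z j) p q * ellGamma ((t i)⁻¹ * (zfull (n' + 1) z j)⁻¹) p q) /
        ∏ ij ∈ Finset.univ.filter (fun ij : Fin (n' + 1) × Fin (n' + 1) => ij.1 < ij.2),
            ellGamma (zfull (n' + 1) z ij.1 * (zfull (n' + 1) z ij.2)⁻¹) p q *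
              ellGamma ((zfull (n' + 1) z ij.1)⁻¹ * zfull (n' + 1) z ij.2) p q) =
    pochInf p p ^ (m' + 1 - 1) * pochInf q q ^ (m' + 1 - 1) / ((m' + 1).factorial : ℂ) *
      (∏ i : Fin Nf, ∏ j : Fin Nf, ellGamma (s i * (t j)⁻¹) p q) *
      torusInt (m' + 1 - 1) (fun z =>
        (∏ i : Fin Nf, ∏ j : Fin (m' + 1),
            ellGamma (a * (s i)⁻¹ * zfull (m' + 1) z j) p q *
              ellGamma (b⁻¹ * t i * (zfull (m' + 1) z j)⁻¹) p q) /
        ∏ ij ∈ Finset.univ.filter (fun ij : Fin (m' + 1) × Fin (m' + 1) => ij.1 < ij.2),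
            ellGamma (zfull (m' + 1) z ij.1 * (zfull (m' + 1) z ij.2)⁻¹) p q *
              ellGamma ((zfull (m' + 1) z ij.1)⁻¹ * zfull (m' + 1) z ij.2) p q) := by
  have hp : p ≠ 0 := norm_pos_iff.mp hp0
  have hq : q ≠ 0 := norm_pos_iff.mp hq0
  have hb' : 0 < ‖b‖ := norm_pos_iff.mpr hb0
  have hs' : ∀ i, 0 < ‖s i‖ := fun i => norm_pos_iff.mpr (hs0 i)
  have ht' : ∀ i, 0 < ‖t i‖ := fun i => norm_pos_iff.mpr (ht0 i)
  rw [torus_JJ hp1 hq1 n' s (fun i => (t i)⁻¹) (fun i => s i * (t i)⁻¹) (fun i => p * q / (s i * (t i)⁻¹)) hs0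
    (fun i => inv_ne_zero (ht0 i)) (fun i => rfl) (fun i => rfl) hshi
    (fun i => by rw [norm_inv]; exact inv_lt_one_of_one_lt₀ (htlo i)),
    torus_JJ hp1 hq1 m' (fun i => a * (s i)⁻¹) (fun i => b⁻¹ * t i) (fun i => p * q / (s i * (t i)⁻¹))
    (fun i => s i * (t i)⁻¹)
    (fun i => mul_ne_zero ha0 (inv_ne_zero (hs0 i))) (fun i => mul_ne_zero (inv_ne_zero hb0) (ht0 i))
    (fun i => by have := hs0 i; have := ht0 i; rw [hab]; field_simp)
    (fun i => by have := hs0 i; have := ht0 i; field_simp)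
    (fun i => by rw [norm_mul, norm_inv, ← div_eq_mul_inv, div_lt_one (hs' i)]; exact hslo i)
    (fun i => by rw [norm_mul, norm_inv, inv_mul_lt_one₀ hb']; exact hthi i)]
  let e : Fin (m' + 1) ⊕ Fin (n' + 1) ≃ Fin Nf := finSumFinEquiv.trans (finCongr hNf)
  have h := phase2 hp hp1 hq hq1 (fun i => s (e i)) (fun i => (t (e i))⁻¹) a b⁻¹ ha0 (inv_ne_zero hb0)
    (fun i => hslo _) (fun i => hshi _)
    (fun i => by rw [norm_inv, norm_inv]; exact inv_strictAnti₀ (ht' _) (hthi _))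
    (fun i => by rw [norm_inv]; exact inv_lt_one_of_one_lt₀ (htlo _))
    (by rw [haS]; exact (Equiv.prod_comp e s).symm)
    (by rw [inv_pow, hbT, ← Finset.prod_inv_distrib]; exact (Equiv.prod_comp e fun i => (t i)⁻¹).symm)
    (by rw [hab]; field_simp)
  rw [DD_equiv p q e n' m' s a (fun i => s i * (t i)⁻¹) (fun i => p * q / (s i * (t i)⁻¹)), DD, sub_eq_zero] at h
  have hpref : (∏ i : Fin Nf, ∏ j : Fin Nf, ellGamma (s i * (t j)⁻¹) p q) =
      pref p q s (fun i => s i * (t i)⁻¹) (fun i => p * q / (s i * (t i)⁻¹)) := by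
    refine Finset.prod_congr rfl fun x _ => Finset.prod_congr rfl fun y _ => ?_
    have h1 := hs0 x
    have h2 := hs0 y
    have h3 := ht0 y
    have e1 : s y * (t y)⁻¹ * (s x / s y) = s x * (t y)⁻¹ := by field_simp
    have e2 : p * q / (s y * (t y)⁻¹) / (s x / s y) = p * q / (s x * (t y)⁻¹) := by field_simp
    rw [ellGamma_eq hp1 hq1, e1, e2]
  rw [hpref]
  exact h

end SD

/-- Equality of the electric and magnetic superconformal indices for Seiberg's
duality of `SU(N)` SQCD with `N_f` flavors (the `A_{N-1} ↔ A_{Ñ-1}` symmetry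
transformation of elliptic hypergeometric integrals, `Ñ = N_f - N`). -/
theorem seiberg_duality_SU_index (N Nf : ℕ) (hN : 2 ≤ N) (hNf : N + 2 ≤ Nf)
    (p q : ℂ) (hp0 : 0 < ‖p‖) (hp1 : ‖p‖ < 1)
    (hq0 : 0 < ‖q‖) (hq1 : ‖q‖ < 1)
    (s t : Fin Nf → ℂ) (a b : ℂ) (ha0 : a ≠ 0) (hb0 : b ≠ 0)
    (hs0 : ∀ i, s i ≠ 0) (ht0 : ∀ i, t i ≠ 0)
    (haS : a ^ (Nf - N) = ∏ i, s i) (hbT : b ^ (Nf - N) = ∏ i, t i)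
    (hab : a = p * q * b)
    (hslo : ∀ i, ‖a‖ < ‖s i‖) (hshi : ∀ i, ‖s i‖ < 1)
    (htlo : ∀ i, 1 < ‖t i‖) (hthi : ∀ i, ‖t i‖ < ‖b‖) :
    pochInf p p ^ (N - 1) * pochInf q q ^ (N - 1) / (N.factorial : ℂ) *
      torusInt (N - 1) (fun z =>
        (∏ i : Fin Nf, ∏ j : Fin N,
            ellGamma (s i * zfull N z j) p q * ellGamma ((t i)⁻¹ * (zfull N z j)⁻¹) p q) /
        ∏ ij ∈ Finset.univ.filter (fun ij : Fin N × Fin N => ij.1 < ij.2),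
            ellGamma (zfull N z ij.1 * (zfull N z ij.2)⁻¹) p q *
              ellGamma ((zfull N z ij.1)⁻¹ * zfull N z ij.2) p q) =
    pochInf p p ^ (Nf - N - 1) * pochInf q q ^ (Nf - N - 1) / ((Nf - N).factorial : ℂ) *
      (∏ i : Fin Nf, ∏ j : Fin Nf, ellGamma (s i * (t j)⁻¹) p q) *
      torusInt (Nf - N - 1) (fun z =>
        (∏ i : Fin Nf, ∏ j : Fin (Nf - N),
            ellGamma (a * (s i)⁻¹ * zfull (Nf - N) z j) p q *
              ellGamma (b⁻¹ * t i * (zfull (Nf - N) z j)⁻¹) p q) /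
        ∏ ij ∈ Finset.univ.filter (fun ij : Fin (Nf - N) × Fin (Nf - N) => ij.1 < ij.2),
            ellGamma (zfull (Nf - N) z ij.1 * (zfull (Nf - N) z ij.2)⁻¹) p q *
              ellGamma ((zfull (Nf - N) z ij.1)⁻¹ * zfull (Nf - N) z ij.2) p q) := by
  obtain ⟨n', rfl⟩ : ∃ n', N = n' + 1 := ⟨N - 1, by omega⟩
  have hsum : (Nf - (n' + 1)) + (n' + 1) = Nf := by omega
  have hpos : 0 < Nf - (n' + 1) := by omega
  generalize Nf - (n' + 1) = M at *
  obtain ⟨m', rfl⟩ : ∃ m', M = m' + 1 := ⟨M - 1, by omega⟩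
  exact SD.main_aux n' m' Nf hsum p q hp0 hp1 hq0 hq1 s t a b ha0 hb0 hs0 ht0 haS hbT hab hslo hshi htlo hthi
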